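/- General semiclassical Carleman estimate (Proposition 2.3). Let n ≥ 2 and let Ω ⋐ Ω̃ be open subsets of ℝⁿ with the closure of Ω compact and contained in Ω̃. Let φ : Ω̃ → ℝ be smooth with ∇φ(x) ≠ 0 for all x ∈ Ω̃, and assume that for every x ∈ Ω̃ and ξ ∈ ℝⁿ with a(x,ξ) = 0 and b(x,ξ) = 0 one has {a,b}(x,ξ) ≥ 0. Let A : Ω → ℂⁿ be bounded and Lipschitz and q : Ω → ℂ be bounded measurable. Then there exist C > 0 and h₀ ∈ (0,1) such that for all h ∈ (0,h₀) and all w ∈ C_c^∞(Ω): h²·(‖w‖²_{L²(Ω)} + h²‖∇w‖²_{L²(Ω)}) ≤ C·‖e^{φ/h} h⁴ L_{A,q}(e^{−φ/h} w)‖²_{L²(Ω)}. -/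

import Mathlib

open MeasureTheory Real Set

noncomputable section

def pd {n : ℕ} (j : Fin n) (u : EuclideanSpace ℝ (Fin n) → ℂ) :
    EuclideanSpace ℝ (Fin n) → ℂ :=
  fun x => fderiv ℝ u x (EuclideanSpace.single j 1)

def pdR {n : ℕ} (j : Fin n) (φ : EuclideanSpace ℝ (Fin n) → ℝ) :
    EuclideanSpace ℝ (Fin n) → ℝ :=
  fun x => fderiv ℝ φ x (EuclideanSpace.single j 1)

def opL {n : ℕ} (A : EuclideanSpace ℝ (Fin n) → Fin n → ℂ)
    (q : EuclideanSpace ℝ (Fin n) → ℂ) (u : EuclideanSpace ℝ (Fin n) → ℂ) :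
    EuclideanSpace ℝ (Fin n) → ℂ :=
  fun x => (∑ j : Fin n, (pd j)^[4] u x)
    - Complex.I * (∑ j : Fin n, A x j * pd j u x) + q x * u x

def IsCcInfty {n : ℕ} (Ω : Set (EuclideanSpace ℝ (Fin n)))
    (w : EuclideanSpace ℝ (Fin n) → ℂ) : Prop :=
  ContDiff ℝ (⊤ : ℕ∞) w ∧ HasCompactSupport w ∧ tsupport w ⊆ Ω

def l2sq {n : ℕ} (Ω : Set (EuclideanSpace ℝ (Fin n)))
    (f : EuclideanSpace ℝ (Fin n) → ℂ) : ℝ :=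
  ∫ x in Ω, ‖f x‖ ^ 2

def l2norm {n : ℕ} (Ω : Set (EuclideanSpace ℝ (Fin n)))
    (f : EuclideanSpace ℝ (Fin n) → ℂ) : ℝ :=
  Real.sqrt (l2sq Ω f)

def gradsq {n : ℕ} (Ω : Set (EuclideanSpace ℝ (Fin n)))
    (w : EuclideanSpace ℝ (Fin n) → ℂ) : ℝ :=
  ∫ x in Ω, ∑ j : Fin n, ‖pd j w x‖ ^ 2

def BddLipOn {n : ℕ} (Ω : Set (EuclideanSpace ℝ (Fin n)))
    (A : EuclideanSpace ℝ (Fin n) → Fin n → ℂ) : Prop :=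
  (∃ M, ∀ x ∈ Ω, ‖A x‖ ≤ M) ∧ ∃ K, LipschitzOnWith K A Ω

def BddMeasOn {n : ℕ} (Ω : Set (EuclideanSpace ℝ (Fin n)))
    (q : EuclideanSpace ℝ (Fin n) → ℂ) : Prop :=
  Measurable q ∧ ∃ M, ∀ x ∈ Ω, ‖q x‖ ≤ M

def derivsL2 {n : ℕ} (Ω : Set (EuclideanSpace ℝ (Fin n)))
    (u : EuclideanSpace ℝ (Fin n) → ℂ) : Prop :=
  ∀ js : List (Fin n), js.length ≤ 4 →
    IntegrableOn (fun x => ‖(js.foldr pd u) x‖ ^ 2) Ω volume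

def symA {n : ℕ} (φ : EuclideanSpace ℝ (Fin n) → ℝ)
    (x ξ : EuclideanSpace ℝ (Fin n)) : ℝ :=
  ∑ j : Fin n, ((ξ j) ^ 4 - 6 * (pdR j φ x) ^ 2 * (ξ j) ^ 2 + (pdR j φ x) ^ 4)

def symB {n : ℕ} (φ : EuclideanSpace ℝ (Fin n) → ℝ)
    (x ξ : EuclideanSpace ℝ (Fin n)) : ℝ :=
  ∑ j : Fin n, (4 * pdR j φ x * (ξ j) ^ 3 - 4 * (pdR j φ x) ^ 3 * ξ j)

def poisson {n : ℕ} (φ : EuclideanSpace ℝ (Fin n) → ℝ)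
    (x ξ : EuclideanSpace ℝ (Fin n)) : ℝ :=
  ∑ k : Fin n,
    (fderiv ℝ (fun ξ' => symA φ x ξ') ξ (EuclideanSpace.single k 1) *
       fderiv ℝ (fun y => symB φ y ξ) x (EuclideanSpace.single k 1) -
     fderiv ℝ (fun y => symA φ y ξ) x (EuclideanSpace.single k 1) *
       fderiv ℝ (fun ξ' => symB φ x ξ') ξ (EuclideanSpace.single k 1))

section
set_option linter.all false
open Finset (sum_congr mul_sum sum_add_distrib sum_le_sum sum_mul sum_insert sum_sub_distrib single_le_sum sum_nonneg sum_comm sum_neg_distrib sum_mul_sum sum_div sum_eq_zero abs_sum_le_sum_abs sum_const)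
open Complex (I norm_real re_ofReal_mul abs_re_le_norm norm_conj add_re conj_ofReal norm_I re_sum normSq_eq_norm_sq conj_conj mul_conj sub_re ofReal_mul ofReal_re im_ofReal_mul re_le_norm abs_im_le_norm continuous_re)
open Filter.Eventually (of_forall)
local notation "cJ" => starRingEnd ℂ
set_option hygiene false
local notation "ISm" => Ix n R0 R → Sm n
local notation "IX" => Ix n R0 R
local notation "EEx" => Ex n R0 R
local notation "FR" => Fin n → ℝ
local notation "ER" => Eu n → ℝ
local notation "EX" => EF a b (.X j)
local notation "EY" => EF a b (.Y l)
local notation "mll" => mul_le_mul_of_nonneg_left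
local notation "mlr" => mul_le_mul_of_nonneg_right
local notation "Ba" => (i.s ^ 2)
local notation "Bb" => (psi Λ lam φ)
local notation "Bc" => (bb hφ Λ lam)
local notation "Be" => (h : ℂ)
local notation "Bf" => (zt F1 ξ j ^ 3 * cJ (zt F1 ξ l) ^ 3)
local notation "Bg" => (Fw Λ lam τ φ)
local notation "Bh" => (aa hφ)
local notation "Bj" => (-∑ j, ∑ l, ((I * cJ (zt F1 ξ l)) ^ 3 * ((I * zt F1 ξ j) ^ 3 * ((F2 j l : ℂ) * V + ∑ m, (F3 j l m : ℂ) * W m) - 3 * (I * zt F1 ξ j) ^ 2 * ((F2 j l : ℂ) * (W' j + Sw F2 W j))) - 3 * (I * cJ (zt F1 ξ l)) ^ 2 * ((I * zt F1 ξ j) ^ 3 * ((F2 j l : ℂ) * (W' l - Sw F2 W l)))))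
local notation "Bk" => (T2 * Q ^ 2 + n * P3 + lam * (n * (P2 * (2 * B2) + P2 * P2)))
local notation "Bl" => (3 * z j ^ 2 * (s1f Λ g x j * I) * cJ (z l) ^ 3)
local notation "Bm" => (s⁻¹ • (y - x0))
local notation "Bn" => (EF (cx ψ hψ) b (.X j) h 0 W)
local notation "Bo" => (τ * (gp l (gp m φ) x * gp j (gp m Bb) x + gp l (gp m Bb) x * gp j (gp m φ) x) + τ * (τ * (gp l (gp m Bb) x * gp j (gp m Bb) x)))
local notation "Bp" => (2 * C1 + 1)
local notation "Bq" => (1 + ∑ j, ξ j ^ 2)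
local notation "Br" => (gp j φ)
local notation "Bs" => (∑ m, (F3 j l m : ℂ) * W m)
local notation "Bt" => (fun i => lin m i * ch i)
local notation "Bu" => (z j ^ 3 * cJ (z l) ^ 3)
local notation "Bv" => (Dd j a)
local notation "Bw" => (Dd j b)
local notation "Bx" => ((μ * (μ * r j ^ 2 - 2 * r j * d0 j) : ℝ) : ℂ)
local notation "By" => (Λ * (∑ j, x j ^ 2) / 2)
local notation "Bz" => (I * Be ^ 3 * (∑ j, A y j * (X j).1 y) - Be ^ 4 * q y * W.1 y)
local notation "BA" => (s2f Λ g x j l + lam * ∑ m, F2 m l * F2 m j)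
local notation "BB" => (s ^ 2)
local notation "BC" => (gp m φ)
local notation "BD" => (Fw Λ lam i.t φ)
local notation "BE" => (ξ + dξ)
local notation "BF" => (dd h j u)
local notation "BG" => (zt F1 ξ j ^ 2 * cJ (zt F1 ξ l) ^ 3)
local notation "BH" => (fun i => Fc c0 c1 i * ch i)
local notation "BJ" => (i.s⁻¹ • (y - i.x0))
local notation "BK" => (fun y => (Real.exp (-(φ y) / h) : ℂ) * W.1 y)
local notation "BL" => (kc (Fv c0 c1) * Ph ch 1 + ∑ m, kc (Fv (Dd m c0) (Dd m c1)) * Ph Bt 1)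
local notation "BM" => (PF a b h τ u)
local notation "BN" => (3 * z j ^ 2 * e j * cJ (z l) ^ 3)
local notation "BP" => (4 * C ^ 2 + 2 * C + 1)
local notation "BQ" => (EuclideanSpace.proj j : Eu n →L[ℝ] ℝ)
local notation "BR" => (cx ψ hψ)
local notation "BS" => (2 * c1.im * c2.im + 2 * c1.im * t * (ρ t).im + c2.im ^ 2 * t + 2 * c2.im * t ^ 2 * (ρ t).im + t ^ 3 * (ρ t).im ^ 2)
local notation "BT" => (k + 1)
local notation "BU" => (3 - i)
local notation "BV" => (4 * ∑ j, zt f ξ j ^ 3 * d j)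
local notation "BW" => (hu.dd h j)
local notation "BX" => (hφ.gp j)
local notation "BY" => (smo_psi Λ lam hφ)
local notation "BZ" => (k.1 y * cJ (u.1 y))
local notation "Ja" => (∑ j, ∑ l, 3 * (F2 j l : ℂ) * (zt F1 ξ j ^ 3 * cJ (zt F1 ξ l) ^ 2) * (I * (W' l - Sw F2 W l) * cJ V))
local notation "Jb" => (-1)
local notation "Jc" => (EY ^ 3 * Fjl a b j l * EX ^ 3)
local notation "Jd" => (C6 + 6 * (C0 + C2 + C4) + 1)
local notation "Je" => (zt f ξ l)
local notation "Jf" => (Nn a b ε j f)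
local notation "Jg" => (n * (2 * B * (2 * B)))
local notation "Jh" => (gp j Bb)
local notation "Jj" => ((∑ j, zt a BE j ^ 4) - (plin F1 F2 ξ 1 dx dξ - 4 * I * τ * ∑ j, z j ^ 3 * s1f Λ g x j))
local notation "Jk" => (EX ^ k * -(2 * (HF * Fjl a b j l)) * EX ^ (3 - k))
local notation "Jl" => (∑ m, ‖W m‖ ^ 2 + ∑ m, ‖W' m‖ ^ 2)
local notation "Jm" => (r i)
local notation "Jn" => (1 + n * K)
local notation "Jo" => (ξ j ^ 4 - 6 * f j ^ 2 * ξ j ^ 2 + f j ^ 4)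
local notation "Jp" => (gp j Bg)
local notation "Jq" => (∑ j, ∑ l, Bf * (Bs * cJ V))
local notation "Jr" => (2 * K * ρ)
local notation "Js" => (F2 j l : ℂ)
local notation "Jt" => (b0 * (u0 * w0) + b1 * (u0 * w0) + b0 * (u1 * w0) + b0 * (u0 * w1))
local notation "Ju" => ((zt F1 ξ l ^ 3 * cJ (zt F1 ξ j) ^ 3) * ((∑ m, (F3 l j m : ℂ) * W m) * cJ V))
local notation "Jv" => (((EF BR b (.X j)) ^ 4) h 0 W)
local notation "Jw" => (4 * C ^ 2 + 7 / 4 * C + 1)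
local notation "Jy" => (x + e)
local notation "Jz" => (w j)
local notation "JA" => (f i)
local notation "JB" => (cj v)
local notation "JC" => (fun i => dd Ba j (ch i))
local notation "JD" => (mulF c0 c1 * EX ^ 3)
local notation "JE" => (W' j + Sw F2 W j)
local notation "JF" => (n * (M * (1 + N)) + Mq)
local notation "JG" => (T t)
local notation "JH" => (Eu n)
local notation "JJ" => (i.s : ℂ)
local notation "JK" => (L * w)
local notation "JL" => (fun j => Jξ j / N)
local notation "JM" => (T h τ u)
local notation "JN" => (cJ σ * (4 * ∑ j, z j ^ 3 * d j))
local notation "JP" => (cs * ∑ j, z j ^ 3 * (d0 j : ℂ))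
local notation "JQ" => (6 * ∑ j, zt f ξ j ^ 2 * d j ^ 2)
local notation "JR" => (fun i => Fc c0 c1 i * Nn a b 1 l ch i)
local notation "JS" => (smo u)
local notation "JT" => (n * (L ^ 2 * L2 ^ 2))
local notation "JU" => (fun y => Real.exp (L * f y))
local notation "JV" => (K * ρ)
local notation "JW" => (1 + ρ)
local notation "JX" => (2 * κ)
local notation "JY" => (ξ + t • d)
local notation "JZ" => (Mk_ft h 0 hu)
local notation "Ka" => (4 * ∑ j, z j ^ 3 * (d j : ℂ))
local notation "Kb" => (EX ^ k * Fjl a b j l * EX ^ (3 - k))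
local notation "Kd" => (I * (W' j - Sw F2 W j) * cJ V)
local notation "Ke" => (E * W)
local notation "Kf" => (τ : ℂ)
local notation "Kg" => (4 * (∑ j, zt f ξ j * d j ^ 3) + t * ∑ j, (d j : ℂ) ^ 4)
local notation "Kh" => (cs * ec ^ 2 * p + 2 * (cs * S31))
local notation "Kj" => (∀ j l m, |F3 j l m| ≤ K)
local notation "Kk" => (ip (sc χ i * k) (sc χ i * u))
local notation "Kl" => (∀ x0 y, u.1 y ≠ 0 → ‖y - x0‖ ≤ √h → x0 ∈ K)
local notation "Km" => (zt F1 ξ l)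
local notation "Kn" => (fun j => Jx j / N)
local notation "Ko" => (w ^ 4 * N ^ 2)
local notation "Kp" => (∑ m, kc (Fv (Dd m (Dd j Bh)) (Dd m (Dd j Bc))) * Ph Bt 1 : EEx)
local notation "Kq" => (u * v)
local notation "Kr" => (cx f hf)
local notation "Ks" => (c • u)
local notation "Kt" => (z' j ^ 3 * cJ (z' l) ^ 3)
local notation "Ku" => (n * (2 * (B1 * P1)) + 1)
local notation "Kv" => (Fv c0 c1)
local notation "Kw" => ((b0 j l + b1 j l) * (Bu).re + 2 * b0 j l * (BN).re)
local notation "Kx" => (ch i * KF Bh Bc Ba i.t i.u)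
local notation "Ky" => ((C0 / M + 2 * (C2 / M)) / 4 - κ ^ 2 / 4 + C4 / M)
local notation "Kz" => (Mk_ft h 4 hu)
local notation "KA" => (32 * D + C1)
local notation "KB" => (w ^ 4 * e1 ^ 2 + w ^ 4 * e2 ^ 2 + w ^ 4 * e3 ^ 2)
section
variable {n : ℕ}
lemma minlem (U : ℝ → ℝ) (U0 α β : ℝ) (r : ℝ → ℝ) (hr : Continuous r)
    (hU : ∀ t, U t = U0 + α * t + β * t ^ 2 + t ^ 3 * r t)
    (hmin : ∀ᶠ t in nhds 0, U0 ≤ U t) : α = 0 ∧ 0 ≤ β := by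
  have h1 : Filter.Tendsto (fun t : ℝ => α + β * t + t ^ 2 * r t) (nhds 0) (nhds α) := by
    have : Continuous (fun t : ℝ => α + β * t + t ^ 2 * r t) := by fun_prop
    simpa using this.tendsto 0
  have hα1 : 0 ≤ α := by
    refine ge_of_tendsto (h1.mono_left (nhdsWithin_le_nhds (s := Ioi 0))) ?_
    filter_upwards [hmin.filter_mono nhdsWithin_le_nhds, self_mem_nhdsWithin] with t ht ht0
    rw [hU] at ht
    have ht0 : 0 < t := ht0
    by_contra hc
    push Not at hc
    nlinarith [mul_pos_of_neg_of_neg hc (neg_neg_of_pos ht0)]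
  have hα2 : α ≤ 0 := by
    refine le_of_tendsto (h1.mono_left (nhdsWithin_le_nhds (s := Iio 0))) ?_
    filter_upwards [hmin.filter_mono nhdsWithin_le_nhds, self_mem_nhdsWithin] with t ht ht0
    rw [hU] at ht
    have ht0 : t < 0 := ht0
    by_contra hc
    push Not at hc
    nlinarith [mul_pos hc (neg_pos.2 ht0)]
  have hα : α = 0 := le_antisymm hα2 hα1
  refine ⟨hα, ?_⟩
  have h2 : Filter.Tendsto (fun t : ℝ => β + t * r t) (nhds 0) (nhds β) := by
    have : Continuous (fun t : ℝ => β + t * r t) := by fun_prop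
    simpa using this.tendsto 0
  refine ge_of_tendsto (h2.mono_left (nhdsWithin_le_nhds (s := Ioi 0))) ?_
  filter_upwards [hmin.filter_mono nhdsWithin_le_nhds, self_mem_nhdsWithin] with t ht ht0
  rw [hU, hα] at ht
  have ht0 : 0 < t := ht0
  by_contra hc
  push Not at hc
  have : 0 < t ^ 2 := by positivity
  nlinarith [mul_pos_of_neg_of_neg hc (neg_neg_of_pos this)]
lemma secOrd (k r : ℝ → ℝ) (T ρ : ℝ → ℂ) (k0 k1 k2 a M : ℝ) (c1 c2 : ℂ) (ha : 0 < a) (hM : 0 ≤ M)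
    (hr : Continuous r) (hρ : Continuous ρ)
    (hk : ∀ t, k t = k0 + k1 * t + k2 * t ^ 2 + t ^ 3 * r t)
    (hT : ∀ t : ℝ, T t = a + c1 * t + c2 * t ^ 2 + t ^ 3 * ρ t)
    (hmin : ∀ᶠ t in nhds 0, k0 + M * a + a ^ 2 ≤ k t + M * ‖T t‖ + ‖T t‖ ^ 2) :
    k1 + (M + 2 * a) * c1.re = 0 ∧
    0 ≤ k2 + M * (c2.re + c1.im ^ 2 / a) + c1.re ^ 2 + 2 * a * c2.re + c1.im ^ 2 := by
  have hre : ∀ t, (JG).re = a + c1.re * t + c2.re * t ^ 2 + t ^ 3 * (ρ t).re := by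
    intro t; rw [hT]
    have e1 : ((t : ℂ) ^ 2) = ((t ^ 2 : ℝ) : ℂ) := by push_cast; rfl
    have e2 : ((t : ℂ) ^ 3) = ((t ^ 3 : ℝ) : ℂ) := by push_cast; rfl
    rw [e1, e2]; simp [-Complex.ofReal_pow]
  have him : ∀ t, (JG).im = c1.im * t + c2.im * t ^ 2 + t ^ 3 * (ρ t).im := by
    intro t; rw [hT]
    have e1 : ((t : ℂ) ^ 2) = ((t ^ 2 : ℝ) : ℂ) := by push_cast; rfl
    have e2 : ((t : ℂ) ^ 3) = ((t ^ 3 : ℝ) : ℂ) := by push_cast; rfl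
    rw [e1, e2]; simp [-Complex.ofReal_pow]
  have hTc : Continuous T := by
    have : T = fun t : ℝ => (a : ℂ) + c1 * t + c2 * t ^ 2 + t ^ 3 * ρ t := funext hT
    rw [this]; fun_prop
  have hcre : Continuous fun t => (ρ t).re := continuous_re.comp hρ
  have hcim : Continuous fun t => (ρ t).im := Complex.continuous_im.comp hρ
  have hev : ∀ᶠ t in nhds (0:ℝ), a / 2 < (JG).re := by
    have h1 : Filter.Tendsto (fun t => (JG).re) (nhds 0) (nhds a) := by
      have := (continuous_re.comp hTc).tendsto 0
      simpa [hre, Function.comp_def] using this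
    exact h1.eventually (lt_mem_nhds (by linarith))
  refine minlem (fun t => k t + M * ((JG).re + (JG).im ^ 2 / a) + ((JG).re ^ 2 + (JG).im ^ 2))
    (k0 + M * a + a ^ 2) _ _ (fun t => r t + M * ((ρ t).re + BS / a)
      + (2 * a * (ρ t).re + 2 * c1.re * c2.re + 2 * c1.re * t * (ρ t).re
        + c2.re ^ 2 * t + 2 * c2.re * t ^ 2 * (ρ t).re + t ^ 3 * (ρ t).re ^ 2) +
        BS) ?_ ?_ ?_
  · fun_prop
  · intro t
    simp only [hk, hre, him]
    field_simp
    ring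
  · filter_upwards [hmin, hev] with t ht h2
    have h3 : ‖T t‖ ^ 2 = (JG).re ^ 2 + (JG).im ^ 2 := by
      rw [Complex.sq_norm, Complex.normSq_apply]; ring
    have h4 : ‖T t‖ ≤ (JG).re + (JG).im ^ 2 / a := by
      have h5 : 0 ≤ (JG).im ^ 2 / a := by positivity
      apply le_of_sq_le_sq _ (by linarith)
      rw [h3]
      have h6 : (JG).im ^ 2 = a * ((JG).im ^ 2 / a) := by field_simp
      nlinarith
    nlinarith [mll h4 hM]
def zt (f ξ : FR) (j : Fin n) : ℂ := (ξ j : ℂ) + f j * I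
def pS (f ξ : FR) : ℂ := ∑ j, zt f ξ j ^ 4
def kS (f : FR) (Q : Fin n → FR) (ξ : FR) : ℝ :=
  ∑ j, ∑ l, Q j l * (zt f ξ j ^ 3 * cJ Je ^ 3).re
lemma zt_bd (f ξ : FR) (B : ℝ) (hf : ∀ j, |f j| ≤ B) (j : Fin n) :
    ‖zt f ξ j‖ ≤ ‖ξ‖ + B := by
  refine (norm_add_le _ _).trans (add_le_add ?_ ?_)
  · rw [norm_real]; exact norm_le_pi_norm ξ j
  · simpa using hf j
lemma kS_bd (f ξ : FR) (Q) (B L : ℝ) (hQ : ∀ j l, |Q j l| ≤ B)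
    (hz : ∀ j, ‖zt f ξ j‖ ≤ L) : |kS f Q ξ| ≤ n ^ 2 * (B * L ^ 6) := by
  have : ∀ j l, |Q j l * (zt f ξ j ^ 3 * cJ Je ^ 3).re| ≤ B * L ^ 6 := by
    intro j l
    rw [abs_mul]
    have h0 : 0 ≤ B := (abs_nonneg _).trans (hQ j l)
    refine mul_le_mul (hQ j l) ((abs_re_le_norm _).trans ?_) (abs_nonneg _) h0
    rw [norm_mul, norm_pow, norm_pow, RCLike.norm_conj]
    calc ‖zt f ξ j‖ ^ 3 * ‖zt f ξ l‖ ^ 3 ≤ L ^ 3 * L ^ 3 := by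
          have hL : 0 ≤ L := (norm_nonneg _).trans (hz j)
          gcongr <;> apply hz
      _ = L ^ 6 := by ring
  refine (abs_sum_le_sum_abs _ _).trans ?_
  refine (sum_le_sum fun j _ => (abs_sum_le_sum_abs _ _).trans
    (sum_le_sum fun l _ => this j l)).trans ?_
  simp; apply le_of_eq; ring
lemma coer (n : ℕ) (B : ℝ) (hB : 0 ≤ B) : ∃ R > 0, ∀ (f ξ : FR) (Q : Fin n → FR),
    (∀ j, |f j| ≤ B) → (∀ j l, |Q j l| ≤ B) → R ≤ ‖ξ‖ →
    ‖ξ‖ ^ 4 / 2 ≤ ‖pS f ξ‖ ∧ |kS f Q ξ| ≤ ‖pS f ξ‖ ^ 2 := by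
  refine ⟨1 + 12 * n * B ^ 2 + B + 256 * n ^ 2 * B, by positivity, fun f ξ Q hf hQ hR => ?_⟩
  set m := ‖ξ‖ with hm
  have hm1 : 1 ≤ m := by
    have : 0 ≤ 12 * n * B ^ 2 + B + 256 * n ^ 2 * B := by positivity
    linarith
  have hm0 : 0 < m := by linarith
  obtain ⟨j0, hj0⟩ : ∃ j, m ≤ |ξ j| := by
    by_contra hc
    push Not at hc
    exact lt_irrefl _ ((pi_norm_lt_iff hm0).2 hc)
  have hp : m ^ 4 / 2 ≤ ‖pS f ξ‖ := by
    refine le_trans ?_ (re_le_norm _)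
    have e : (pS f ξ).re = ∑ j, Jo := by
      rw [pS, re_sum]
      refine sum_congr rfl fun j _ => ?_
      simp [zt, pow_succ]; ring
    rw [e]
    have h1 : ∀ j, f j ^ 2 ≤ B ^ 2 := fun j => sq_le_sq' (abs_le.1 (hf j)).1 (abs_le.1 (hf j)).2
    have h2 : ∀ j, ξ j ^ 2 ≤ m ^ 2 := fun j => by
      have : |ξ j| ≤ m := norm_le_pi_norm ξ j
      exact sq_le_sq' (abs_le.1 this).1 (abs_le.1 this).2
    have h3 : ∑ j, (ξ j ^ 4 - 6 * B ^ 2 * m ^ 2) ≤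
        ∑ j, Jo := by
      refine sum_le_sum fun j _ => ?_
      have := mul_le_mul (h1 j) (h2 j) (sq_nonneg _) (sq_nonneg _)
      have h5 : 0 ≤ f j ^ 4 := by positivity
      nlinarith
    have h4 : m ^ 4 ≤ ∑ j, ξ j ^ 4 := by
      refine le_trans ?_ (single_le_sum (f := fun j => ξ j ^ 4) (fun j _ => by positivity)
        (Finset.mem_univ j0))
      have : m ^ 2 ≤ ξ j0 ^ 2 := by rw [← sq_abs (ξ j0)]; gcongr
      calc m ^ 4 = (m ^ 2) ^ 2 := by ring
        _ ≤ (ξ j0 ^ 2) ^ 2 := by gcongr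
        _ = ξ j0 ^ 4 := by ring
    rw [sum_sub_distrib] at h3
    simp at h3
    have h6 : 12 * n * B ^ 2 ≤ m ^ 2 := by
      have h7 : 0 ≤ B + 256 * n ^ 2 * B := by positivity
      nlinarith
    nlinarith [mlr h6 (sq_nonneg m)]
  refine ⟨hp, ?_⟩
  have hz : ∀ j, ‖zt f ξ j‖ ≤ 2 * m := fun j => (zt_bd f ξ B hf j).trans (by
    have : 0 ≤ 12 * n * B ^ 2 + 256 * n ^ 2 * B := by positivity
    linarith)
  refine (kS_bd f ξ Q B _ hQ hz).trans ?_
  have h8 : 256 * n ^ 2 * B ≤ m ^ 2 := by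
    have : 0 ≤ 12 * n * B ^ 2 + B := by positivity
    nlinarith
  calc (n:ℝ) ^ 2 * (B * (2 * m) ^ 6) = (256 * n ^ 2 * B) * m ^ 6 / 4 := by ring
    _ ≤ m ^ 2 * m ^ 6 / 4 := by gcongr
    _ = (m ^ 4 / 2) ^ 2 := by ring
    _ ≤ _ := by gcongr
end
section
lemma norm_sum_le' {n : ℕ} {F : Type*} [SeminormedAddCommGroup F] (g : Fin n → F) (c : ℝ)
    (h : ∀ j, ‖g j‖ ≤ c) :
    ‖∑ j, g j‖ ≤ n * c := by
  refine (norm_sum_le _ _).trans ((sum_le_sum fun j _ => h j).trans ?_)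
  simp
set_option maxHeartbeats 4000000 in
lemma coreA (n : ℕ) (L Ck C0 κ : ℝ) (hL : 1 ≤ L) (hCk : 0 ≤ Ck) (hC0 : 0 ≤ C0) (hκ : 0 < κ) :
    ∃ M0 : ℝ, ∀ (M : ℝ) (z : Fin n → ℂ) (σ : ℂ) (a : ℝ) (k1 k2 : (FR) → ℝ),
    M0 ≤ M → (∀ j, ‖z j‖ ≤ L) → κ ^ 2 ≤ ∑ j, ‖z j‖ ^ 4 → κ ^ 3 ≤ ∑ j, ‖z j‖ ^ 6 → ‖σ‖ = 1 →
    0 < a → M * a ≤ C0 → ∑ j, z j ^ 4 = a * σ →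
    (∀ d δ, (∀ j, |d j| ≤ δ) → |k1 d| ≤ Ck * δ) → (∀ d δ, (∀ j, |d j| ≤ δ) → |k2 d| ≤ Ck * δ ^ 2) →
    (∀ d, k1 d + (M + 2 * a) * (JN).re = 0) →
    (∀ d, (JN).im = 0 →
      0 ≤ k2 d + M * (cJ σ * (6 * ∑ j, z j ^ 2 * d j ^ 2)).re
        + (JN).re ^ 2
        + 2 * a * (cJ σ * (6 * ∑ j, z j ^ 2 * d j ^ 2)).re) → False := by
  set C2 := C0 + 2 * n * L * Ck with hC2
  have hC2n : 0 ≤ C2 := by positivity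
  set C3 := C2 * (2 / κ ^ 3) with hC3
  have hC3n : 0 ≤ C3 := by positivity
  set L2 := L + C3 * L ^ 3 with hL2
  have hL2n : 0 ≤ L2 := by positivity
  set C4 := n * (L ^ 2 * (C3 * (2 * L ^ 4 + C3 * L ^ 6))) with hC4
  set C6 := Ck * L2 ^ 2 + (4 * (n * (L ^ 3 * L2))) ^ 2 + 2 * C0 * (6 * JT) with hC6
  have hC6n : 0 ≤ C6 := by positivity
  refine ⟨1 + 2 * n * Ck ^ 2 / κ ^ 3 + Jd / κ ^ 2, ?_⟩
  intro M z σ a k1 k2 hM hz h4 h6 hσ ha hMa hp hk1 hk2 hfo hso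
  have hC4n : 0 ≤ C4 := by positivity
  have hM1 : 1 ≤ M := by
    have h1 : 0 ≤ 2 * n * Ck ^ 2 / κ ^ 3 := by positivity
    have h2 : 0 ≤ Jd / κ ^ 2 := by positivity
    linarith
  have hM2 : 2 * n * Ck ^ 2 / κ ^ 3 ≤ M := by
    have h2 : 0 ≤ Jd / κ ^ 2 := by positivity
    linarith
  have hM3 : Jd ≤ M * κ ^ 2 := by
    have h1 : 0 ≤ 2 * n * Ck ^ 2 / κ ^ 3 := by positivity
    rw [← div_le_iff₀ (by positivity)]
    linarith
  have hM0 : 0 < M := by linarith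
  have haC : a ≤ C0 / M := by rw [le_div_iff₀ hM0]; linarith
  have haC0 : a ≤ C0 := haC.trans (div_le_self hC0 hM1)
  set cs := cJ σ with hcs
  have hcsσ : cs * σ = 1 := by
    rw [mul_comm, hcs, mul_conj, normSq_eq_norm_sq, hσ]; simp
  have hcsn : ‖cs‖ = 1 := by rw [hcs, RCLike.norm_conj, hσ]
  set w := fun j => cs * z j ^ 3 with hw
  have hwn : ∀ j, ‖w j‖ = ‖z j‖ ^ 3 := fun j => by simp [hw, hcsn]
  have hx : ∀ j, |(Jz).re| ≤ Ck / M := by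
    intro j
    have h1 := hfo (Pi.single j 1)
    have h2 := hk1 (Pi.single j 1) 1 (fun i => by
      by_cases h : i = j
      · subst h; simp
      · simp [h])
    have h3 : ∑ i, z i ^ 3 * ((Pi.single j (1:ℝ) : FR) i : ℂ) = z j ^ 3 := by
      rw [Finset.sum_eq_single j]
      · simp
      · intro i _ hi; simp [hi]
      · simp
    rw [h3] at h1
    have h4 : (cs * (4 * z j ^ 3)).re = 4 * (Jz).re := by
      rw [show cs * (4 * z j ^ 3) = ((4:ℝ):ℂ) * w j by simp [hw]; ring, re_ofReal_mul]
    rw [h4] at h1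
    have h5 : |(M + 2 * a) * (4 * (Jz).re)| ≤ Ck := by
      rw [show (M + 2 * a) * (4 * (Jz).re) = - k1 (Pi.single j 1) by linarith, abs_neg]
      linarith
    rw [abs_mul, abs_of_pos (by linarith : 0 < M + 2 * a), abs_mul] at h5
    norm_num at h5
    rw [le_div_iff₀ hM0]
    have h6 : 0 ≤ 3 * (M * |(Jz).re|) + 8 * (a * |(Jz).re|) := by positivity
    linarith
  set r := fun j => (Jz).im with hr
  have hrL : ∀ j, |r j| ≤ L ^ 3 := fun j => (abs_im_le_norm _).trans (by
    rw [hwn]; gcongr; exact hz j)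
  set S := ∑ j, r j ^ 2 with hS
  have hSκ : κ ^ 3 / 2 ≤ S := by
    have e : ∑ j, ‖z j‖ ^ 6 = ∑ j, ((Jz).re ^ 2) + S := by
      rw [hS, ← sum_add_distrib]
      refine sum_congr rfl fun j _ => ?_
      have : ‖z j‖ ^ 6 = ‖w j‖ ^ 2 := by rw [hwn]; ring
      rw [this, Complex.sq_norm, Complex.normSq_apply]; ring
    have h1 : ∑ j, ((Jz).re ^ 2) ≤ n * (Ck / M) ^ 2 := by
      refine (sum_le_sum fun j _ => (?_ : _ ≤ (Ck / M) ^ 2)).trans (by simp)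
      exact sq_le_sq' (abs_le.1 (hx j)).1 (abs_le.1 (hx j)).2
    have h2 : n * (Ck / M) ^ 2 ≤ κ ^ 3 / 2 := by
      rw [div_pow, ← mul_div_assoc, div_le_iff₀ (by positivity)]
      rw [div_le_iff₀ (by positivity)] at hM2
      have : M * κ ^ 3 ≤ M ^ 2 * κ ^ 3 := by
        gcongr; exact le_self_pow₀ hM1 (by norm_num)
      linarith
    linarith
  have hS0 : 0 < S := lt_of_lt_of_le (by positivity) hSκ
  obtain ⟨e, he⟩ := IsAlgClosed.exists_pow_nat_eq (-σ) (n := 2) (by norm_num)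
  have hen : ‖e‖ = 1 := by
    have : ‖e‖ ^ 2 = 1 := by rw [← norm_pow, he, norm_neg, hσ]
    exact (pow_eq_one_iff_of_nonneg (norm_nonneg e) (by norm_num)).1 this
  set ec := cJ e with hec
  have hecn : ‖ec‖ = 1 := by rw [hec, RCLike.norm_conj, hen]
  have hee : e * ec = 1 := by rw [hec, mul_conj, normSq_eq_norm_sq, hen]; simp
  set d0 := fun j => (ec * z j).re with hd0
  have hd0L : ∀ j, |d0 j| ≤ L := fun j => (abs_re_le_norm _).trans (by
    rw [norm_mul, hecn, one_mul]; exact hz j)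
  set zc := fun j => cJ (z j) with hzc
  have hd0c : ∀ j, (d0 j : ℂ) = (ec * z j + e * zc j) / 2 := fun j => by
    rw [hd0]; simp only [Complex.re_eq_add_conj, map_mul, hec, hzc, conj_conj]
  set p := ∑ j, z j ^ 4 with hpd
  have hpn : ‖p‖ ≤ C0 / M := by
    rw [hp, norm_mul, hσ, mul_one, norm_real, norm_of_nonneg ha.le]; exact haC
  set S31 := ∑ j, z j ^ 3 * zc j with hS31
  have hS31b : ‖S31‖ ≤ C2 / M := by
    have e1 : S31 = -σ ^ 2 * cJ p + σ * ∑ j, (2 * ((Jz).re : ℂ)) * zc j := by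
      rw [hS31, hpd, map_sum, mul_sum, mul_sum, ← sum_add_distrib]
      refine sum_congr rfl fun j _ => ?_
      have e2 : (2 * ((Jz).re : ℂ)) = w j + cJ Jz := by
        rw [Complex.re_eq_add_conj]; ring
      rw [e2]
      simp only [hw, map_mul, map_pow, hcs, conj_conj, hzc]
      rw [← hcs]
      linear_combination (-(z j ^ 3 * cJ (z j))) * hcsσ
    rw [e1]
    refine (norm_add_le _ _).trans ?_
    rw [norm_mul, norm_mul, norm_neg, norm_pow, hσ, RCLike.norm_conj]
    have h1 : ‖∑ j, (2 * ((Jz).re : ℂ)) * zc j‖ ≤ n * (2 * (Ck / M) * L) := by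
      refine norm_sum_le' _ _ fun j => ?_
      rw [norm_mul, norm_mul, norm_real, RCLike.norm_conj]
      have := hx j
      have := hz j
      simp only [Complex.norm_ofNat, norm_eq_abs]
      gcongr
    calc _ ≤ 1 ^ 2 * (C0 / M) + 1 * (n * (2 * (Ck / M) * L)) := by gcongr
      _ = C2 / M := by rw [hC2]; ring
  have hA : ∑ j, z j ^ 3 * (d0 j : ℂ) = (ec * p + e * S31) / 2 := by
    rw [hpd, hS31, mul_sum, mul_sum, ← sum_add_distrib, sum_div]
    refine sum_congr rfl fun j _ => ?_
    rw [hd0c]; ring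
  have hAn : ‖∑ j, z j ^ 3 * (d0 j : ℂ)‖ ≤ C2 / M := by
    rw [hA, norm_div]
    have h1 : ‖ec * p + e * S31‖ ≤ C2 / M + C2 / M := by
      refine (norm_add_le _ _).trans ?_
      rw [norm_mul, norm_mul, hecn, hen, one_mul, one_mul]
      have : C0 / M ≤ C2 / M := by
        gcongr; rw [hC2]; have : 0 ≤ 2 * n * L * Ck := by positivity
        linarith
      linarith
    simp only [Complex.norm_ofNat]
    linarith
  set m := (JP).im with hm
  have hmb : |m| ≤ C2 / M := (abs_im_le_norm _).trans (by rw [norm_mul, hcsn, one_mul]; exact hAn)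
  set μ := m / S with hμ
  have hμb : |μ| ≤ C3 / M := by
    rw [hμ, abs_div, abs_of_pos hS0, hC3]
    calc |m| / S ≤ (C2 / M) / (κ ^ 3 / 2) := by gcongr
      _ = _ := by field_simp
  have hμC : |μ| ≤ C3 := hμb.trans (div_le_self hC3n hM1)
  set d := fun j => d0 j - μ * r j with hd
  have hdL : ∀ j, |d j| ≤ L2 := fun j => by
    refine (abs_sub _ _).trans ?_
    rw [abs_mul, hL2]
    have := hd0L j
    have := hrL j
    gcongr
  have hwr : ∀ j, w j = (Jz).re + r j * I := fun j => by simp [hr]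
  have him : (cs * Ka).im = 0 := by
    have e1 : cs * Ka =
        4 * JP - 4 * ∑ j, ((μ * r j : ℝ) : ℂ) * w j := by
      simp only [mul_sum, ← sum_sub_distrib]
      refine sum_congr rfl fun j _ => ?_
      simp only [hd, hw]; push_cast; ring
    rw [e1, Complex.sub_im]
    have e2 : (4 * ∑ j, ((μ * r j : ℝ) : ℂ) * w j).im = 4 * (μ * S) := by
      rw [show (4:ℂ) = ((4:ℝ):ℂ) by norm_num, im_ofReal_mul, Complex.im_sum, hS]
      congr 1
      rw [mul_sum]
      refine sum_congr rfl fun j _ => ?_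
      rw [im_ofReal_mul]; simp only [hr]; ring
    have e3 : (4 * JP).im = 4 * m := by
      rw [show (4:ℂ) = ((4:ℝ):ℂ) by norm_num, im_ofReal_mul]
    rw [e2, e3, hμ]
    field_simp; ring
  have h2 := hso d him
  set c1 := cs * Ka with hc1
  set c2 := cs * (6 * ∑ j, z j ^ 2 * (d j : ℂ) ^ 2) with hc2
  have hc1b : |c1.re| ≤ 4 * (n * (L ^ 3 * L2)) := by
    refine (abs_re_le_norm _).trans ?_
    rw [hc1, norm_mul, hcsn, one_mul, norm_mul, Complex.norm_ofNat]
    gcongr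
    refine norm_sum_le' _ _ fun j => ?_
    rw [norm_mul, norm_pow, norm_real, norm_eq_abs]
    have := hz j
    have := hdL j
    gcongr
  have hc2b : |c2.re| ≤ 6 * JT := by
    refine (abs_re_le_norm _).trans ?_
    rw [hc2, norm_mul, hcsn, one_mul, norm_mul, Complex.norm_ofNat]
    gcongr
    refine norm_sum_le' _ _ fun j => ?_
    rw [norm_mul, norm_pow, norm_pow, norm_real, norm_eq_abs]
    have := hz j
    have := hdL j
    gcongr
  have hk2b := hk2 d L2 hdL
  set S44 := ∑ j, ‖z j‖ ^ 4 with hS44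
  have hc2e : c2 = 6 * (Kh / 4 - (S44 : ℂ) / 4
      + cs * ∑ j, z j ^ 2 * Bx) := by
    have e1 : (S44 : ℂ) = - cs * ∑ j, e ^ 2 * (z j ^ 2 * zc j ^ 2) := by
      rw [← mul_sum, ← mul_assoc, he, hS44]
      rw [show -cs * -σ = 1 by rw [neg_mul_neg]; exact hcsσ, one_mul]
      push_cast
      refine sum_congr rfl fun j _ => ?_
      rw [← mul_pow, hzc]; simp only []
      rw [mul_conj, normSq_eq_norm_sq]; push_cast; ring
    rw [e1, hc2, hpd, hS31]
    simp only [mul_sum, sum_div, ← sum_sub_distrib, ← sum_add_distrib]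
    refine sum_congr rfl fun j _ => ?_
    simp only [hd]
    push_cast
    rw [hd0c]
    linear_combination (3 * cs * z j ^ 3 * zc j) * hee
  have hlast : ‖∑ j, z j ^ 2 * Bx‖ ≤ C4 / M := by
    have : ‖∑ j, z j ^ 2 * Bx‖ ≤
        n * (L ^ 2 * ((C3 / M) * (2 * L ^ 4 + C3 * L ^ 6))) := by
      refine norm_sum_le' _ _ fun j => ?_
      rw [norm_mul, norm_pow, norm_real, norm_eq_abs, abs_mul]
      have h1 := hz j
      have h3 : |μ * r j ^ 2 - 2 * r j * d0 j| ≤ 2 * L ^ 4 + C3 * L ^ 6 := by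
        refine (abs_sub _ _).trans ?_
        rw [abs_mul, abs_mul, abs_mul, abs_pow, abs_two]
        calc |μ| * |r j| ^ 2 + 2 * |r j| * |d0 j| ≤ C3 * (L ^ 3) ^ 2 + 2 * L ^ 3 * L := by
              have := hrL j
              have := hd0L j
              gcongr
          _ = _ := by ring
      gcongr
    refine this.trans (le_of_eq ?_)
    rw [hC4]; ring
  have hc2r : c2.re ≤ 6 * Ky := by
    have e1 : c2.re = 6 * ((Kh).re / 4 - S44 / 4
      + (cs * ∑ j, z j ^ 2 * Bx).re) := by
      rw [hc2e]
      rw [show (6:ℂ) = ((6:ℝ):ℂ) by norm_num, re_ofReal_mul, add_re, sub_re]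
      rw [show (4:ℂ) = ((4:ℝ):ℂ) by norm_num, Complex.div_ofReal_re, Complex.div_ofReal_re,
        ofReal_re]
    rw [e1]
    have h5 : (Kh).re ≤ C0 / M + 2 * (C2 / M) := by
      refine (re_le_norm _).trans ((norm_add_le _ _).trans ?_)
      simp only [norm_mul, norm_pow, hcsn, hecn, Complex.norm_ofNat]
      linarith
    have h7 : (cs * ∑ j, z j ^ 2 * Bx).re ≤ C4 / M := by
      refine (re_le_norm _).trans ?_
      rw [norm_mul, hcsn, one_mul]; exact hlast
    linarith
  have h8 : M * c2.re ≤ 6 * ((C0 + 2 * C2) / 4 - M * κ ^ 2 / 4 + C4) := by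
    calc M * c2.re ≤ M * (6 * Ky) := by gcongr
      _ = _ := by field_simp
  have h9 : c1.re ^ 2 ≤ (4 * (n * (L ^ 3 * L2))) ^ 2 := sq_le_sq' (abs_le.1 hc1b).1 (abs_le.1 hc1b).2
  have h10 : 2 * a * c2.re ≤ 2 * C0 * (6 * JT) := by
    have := (abs_le.1 hc2b).2
    calc 2 * a * c2.re ≤ 2 * a * (6 * JT) := by gcongr
      _ ≤ _ := by gcongr
  have h11 := (abs_le.1 hk2b).2
  linarith
end
section
variable {n : ℕ}
def k1S (Q : Fin n → FR) (z : Fin n → ℂ) (d : FR) : ℝ :=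
  ∑ j, ∑ l, Q j l * (3 * z j ^ 2 * d j * cJ (z l) ^ 3
    + z j ^ 3 * (3 * cJ (z l) ^ 2 * d l)).re
def k2S (Q : Fin n → FR) (z : Fin n → ℂ) (d : FR) : ℝ :=
  ∑ j, ∑ l, Q j l * (3 * z j * d j ^ 2 * cJ (z l) ^ 3
    + 9 * (z j ^ 2 * d j * (cJ (z l) ^ 2 * d l))
    + z j ^ 3 * (3 * cJ (z l) * d l ^ 2)).re
lemma dsum_bd (Q : Fin n → FR) (g : Fin n → Fin n → ℂ) (B c : ℝ)
    (hQ : ∀ j l, |Q j l| ≤ B) (hg : ∀ j l, ‖g j l‖ ≤ c) :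
    |∑ j, ∑ l, Q j l * (g j l).re| ≤ n * (n * (B * c)) := by
  rw [← norm_eq_abs]
  refine norm_sum_le' _ _ fun j => ?_
  refine norm_sum_le' _ _ fun l => ?_
  rw [norm_eq_abs, abs_mul]
  exact mul_le_mul (hQ j l) ((abs_re_le_norm _).trans (hg j l)) (abs_nonneg _)
    ((abs_nonneg _).trans (hQ j l))
lemma kS_exp (f ξ d : FR) (Q : Fin n → FR) :
    ∃ r : ℝ → ℝ, Continuous r ∧ ∀ t : ℝ, kS f Q JY =
      kS f Q ξ + k1S Q (zt f ξ) d * t + k2S Q (zt f ξ) d * t ^ 2 + t ^ 3 * r t := by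
  let g : ℝ → Fin n → Fin n → ℂ := fun t j l =>
    let z := zt f ξ j; let w := cJ Je
    (z ^ 3 * d l ^ 3 + 3 * z ^ 2 * d j * (3 * w * d l ^ 2) + 3 * z * d j ^ 2 * (3 * w ^ 2 * d l)
      + d j ^ 3 * w ^ 3) + t * (3 * z ^ 2 * d j * d l ^ 3 + 3 * z * d j ^ 2 * (3 * w * d l ^ 2)
      + d j ^ 3 * (3 * w ^ 2 * d l)) + t ^ 2 * (3 * z * d j ^ 2 * d l ^ 3 + d j ^ 3 * (3 * w * d l ^ 2))
      + t ^ 3 * (d j ^ 3 * d l ^ 3)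
  refine ⟨fun t => ∑ j, ∑ l, Q j l * (g t j l).re, ?_, fun t => ?_⟩
  · refine continuous_finsetSum _ fun j _ => continuous_finsetSum _ fun l _ => ?_
    refine continuous_const.mul (continuous_re.comp ?_)
    simp only [g]; fun_prop
  · simp only [kS, k1S, k2S, mul_sum, sum_mul, ← sum_add_distrib]
    refine sum_congr rfl fun j _ => sum_congr rfl fun l _ => ?_
    have e1 : ∀ i, zt f JY i = zt f ξ i + (t : ℂ) * d i := fun i => by
      simp [zt]; ring
    rw [e1, e1, map_add, map_mul, conj_ofReal, conj_ofReal]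
    have e2 : ((zt f ξ j + (t : ℂ) * d j) ^ 3 * (cJ Je + t * d l) ^ 3).re =
      (zt f ξ j ^ 3 * cJ Je ^ 3
       + (t : ℝ) * (3 * zt f ξ j ^ 2 * d j * cJ Je ^ 3
    + zt f ξ j ^ 3 * (3 * cJ Je ^ 2 * d l))
       + (t ^ 2 : ℝ) * (3 * zt f ξ j * d j ^ 2 * cJ Je ^ 3
    + 9 * (zt f ξ j ^ 2 * d j * (cJ Je ^ 2 * d l))
    + zt f ξ j ^ 3 * (3 * cJ Je * d l ^ 2))
       + (t ^ 3 : ℝ) * g t j l).re := by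
      congr 1
      simp only [g]; push_cast; ring
    rw [e2, add_re, add_re, add_re, re_ofReal_mul,
      re_ofReal_mul, re_ofReal_mul]
    ring
lemma pS_exp (f ξ d : FR) (t : ℝ) : pS f JY =
      pS f ξ + BV * t + JQ * t ^ 2
       + t ^ 3 * Kg := by
  simp only [pS, mul_sum, sum_mul, ← sum_add_distrib]
  refine sum_congr rfl fun j _ => ?_
  have e1 : zt f JY j = zt f ξ j + (t : ℂ) * d j := by simp [zt]; ring
  rw [e1]; ring
set_option maxHeartbeats 1000000 in
theorem lemA (n : ℕ) (B c0 : ℝ) (hB : 0 ≤ B) (hc0 : 0 < c0) : ∃ M > 0,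
    ∀ (f : FR) (Q : Fin n → FR), (∀ j, |f j| ≤ B) → (∀ j l, |Q j l| ≤ B) →
    c0 ≤ ∑ j, f j ^ 2 → (∀ ξ, pS f ξ = 0 → 0 ≤ kS f Q ξ) →
    ∀ ξ, -(M * ‖pS f ξ‖ + ‖pS f ξ‖ ^ 2) ≤ kS f Q ξ := by
  obtain ⟨R, hR0, hR⟩ := coer n B hB
  set L := R + B + 1 with hL
  have hL1 : 1 ≤ L := by linarith
  rcases Nat.eq_zero_or_pos n with hn | hn
  · subst hn
    refine ⟨1, one_pos, fun f Q _ _ h => ?_⟩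
    simp at h; linarith
  have hn' : (0:ℝ) < n := by exact_mod_cast hn
  obtain ⟨M0, hM0⟩ := coreA n L (n * (n * (B * (15 * L ^ 5)))) (n ^ 2 * (B * L ^ 6)) (c0 / n) hL1
    (by positivity) (by positivity) (by positivity)
  refine ⟨|M0| + 1, by positivity, fun f Q hf hQ hfc hpk => ?_⟩
  set M := |M0| + 1 with hMd
  have hM : 0 < M := by positivity
  by_contra hcon
  push Not at hcon
  obtain ⟨ξ1, hξ1⟩ := hcon
  set H : (FR) → ℝ := fun ξ => kS f Q ξ + (M * ‖pS f ξ‖ + ‖pS f ξ‖ ^ 2) with hH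
  have hHc : Continuous H := by
    simp only [hH, kS, pS, zt]
    refine Continuous.add ?_ (by fun_prop)
    refine continuous_finsetSum _ fun j _ => continuous_finsetSum _ fun l _ => ?_
    refine continuous_const.mul (continuous_re.comp ?_)
    have : Continuous cJ := Complex.continuous_conj
    fun_prop
  have hout : ∀ ξ, R ≤ ‖ξ‖ → 0 ≤ H ξ := fun ξ h => by
    have h1 := (abs_le.1 (hR f ξ Q hf hQ h).2).1
    have h2 : 0 ≤ M * ‖pS f ξ‖ := by positivity
    simp only [hH]; linarith
  have hξ1n : H ξ1 < 0 := by simp only [hH]; linarith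
  have hξ1R : ‖ξ1‖ < R := by
    by_contra h; push Not at h
    linarith [hout _ h]
  obtain ⟨ξ, hξm, hξ⟩ := (isCompact_closedBall (0 : FR) R).exists_isMinOn
    ⟨ξ1, by simpa using hξ1R.le⟩ hHc.continuousOn
  have hmin : ∀ η, ‖η‖ ≤ R → H ξ ≤ H η := fun η h => hξ (by simpa using h)
  have hξneg : H ξ < 0 := (hmin ξ1 hξ1R.le).trans_lt hξ1n
  have hξR : ‖ξ‖ < R := by
    by_contra h; push Not at h
    linarith [hout _ h]
  set p := pS f ξ with hp
  set a := ‖p‖ with ha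
  have hz : ∀ j, ‖zt f ξ j‖ ≤ L := fun j => (zt_bd f ξ B hf j).trans (by linarith)
  have hap : 0 < a := by
    rcases (norm_nonneg p).lt_or_eq with h | h
    · exact h
    · have := hpk ξ (norm_eq_zero.1 h.symm)
      simp only [hH, ← hp, ← h] at hξneg
      linarith
  have hpne : p ≠ 0 := norm_pos_iff.1 hap
  set σ := p / a with hσ
  have hσn : ‖σ‖ = 1 := by rw [hσ, norm_div, norm_real, norm_norm, div_self hap.ne']
  have hpσ : p = a * σ := by
    rw [hσ, mul_div_cancel₀]; exact_mod_cast hap.ne'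
  have hcσ : cJ σ * p = a := by
    rw [hpσ, mul_left_comm, ← mul_comm σ, mul_conj, normSq_eq_norm_sq, hσn]; simp
  have hkb := kS_bd f ξ Q B L hQ hz
  have hkey : ∀ d : FR,
    k1S Q (zt f ξ) d + (M + 2 * a) * (cJ σ * BV).re = 0 ∧
    0 ≤ k2S Q (zt f ξ) d + M * ((cJ σ * JQ).re +
      (cJ σ * BV).im ^ 2 / a)
      + (cJ σ * BV).re ^ 2
      + 2 * a * (cJ σ * JQ).re
      + (cJ σ * BV).im ^ 2 := by
    intro d
    obtain ⟨r, hr, hk⟩ := kS_exp f ξ d Q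
    refine secOrd (fun t => kS f Q JY) r (fun t => cJ σ * pS f JY)
      (fun t => cJ σ * Kg)
      (kS f Q ξ) _ _ a M _ _ hap hM.le hr (by fun_prop) hk ?_ ?_
    · intro t
      rw [pS_exp, ← hcσ]; ring
    · have hc : Filter.Tendsto (fun t : ℝ => ‖ξ + t • d‖) (nhds 0) (nhds ‖ξ‖) := by
        have : Continuous (fun t : ℝ => ‖ξ + t • d‖) := by fun_prop
        simpa using this.tendsto 0
      filter_upwards [hc.eventually (gt_mem_nhds hξR)] with t ht
      have := hmin _ (le_of_lt ht)
      simp only [hH] at this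
      simp only [norm_mul, RCLike.norm_conj, hσn, one_mul]
      linarith
  obtain ⟨j0, hj0⟩ : ∃ j, c0 / n ≤ f j ^ 2 := by
    by_contra hc
    push Not at hc
    have : ∑ j, f j ^ 2 < ∑ j : Fin n, c0 / n :=
      Finset.sum_lt_sum_of_nonempty ⟨⟨0, hn⟩, Finset.mem_univ _⟩ fun j _ => hc j
    simp at this
    rw [mul_div_cancel₀ _ hn'.ne'] at this
    linarith
  have hzj0 : c0 / n ≤ ‖zt f ξ j0‖ ^ 2 := by
    refine hj0.trans ?_
    rw [Complex.sq_norm, Complex.normSq_apply]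
    simp [zt]; nlinarith [sq_nonneg (ξ j0)]
  have hz4 : ∀ m : ℕ, (c0 / n) ^ m ≤ ∑ j, ‖zt f ξ j‖ ^ (2 * m) := fun m => by
    refine le_trans ?_ (single_le_sum (f := fun j => ‖zt f ξ j‖ ^ (2 * m))
      (fun j _ => by positivity) (Finset.mem_univ j0))
    simp only [pow_mul]
    gcongr
  refine hM0 M (zt f ξ) σ a (k1S Q (zt f ξ)) (k2S Q (zt f ξ)) (by linarith [le_abs_self M0]) hz
    (hz4 2) (hz4 3) hσn hap ?_ hpσ ?_ ?_ (fun d => (hkey d).1) (fun d hd => ?_)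
  · have := (abs_le.1 hkb).1
    have h2 : 0 ≤ a ^ 2 := sq_nonneg _
    simp only [hH, ← hp, ← ha] at hξneg
    linarith
  · intro d δ hd
    have hδ : 0 ≤ δ := (abs_nonneg _).trans (hd ⟨0, hn⟩)
    refine (dsum_bd Q _ B (15 * L ^ 5 * δ) hQ fun j l => ?_).trans (le_of_eq (by ring))
    refine (norm_add_le _ _).trans ?_
    simp only [norm_mul, norm_pow, RCLike.norm_conj, Complex.norm_ofNat, norm_real,
      norm_eq_abs]
    calc _ ≤ 3 * L ^ 2 * δ * L ^ 3 + L ^ 3 * (3 * L ^ 2 * δ) := by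
          gcongr <;> first | exact hz _ | exact hd _
      _ = 6 * (L ^ 5 * δ) := by ring
      _ ≤ 15 * (L ^ 5 * δ) := by gcongr; norm_num
      _ = _ := by ring
  · intro d δ hd
    have hδ : 0 ≤ δ := (abs_nonneg _).trans (hd ⟨0, hn⟩)
    refine (dsum_bd Q _ B (15 * L ^ 5 * δ ^ 2) hQ fun j l => ?_).trans (le_of_eq (by ring))
    refine (norm_add₃_le).trans ?_
    simp only [norm_mul, norm_pow, RCLike.norm_conj, Complex.norm_ofNat, norm_real,
      norm_eq_abs]
    calc _ ≤ 3 * L * δ ^ 2 * L ^ 3 + 9 * (L ^ 2 * δ * (L ^ 2 * δ)) + L ^ 3 * (3 * L * δ ^ 2) := by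
          gcongr <;> first | exact hz _ | exact hd _
      _ = 15 * (L ^ 4 * δ ^ 2) := by ring
      _ ≤ 15 * (L ^ 5 * δ ^ 2) := by gcongr <;> norm_num
      _ = _ := by ring
  · have h := (hkey d).2
    rw [hd] at h
    simpa using h
end
section
variable {n : ℕ}
def om (F2 : Fin n → FR) (Jx Jξ : FR) (j : Fin n) : ℂ :=
  Jξ j + (∑ m, F2 j m * Jx m : ℝ) * I
def klin (F1 : FR) (F2 : Fin n → FR) (F3 : Fin n → Fin n → FR)
    (ξ : FR) (N : ℝ) (Jx Jξ : FR) : ℝ :=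
  ∑ j, ∑ l, ((F2 j l * N + ∑ m, F3 j l m * Jx m) *
      (Bf).re
    + 2 * F2 j l * (3 * zt F1 ξ j ^ 2 * om F2 Jx Jξ j * cJ Km ^ 3).re)
def plin (F1 : FR) (F2 : Fin n → FR)
    (ξ : FR) (N : ℝ) (Jx Jξ : FR) : ℂ :=
  ∑ j, (zt F1 ξ j ^ 4 * N + 4 * zt F1 ξ j ^ 3 * om F2 Jx Jξ j)
lemma tri (K ρ : ℝ) (b b0 b1 u u0 u1 w w0 w1 : ℂ) (hρ : 0 ≤ ρ) (hρ1 : ρ ≤ 1)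
    (hb0 : ‖b0‖ ≤ K) (hb1 : ‖b1‖ ≤ K * ρ) (hb2 : ‖b - (b0 + b1)‖ ≤ K * ρ ^ 2)
    (hu0 : ‖u0‖ ≤ K) (hu1 : ‖u1‖ ≤ K * ρ) (hu2 : ‖u - (u0 + u1)‖ ≤ K * ρ ^ 2)
    (hw0 : ‖w0‖ ≤ K) (hw1 : ‖w1‖ ≤ K * ρ) (hw2 : ‖w - (w0 + w1)‖ ≤ K * ρ ^ 2) :
    ‖b * (u * w) - Jt‖
      ≤ 23 * K ^ 3 * ρ ^ 2 := by
  have hK : 0 ≤ K := (norm_nonneg _).trans hb0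
  have e : b * (u * w) - Jt =
    (b - (b0 + b1)) * (u * w) + b0 * ((u - (u0 + u1)) * w) + b0 * (u0 * (w - (w0 + w1)))
     + b0 * (u1 * (w - w0)) + b1 * (u - u0) * w + b1 * u0 * (w - w0) := by ring
  have g1 : ∀ {v v0 v1 : ℂ}, ‖v0‖ ≤ K → ‖v1‖ ≤ K * ρ → ‖v - (v0 + v1)‖ ≤ K * ρ ^ 2 →
      ‖v - v0‖ ≤ 2 * K * ρ ∧ ‖v‖ ≤ 3 * K := by
    intro v v0 v1 h0 h1 h2
    have h3 : K * ρ ^ 2 ≤ K * ρ := by gcongr; nlinarith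
    have h4 : K * ρ ≤ K := by nlinarith
    constructor
    · calc ‖v - v0‖ = ‖(v - (v0 + v1)) + v1‖ := by congr 1; ring
        _ ≤ _ := norm_add_le _ _
        _ ≤ _ := by linarith
    · calc ‖v‖ = ‖(v - (v0 + v1)) + v0 + v1‖ := by congr 1; ring
        _ ≤ _ := norm_add₃_le
        _ ≤ _ := by linarith
  obtain ⟨u3, u4⟩ := g1 hu0 hu1 hu2
  obtain ⟨w3, w4⟩ := g1 hw0 hw1 hw2
  rw [e]
  calc _ ≤ ‖(b - (b0 + b1)) * (u * w)‖ + ‖b0 * ((u - (u0 + u1)) * w)‖ + ‖b0 * (u0 * (w - (w0 + w1)))‖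
     + ‖b0 * (u1 * (w - w0))‖ + ‖b1 * (u - u0) * w‖ + ‖b1 * u0 * (w - w0)‖ := by
        refine (norm_add_le _ _).trans (add_le_add ((norm_add_le _ _).trans (add_le_add
          ((norm_add_le _ _).trans (add_le_add norm_add₃_le le_rfl)) le_rfl)) le_rfl)
    _ ≤ (K * ρ ^ 2) * ((3 * K) * (3 * K)) + K * ((K * ρ ^ 2) * (3 * K)) + K * (K * (K * ρ ^ 2))
        + K * (JV * Jr) + JV * Jr * (3 * K) + JV * K * Jr := by
        simp only [norm_mul]
        gcongr
    _ = 23 * K ^ 3 * ρ ^ 2 := by ring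
lemma pw34 (K ρ : ℝ) (hK : 1 ≤ K) (hρ : 0 ≤ ρ) (hρ1 : ρ ≤ 1) (z z' e : ℂ) (hz : ‖z‖ ≤ K) (he : ‖e‖ ≤ K * ρ)
    (h2 : ‖z' - (z + e)‖ ≤ K * ρ ^ 2) :
    ‖z' ^ 3 - (z ^ 3 + 3 * z ^ 2 * e)‖ ≤ 23 * K ^ 3 * ρ ^ 2 ∧
    ‖z' ^ 4 - (z ^ 4 + 4 * z ^ 3 * e)‖ ≤ 76 * K ^ 4 * ρ ^ 2 := by
  set f := z' - (z + e) with hf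
  have hz' : z' = z + (e + f) := by rw [hf]; ring
  have hK0 : 0 ≤ K := by linarith
  set d := e + f with hd
  have hdn : ‖d‖ ≤ 2 * K * ρ := by
    have h3 : K * ρ ^ 2 ≤ K * ρ := by gcongr; nlinarith
    calc _ ≤ ‖e‖ + ‖f‖ := norm_add_le _ _
      _ ≤ _ := by linarith
  have hr3 : ρ ^ 3 ≤ ρ ^ 2 := pow_le_pow_of_le_one hρ hρ1 (by norm_num)
  have hr4 : ρ ^ 4 ≤ ρ ^ 2 := pow_le_pow_of_le_one hρ hρ1 (by norm_num)
  constructor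
  · have e1 : z' ^ 3 - (z ^ 3 + 3 * z ^ 2 * e) = 3 * z ^ 2 * f + 3 * z * d ^ 2 + d ^ 3 := by
      rw [hz', hd]; ring
    rw [e1]
    calc _ ≤ ‖3 * z ^ 2 * f‖ + ‖3 * z * d ^ 2‖ + ‖d ^ 3‖ := norm_add₃_le
      _ ≤ 3 * K ^ 2 * (K * ρ ^ 2) + 3 * K * Jr ^ 2 + Jr ^ 3 := by
        simp only [norm_mul, norm_pow, Complex.norm_ofNat]
        gcongr
      _ = 15 * K ^ 3 * ρ ^ 2 + 8 * K ^ 3 * ρ ^ 3 := by ring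
      _ ≤ 15 * K ^ 3 * ρ ^ 2 + 8 * K ^ 3 * ρ ^ 2 := by gcongr
      _ = _ := by ring
  · have e1 : z' ^ 4 - (z ^ 4 + 4 * z ^ 3 * e) = 4 * z ^ 3 * f + 6 * z ^ 2 * d ^ 2 + 4 * z * d ^ 3 + d ^ 4 := by
      rw [hz', hd]; ring
    rw [e1]
    calc _ ≤ ‖4 * z ^ 3 * f‖ + ‖6 * z ^ 2 * d ^ 2‖ + ‖4 * z * d ^ 3‖ + ‖d ^ 4‖ :=
          (norm_add_le _ _).trans (add_le_add norm_add₃_le le_rfl)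
      _ ≤ 4 * K ^ 3 * (K * ρ ^ 2) + 6 * K ^ 2 * Jr ^ 2 + 4 * K * Jr ^ 3 + Jr ^ 4 := by
        simp only [norm_mul, norm_pow, Complex.norm_ofNat]
        gcongr
      _ = 28 * K ^ 4 * ρ ^ 2 + 32 * K ^ 4 * ρ ^ 3 + 16 * K ^ 4 * ρ ^ 4 := by ring
      _ ≤ 28 * K ^ 4 * ρ ^ 2 + 32 * K ^ 4 * ρ ^ 2 + 16 * K ^ 4 * ρ ^ 2 := by gcongr
      _ = _ := by ring
lemma affT (K ρ : ℝ) (hK : 1 ≤ K) (hρ : 0 ≤ ρ) (hρ1 : ρ ≤ 1) (z z' e : Fin n → ℂ)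
    (b b0 b1 : Fin n → FR)
    (hz : ∀ j, ‖z j‖ ≤ K) (he : ∀ j, ‖e j‖ ≤ K * ρ) (h2 : ∀ j, ‖z' j - (z j + e j)‖ ≤ K * ρ ^ 2)
    (hb0 : ∀ j l, |b0 j l| ≤ K) (hb1 : ∀ j l, |b1 j l| ≤ K * ρ)
    (hb2 : ∀ j l, |b j l - (b0 j l + b1 j l)| ≤ K * ρ ^ 2) (hsym : ∀ j l, b0 j l = b0 l j) :
    |(∑ j, ∑ l, b j l * (Kt).re) -
      ∑ j, ∑ l, Kw|
      ≤ n * (n * (23 * (23 * K ^ 3) ^ 3 * ρ ^ 2)) ∧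
    ‖(∑ j, z' j ^ 4) - ∑ j, (z j ^ 4 + 4 * z j ^ 3 * e j)‖ ≤ n * (76 * K ^ 4 * ρ ^ 2) := by
  have hp := fun j => pw34 K ρ hK hρ hρ1 (z j) (z' j) (e j) (hz j) (he j) (h2 j)
  constructor
  · have hswap : ∑ j, ∑ l, b0 j l * (BN).re =
        ∑ j, ∑ l, b0 j l * (z j ^ 3 * cJ (3 * z l ^ 2 * e l)).re := by
      rw [sum_comm]
      refine sum_congr rfl fun j _ => sum_congr rfl fun l _ => ?_
      rw [hsym l j, ← Complex.conj_re (z j ^ 3 * _)]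
      congr 2
      simp only [map_mul, map_pow, conj_conj]
      ring
    have e1 : (∑ j, ∑ l, b j l * (Kt).re) -
      ∑ j, ∑ l, Kw =
      ∑ j, ∑ l, ((b j l : ℂ) * Kt -
        ((b0 j l : ℂ) * Bu +
         (b1 j l : ℂ) * Bu +
         (b0 j l : ℂ) * BN +
         (b0 j l : ℂ) * (z j ^ 3 * cJ (3 * z l ^ 2 * e l)))).re := by
      simp only [sub_re, add_re, re_ofReal_mul, sum_sub_distrib, sum_add_distrib]
      rw [← hswap]
      simp only [mul_assoc, add_mul, sum_add_distrib, ← mul_sum]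
      ring
    rw [e1, ← norm_eq_abs]
    refine norm_sum_le' _ _ fun j => norm_sum_le' _ _ fun l => ?_
    refine (abs_re_le_norm _).trans ?_
    have k3 : 1 ≤ K ^ 3 := one_le_pow₀ hK
    have k1 : K ≤ K ^ 3 := le_self_pow₀ hK (by norm_num)
    have kk : K ≤ 23 * K ^ 3 := by linarith
    have hu0 : ∀ j, ‖z j ^ 3‖ ≤ 23 * K ^ 3 := fun j => by
      rw [norm_pow]
      have := pow_le_pow_left₀ (norm_nonneg _) (hz j) 3
      linarith
    have hu1 : ∀ j, ‖3 * z j ^ 2 * e j‖ ≤ 23 * K ^ 3 * ρ := fun j => by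
      simp only [norm_mul, norm_pow, Complex.norm_ofNat]
      calc _ ≤ 3 * K ^ 2 * JV := by gcongr; exact hz j; exact he j
        _ = 3 * K ^ 3 * ρ := by ring
        _ ≤ _ := by gcongr; norm_num
    refine tri (23 * K ^ 3) ρ _ _ _ _ _ _ _ _ _ hρ hρ1 ?_ ?_ ?_ (hu0 j) (hu1 j) (hp j).1 ?_ ?_ ?_
    · rw [norm_real]; exact (hb0 j l).trans kk
    · rw [norm_real]; exact (hb1 j l).trans (by gcongr)
    · rw [← Complex.ofReal_add, ← Complex.ofReal_sub, norm_real]; exact (hb2 j l).trans (by gcongr)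
    · rw [← map_pow, norm_conj]; exact hu0 l
    · rw [norm_conj]; exact hu1 l
    · rw [← map_pow, ← map_pow, ← map_add, ← map_sub, norm_conj]; exact (hp l).1
  · rw [← sum_sub_distrib]
    exact norm_sum_le' _ _ fun j => (hp j).2
end
section
variable {n : ℕ}
lemma qf (a : FR) (v : Fin n → ℂ) :
    ∑ j, ∑ l, (a j * a l) * (v j * cJ (v l)).re = ‖∑ j, a j * v j‖ ^ 2 := by
  have h : ((‖∑ j, (a j : ℂ) * v j‖ ^ 2 : ℝ) : ℂ) = ∑ j, ∑ l, ((a j * a l : ℝ) : ℂ) * (v j * cJ (v l)) := by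
    push_cast
    rw [← Complex.mul_conj', map_sum, sum_mul_sum]
    refine sum_congr rfl fun j _ => sum_congr rfl fun l _ => ?_
    simp; ring
  have := congrArg Complex.re h
  rw [ofReal_re] at this
  rw [this]
  simp only [re_sum, re_ofReal_mul]
def s1f (Λ g : ℝ) (x : FR) (j : Fin n) : ℝ := Λ * x j * g
def s2f (Λ g : ℝ) (x : FR) (j l : Fin n) : ℝ :=
  ((if j = l then Λ else 0) + Λ ^ 2 * (x j * x l)) * g
lemma Elow (z : Fin n → ℂ) (F2 : Fin n → FR) (x : FR) (Λ lam g M2 L S c1 : ℝ)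
    (hg : 1 ≤ g) (hΛ : 0 ≤ Λ) (hΛ2 : 4 * M2 ^ 2 + 1 ≤ Λ * c1) (hc1 : c1 ≤ ∑ j, ‖z j‖ ^ 6)
    (hz : ∀ j, ‖z j‖ ≤ L) (hS : ∀ j, |s1f Λ g x j| ≤ S) (hl : 0 < lam) (hl2 : 18 * n * L ^ 4 * S ^ 2 ≤ lam) :
    1 / 2 + 4 * M2 * ‖∑ j, z j ^ 3 * s1f Λ g x j‖ ≤
     ∑ j, ∑ l, (BA * (Bu).re
      + 2 * F2 j l * (Bl).re) := by
  set Y := ‖∑ j, (x j : ℂ) * z j ^ 3‖ with hY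
  set w : Fin n → ℂ := fun m => ∑ l, (F2 m l : ℂ) * z l ^ 3 with hw
  have P0 : ‖∑ j, z j ^ 3 * s1f Λ g x j‖ = Λ * g * Y := by
    have : ∑ j, z j ^ 3 * (s1f Λ g x j : ℂ) = ((Λ * g : ℝ) : ℂ) * ∑ j, (x j : ℂ) * z j ^ 3 := by
      rw [mul_sum]
      refine sum_congr rfl fun j _ => ?_
      simp only [s1f]; push_cast; ring
    rw [this, norm_mul, norm_real, norm_of_nonneg (by positivity)]
  have P1 : ∑ j, ∑ l, s2f Λ g x j l * (Bu).re =
      g * (Λ * ∑ j, ‖z j‖ ^ 6 + Λ ^ 2 * Y ^ 2) := by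
    rw [hY, ← qf]
    have e1 : ∑ j, ‖z j‖ ^ 6 = ∑ j, ∑ l, (if j = l then 1 else 0) * (Bu).re := by
      refine sum_congr rfl fun j _ => ?_
      simp only [ite_mul, one_mul, zero_mul, Finset.sum_ite_eq, Finset.mem_univ, if_true]
      rw [← map_pow, Complex.mul_conj', ← Complex.ofReal_pow, ofReal_re, norm_pow]; ring
    rw [e1]
    simp only [mul_sum, ← sum_add_distrib]
    refine sum_congr rfl fun j _ => sum_congr rfl fun l _ => ?_
    simp only [s2f, map_pow]
    split_ifs <;> ring
  have P2 : ∑ j, ∑ l, (lam * ∑ m, F2 m l * F2 m j) * (Bu).re =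
      lam * ∑ m, ‖w m‖ ^ 2 := by
    simp only [hw, ← qf]
    simp only [mul_sum, sum_mul]
    rw [sum_comm]
    conv_rhs => rw [sum_comm]
    rw [sum_comm]
    refine sum_congr rfl fun j _ => ?_
    rw [sum_comm]
    refine sum_congr rfl fun m _ => sum_congr rfl fun l _ => ?_
    rw [map_pow]; ring
  have P3 : -(lam * ∑ m, ‖w m‖ ^ 2 + 1 / 2) ≤
      ∑ j, ∑ l, 2 * F2 j l * (Bl).re := by
    have e : ∀ j, ∑ l, 2 * F2 j l * (Bl).re
       = (6 * (z j ^ 2 * (s1f Λ g x j * I) * cJ Jz)).re := by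
      intro j
      simp only [hw, map_sum, mul_sum, re_sum]
      refine sum_congr rfl fun l _ => ?_
      rw [show (6 * (z j ^ 2 * (↑(s1f Λ g x j) * I) * cJ (↑(F2 j l) * z l ^ 3)))
        = ((2 * F2 j l : ℝ) : ℂ) * Bl by
          simp; ring, re_ofReal_mul]
    simp only [e]
    have h1 : ∀ j, -(lam * ‖w j‖ ^ 2 + 9 * L ^ 4 * S ^ 2 / lam) ≤
        (6 * (z j ^ 2 * (s1f Λ g x j * I) * cJ Jz)).re := by
      intro j
      refine le_trans ?_ (abs_le.1 (abs_re_le_norm _)).1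
      rw [neg_le_neg_iff]
      simp only [norm_mul, norm_pow, norm_conj, norm_I, norm_real, Complex.norm_ofNat,
        norm_eq_abs]
      have hL : 0 ≤ L := (norm_nonneg _).trans (hz j)
      calc 6 * (‖z j‖ ^ 2 * (|s1f Λ g x j| * 1) * ‖w j‖) ≤ 6 * (L ^ 2 * (S * 1) * ‖w j‖) := by
            gcongr; exact hz j; exact hS j
        _ ≤ _ := by
            have := sq_nonneg (lam * ‖w j‖ - 3 * (L ^ 2 * S))
            rw [← sub_nonneg]
            have e2 : lam * ‖w j‖ ^ 2 + 9 * L ^ 4 * S ^ 2 / lam - 6 * (L ^ 2 * (S * 1) * ‖w j‖)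
              = (lam * ‖w j‖ - 3 * (L ^ 2 * S)) ^ 2 / lam := by field_simp; ring
            rw [e2]; positivity
    refine le_trans ?_ (sum_le_sum fun j _ => h1 j)
    rw [sum_neg_distrib, sum_add_distrib, ← mul_sum]
    simp only [sum_const, Finset.card_univ, Fintype.card_fin, nsmul_eq_mul]
    have : (n : ℝ) * (9 * L ^ 4 * S ^ 2 / lam) ≤ 1 / 2 := by
      rw [mul_div_assoc', div_le_iff₀ hl]; linarith
    linarith
  have P4 : 1 + 4 * M2 * (Λ * g * Y) ≤ g * (Λ * ∑ j, ‖z j‖ ^ 6 + Λ ^ 2 * Y ^ 2) := by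
    have h1 : Λ * c1 ≤ Λ * ∑ j, ‖z j‖ ^ 6 := by gcongr
    have h2 := sq_nonneg (Λ * Y - 2 * M2)
    have h3 : 1 + 4 * M2 * (Λ * Y) ≤ Λ * ∑ j, ‖z j‖ ^ 6 + Λ ^ 2 * Y ^ 2 := by nlinarith
    have h4 := mll h3 (by linarith : 0 ≤ g)
    nlinarith
  simp only [sum_add_distrib, add_mul]
  rw [P0, P1, P2]
  linarith
end
section
variable {n : ℕ}
lemma om_bd (F2 : Fin n → FR) (dx dξ : FR) (K ρ : ℝ) (hK : 0 ≤ K)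
    (h2 : ∀ j l, |F2 j l| ≤ K) (hx : ∀ m, |dx m| ≤ ρ) (hξ : ∀ m, |dξ m| ≤ ρ) (j : Fin n) :
    ‖om F2 dx dξ j‖ ≤ Jn * ρ := by
  unfold om
  refine (norm_add_le _ _).trans ?_
  rw [norm_mul, norm_real, norm_real, norm_I, mul_one]
  have : ‖∑ m, F2 j m * dx m‖ ≤ n * JV := by
    refine norm_sum_le' _ _ fun m => ?_
    rw [norm_mul]
    exact mul_le_mul (h2 j m) (hx m) (norm_nonneg _) hK
  have h3 : ‖dξ j‖ ≤ ρ := hξ j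
  linarith
lemma lin_bd (K : ℝ) (hK : 0 ≤ K) : ∃ C > 0, ∀ (F1 : FR) (F2 : Fin n → FR)
    (F3 : Fin n → Fin n → FR) (ξ dx dξ : FR) (ρ : ℝ), 0 ≤ ρ →
    (∀ j, |F1 j| ≤ K) → (∀ j l, |F2 j l| ≤ K) → Kj →
    (∀ m, |dx m| ≤ ρ) → (∀ m, |dξ m| ≤ ρ) →
    |klin F1 F2 F3 ξ 1 dx dξ| ≤ C * Bq ^ 4 * JW ∧
    ‖plin F1 F2 ξ 1 dx dξ - pS F1 ξ‖ ≤ C * Bq ^ 2 * ρ := by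
  set L := 1 + K ^ 2 with hL
  have hL1 : 1 ≤ L := by nlinarith
  set C1 := n * (n * ((K + n * K + 6 * K * Jn) * L ^ 4)) with hC1
  set C2 := n * (4 * L ^ 2 * Jn) with hC2
  have hC1p : 0 ≤ C1 := by positivity
  have hC2p : 0 ≤ C2 := by positivity
  refine ⟨C1 + C2 + 1, by positivity, fun F1 F2 F3 ξ dx dξ ρ hρ h1 h2 h3 hx hξ => ?_⟩
  set w := 1 + ∑ j, ξ j ^ 2 with hw
  have hw1 : 1 ≤ w := by
    have : 0 ≤ ∑ j, ξ j ^ 2 := sum_nonneg fun _ _ => sq_nonneg _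
    linarith
  have hLw : 1 ≤ L * w := by nlinarith
  have hz2 : ∀ j, ‖zt F1 ξ j‖ ^ 2 ≤ L * w := by
    intro j
    rw [← normSq_eq_norm_sq, zt, Complex.normSq_add_mul_I]
    have a1 : ξ j ^ 2 ≤ ∑ j, ξ j ^ 2 := single_le_sum (f := fun j => ξ j ^ 2) (fun _ _ => sq_nonneg _) (Finset.mem_univ j)
    have a2 : F1 j ^ 2 ≤ K ^ 2 := sq_le_sq.2 (by rw [abs_of_nonneg hK]; exact h1 j)
    nlinarith [sq_nonneg K]
  have hz3 : ∀ j, ‖zt F1 ξ j‖ ^ 3 ≤ JK ^ 2 := by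
    intro j
    have h4 : ‖zt F1 ξ j‖ ^ 4 ≤ JK ^ 2 := by
      have := pow_le_pow_left₀ (sq_nonneg _) (hz2 j) 2
      rw [← pow_mul] at this; exact this
    rcases le_total ‖zt F1 ξ j‖ 1 with h | h
    · exact (pow_le_one₀ (norm_nonneg _) h).trans (one_le_pow₀ hLw)
    · exact (pow_le_pow_right₀ h (by norm_num : 3 ≤ 4)).trans h4
  have hom := om_bd F2 dx dξ K ρ hK h2 hx hξ
  constructor
  · have : |klin F1 F2 F3 ξ 1 dx dξ| ≤ n * (n * ((K + n * JV) * (JK ^ 2 * JK ^ 2)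
        + 2 * K * (3 * JK * (Jn * ρ) * JK ^ 2))) := by
      unfold klin
      rw [← norm_eq_abs]
      refine norm_sum_le' _ _ fun j => norm_sum_le' _ _ fun l => ?_
      refine (norm_add_le _ _).trans (add_le_add ?_ ?_)
      · rw [norm_mul]
        refine mul_le_mul ?_ ?_ (norm_nonneg _) (by positivity)
        · refine (norm_add_le _ _).trans (add_le_add (by simpa using h2 j l) ?_)
          refine norm_sum_le' _ _ fun m => ?_
          rw [norm_mul]
          exact mul_le_mul (h3 j l m) (hx m) (norm_nonneg _) hK
        · refine (abs_re_le_norm _).trans ?_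
          rw [norm_mul, ← map_pow, norm_conj, norm_pow, norm_pow]
          exact mul_le_mul (hz3 j) (hz3 l) (by positivity) (by positivity)
      · rw [norm_mul]
        refine mul_le_mul ?_ ?_ (norm_nonneg _) (by positivity)
        · rw [norm_mul]; simpa using h2 j l
        · refine (abs_re_le_norm _).trans ?_
          rw [← map_pow]
          simp only [norm_mul, norm_conj, norm_pow, Complex.norm_ofNat]
          gcongr
          · exact hz2 j
          · exact hom j
          · exact hz3 l
    refine this.trans ?_
    have e1 : JK * JK ^ 2 ≤ L ^ 4 * w ^ 4 := by
      rw [← mul_pow, ← pow_succ']; exact pow_le_pow_right₀ hLw (by norm_num)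
    calc _ = n * (n * ((K + n * JV) * (L ^ 4 * w ^ 4)
        + 6 * K * (Jn * ρ) * (JK * JK ^ 2))) := by ring
      _ ≤ n * (n * ((K + n * JV) * (L ^ 4 * w ^ 4)
        + 6 * K * (Jn * ρ) * (L ^ 4 * w ^ 4))) := by gcongr
      _ = n * (n * ((K + n * K * ρ + 6 * K * Jn * ρ) * L ^ 4)) * w ^ 4 := by ring
      _ ≤ n * (n * ((K * JW + n * K * JW + 6 * K * Jn * JW) * L ^ 4)) * w ^ 4 := by
        gcongr <;> nlinarith
      _ = C1 * w ^ 4 * JW := by rw [hC1]; ring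
      _ ≤ _ := by gcongr; linarith
  · have : ‖plin F1 F2 ξ 1 dx dξ - pS F1 ξ‖ ≤ n * (4 * JK ^ 2 * (Jn * ρ)) := by
      unfold plin pS
      rw [← sum_sub_distrib]
      refine norm_sum_le' _ _ fun j => ?_
      have : zt F1 ξ j ^ 4 * ((1:ℝ):ℂ) + 4 * zt F1 ξ j ^ 3 * om F2 dx dξ j - zt F1 ξ j ^ 4
        = 4 * zt F1 ξ j ^ 3 * om F2 dx dξ j := by push_cast; ring
      rw [this]
      simp only [norm_mul, norm_pow, Complex.norm_ofNat]
      gcongr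
      · exact hz3 j
      · exact hom j
    refine this.trans ?_
    calc _ = C2 * w ^ 2 * ρ := by rw [hC2]; ring
      _ ≤ _ := by gcongr; linarith
lemma sixlow (F1 ξ : FR) (c0 : ℝ) (hc0 : 0 < c0) (h : c0 ≤ ∑ j, F1 j ^ 2) :
    (c0 / n) ^ 3 ≤ ∑ j, ‖zt F1 ξ j‖ ^ 6 := by
  rcases Nat.eq_zero_or_pos n with hn | hn
  · subst hn; simp at h; linarith
  haveI : Nonempty (Fin n) := ⟨⟨0, hn⟩⟩
  have hn' : (0:ℝ) < n := by exact_mod_cast hn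
  obtain ⟨j, -, hj⟩ := Finset.exists_le_of_sum_le (s := Finset.univ) (f := fun _ : Fin n => c0 / n) (g := fun j => F1 j ^ 2)
    Finset.univ_nonempty (by simp; rw [mul_div_cancel₀ _ hn'.ne']; exact h)
  have h1 : c0 / n ≤ ‖zt F1 ξ j‖ ^ 2 := by
    rw [← normSq_eq_norm_sq, zt, Complex.normSq_add_mul_I]
    nlinarith [sq_nonneg (ξ j)]
  have h2 := pow_le_pow_left₀ (by positivity) h1 3
  rw [← pow_mul] at h2
  exact h2.trans (single_le_sum (f := fun j => ‖zt F1 ξ j‖ ^ 6) (fun _ _ => by positivity) (Finset.mem_univ j))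
end
section
lemma affFin (M2 τ T p q a1 a2 k s E ρ : ℝ) (hM2 : 0 ≤ M2) (hτ0 : 0 ≤ τ)
    (h1 : q ≤ p + 4 * τ * T + a1 * (a2 * ρ)) (h2 : 1 / 2 + 4 * M2 * T ≤ E)
    (h3 : -(M2 * q) ≤ k) (hρ : 0 ≤ ρ) {d1 d2 : ℝ} (h4 : k - s ≤ d1 * (d1 * (d2 * ρ))) :
    τ / 2 - M2 * p - (M2 * (a1 * a2) + d1 * (d1 * d2) + 1) * ρ ≤ s + τ * E := by
  have m1 := mll h1 hM2
  have m2 := mll h2 hτ0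
  nlinarith
set_option maxHeartbeats 2000000 in
lemma affMain (n : ℕ) (B R S lam K M2 : ℝ) (hB : 0 ≤ B) (hR : 0 ≤ R) (hS0 : 0 ≤ S) (hl : 0 < lam) (hK : 1 ≤ K)
    (hM2 : 0 ≤ M2) (hl2 : 18 * n * (R + 2 * B) ^ 4 * S ^ 2 ≤ lam) :
    ∃ C > 0, ∀ (F1 : FR) (F2 : Fin n → FR) (F3 : Fin n → Fin n → FR) (ξ dx dξ : FR)
      (ρ τ Λ g : ℝ) (x a : FR) (b : Fin n → FR) (c1 : ℝ),
    (∀ j, |F1 j| ≤ 2 * B) → (∀ j l, |F2 j l| ≤ 2 * B) → Kj →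
    (∀ j l, F2 j l = F2 l j) → ‖ξ‖ ≤ R →
    (∀ m, |dx m| ≤ ρ) → (∀ m, |dξ m| ≤ ρ) → 0 ≤ τ → τ ≤ ρ → ρ ≤ 1 →
    1 ≤ g → 0 ≤ Λ → 4 * M2 ^ 2 + 1 ≤ Λ * c1 → c1 ≤ ∑ j, ‖zt F1 ξ j‖ ^ 6 →
    (∀ j, |s1f Λ g x j| ≤ S) → (∀ j l, |s2f Λ g x j l| ≤ S) →
    (∀ j, |a j - (F1 j + ∑ m, F2 j m * dx m - τ * s1f Λ g x j)| ≤ K * ρ ^ 2) →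
    (∀ j l, |b j l - (F2 j l + (∑ m, F3 j l m * dx m - τ * BA))|
      ≤ K * ρ ^ 2) →
    -(M2 * ‖pS a BE‖) ≤ kS a b BE →
    τ / 2 - M2 * ‖plin F1 F2 ξ 1 dx dξ‖ - C * ρ ^ 2 ≤ klin F1 F2 F3 ξ 1 dx dξ := by
  set K1 := (R + 2 * B) + (1 + n * (2 * B) + S) + K + (n * K + (S + lam * Jg)) with hK1
  have hKK : K ≤ K1 := by
    have : 0 ≤ lam * Jg := by positivity
    have : 0 ≤ n * K := by positivity
    have : 0 ≤ n * (2 * B) := by positivity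
    linarith
  have q1 : 0 ≤ lam * Jg := by positivity
  have q2 : 0 ≤ n * K := by positivity
  have q3 : 0 ≤ n * (2 * B) := by positivity
  refine ⟨M2 * (n * (76 * K1 ^ 4)) + n * (n * (23 * (23 * K1 ^ 3) ^ 3)) + 1, by positivity, ?_⟩
  intro F1 F2 F3 ξ dx dξ ρ τ Λ g x a b c1 h1 h2 h3 hsym hξ hx hdξ hτ0 hτ hρ1 hg hΛ hΛ2 hc1 hs1 hs2 ha hb hk
  have hρ : 0 ≤ ρ := hτ0.trans hτ
  set z := zt F1 ξ with hz
  have hzb : ∀ j, ‖z j‖ ≤ R + 2 * B := fun j => (zt_bd F1 ξ _ h1 j).trans (by linarith)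
  set e : Fin n → ℂ := fun j => om F2 dx dξ j - τ * s1f Λ g x j * I with he
  set b1 : Fin n → FR := fun j l => ∑ m, F3 j l m * dx m - τ * BA with hb1
  have hom := om_bd F2 dx dξ (2 * B) ρ (by positivity) h2 hx hdξ
  have hT := affT K1 ρ (hK.trans hKK) hρ hρ1 z (zt a BE) e b F2 b1 (fun j => (hzb j).trans (by linarith)) ?_ ?_
    (fun j l => (h2 j l).trans (by linarith)) ?_ ?_ hsym
  rotate_left
  · intro j
    refine (norm_sub_le _ _).trans ?_
    have e1 : ‖Kf * s1f Λ g x j * I‖ ≤ ρ * S := by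
      simp only [norm_mul, norm_real, norm_I, mul_one, norm_eq_abs]
      rw [abs_of_nonneg hτ0]
      exact mul_le_mul hτ (hs1 j) (abs_nonneg _) hρ
    have e2 : ((1 + n * (2 * B)) + S) * ρ ≤ K1 * ρ := by gcongr; linarith only [hK1, q1, q2, q3, hB, hR, hS0, hK]
    have := hom j
    linarith only [e1, e2, this]
  · intro j
    have : zt a BE j - (z j + e j) = ((a j - (F1 j + ∑ m, F2 j m * dx m - τ * s1f Λ g x j) : ℝ) : ℂ) * I := by
      simp only [hz, he, zt, om, Pi.add_apply]; push_cast; ring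
    rw [this, norm_mul, norm_I, mul_one, norm_real]
    exact (ha j).trans (by gcongr)
  · intro j l
    simp only [hb1]
    rw [← norm_eq_abs]
    refine (norm_sub_le _ _).trans ?_
    have e1 : ‖∑ m, F3 j l m * dx m‖ ≤ n * JV := norm_sum_le' _ _ fun m => by
      rw [norm_mul]; exact mul_le_mul (h3 j l m) (hx m) (norm_nonneg _) (by linarith)
    have e2 : ‖∑ m, F2 m l * F2 m j‖ ≤ n * (2 * B * (2 * B)) := norm_sum_le' _ _ fun m => by
      rw [norm_mul]; exact mul_le_mul (h2 _ _) (h2 _ _) (norm_nonneg _) (by linarith)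
    have e3 : ‖τ * BA‖ ≤ ρ * (S + lam * Jg) := by
      rw [norm_mul, norm_of_nonneg hτ0]
      refine mul_le_mul hτ ((norm_add_le _ _).trans (add_le_add (hs2 j l) ?_)) (norm_nonneg _) hρ
      rw [norm_mul, norm_of_nonneg hl.le]
      gcongr
    have e4 : (n * K + (S + lam * Jg)) * ρ ≤ K1 * ρ := by
      gcongr; linarith only [hK1, q1, q2, q3, hB, hR, hS0, hK]
    linarith only [e1, e3, e4]
  · intro j l
    exact (hb j l).trans (by gcongr)
  obtain ⟨T1, T2⟩ := hT
  have hE := Elow z F2 x Λ lam g M2 (R + 2 * B) S c1 hg hΛ hΛ2 hc1 hzb hs1 hl hl2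
  set T := ‖∑ j, z j ^ 3 * s1f Λ g x j‖ with hTd
  set EE := ∑ j, ∑ l, (BA * (Bu).re
      + 2 * F2 j l * (Bl).re) with hEE
  have I1 : klin F1 F2 F3 ξ 1 dx dξ = (∑ j, ∑ l, ((F2 j l + b1 j l) * (Bu).re
        + 2 * F2 j l * (BN).re)) + τ * EE := by
    rw [hEE, mul_sum, ← sum_add_distrib]
    unfold klin
    refine sum_congr rfl fun j _ => ?_
    rw [mul_sum, ← sum_add_distrib]
    refine sum_congr rfl fun l _ => ?_
    have : 3 * z j ^ 2 * e j * cJ (z l) ^ 3 = 3 * z j ^ 2 * om F2 dx dξ j * cJ (z l) ^ 3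
       - Kf * Bl := by
      simp only [he]; ring
    rw [this, sub_re, re_ofReal_mul, ← hz]
    simp only [hb1]
    ring
  have I2 : ∑ j, (z j ^ 4 + 4 * z j ^ 3 * e j) = plin F1 F2 ξ 1 dx dξ - 4 * I * τ * ∑ j, z j ^ 3 * s1f Λ g x j := by
    rw [mul_sum]
    unfold plin
    rw [← sum_sub_distrib]
    refine sum_congr rfl fun j _ => ?_
    simp only [he, ← hz]; push_cast; ring
  rw [I2] at T2
  have T3 : ‖pS a BE‖ ≤ ‖plin F1 F2 ξ 1 dx dξ‖ + 4 * τ * T + n * (76 * K1 ^ 4 * ρ ^ 2) := by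
    have e0 : pS a BE = Jj
       + plin F1 F2 ξ 1 dx dξ - 4 * I * τ * ∑ j, z j ^ 3 * s1f Λ g x j := by
       unfold pS; ring
    rw [e0]
    refine (norm_sub_le _ _).trans ?_
    have e1 : ‖4 * I * τ * ∑ j, z j ^ 3 * s1f Λ g x j‖ = 4 * τ * T := by
      simp only [norm_mul, norm_I, norm_real, Complex.norm_ofNat, mul_one]
      rw [norm_of_nonneg hτ0]
    rw [e1]
    have := (norm_add_le Jj (plin F1 F2 ξ 1 dx dξ))
    linarith only [this, T2]
  have T1' := (abs_le.1 T1).2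
  have hk' : -(M2 * ‖pS a BE‖) ≤ ∑ j, ∑ l, b j l * (zt a BE j ^ 3 * cJ (zt a BE l) ^ 3).re := hk
  rw [I1]
  exact affFin _ _ _ _ _ _ _ _ _ _ _ hM2 hτ0 T3 hE hk' (sq_nonneg ρ) T1'
end
section
lemma klin_smul {n : ℕ} (F1 F2 F3) (ξ : FR) (N : ℝ) (hN : N ≠ 0) (Jx Jξ : FR) :
    klin F1 F2 F3 ξ N Jx Jξ = N * klin F1 F2 F3 ξ 1 Kn JL := by
  have ho : ∀ j, om F2 Jx Jξ j = (N : ℂ) * om F2 Kn JL j := by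
    intro j
    have hN' : (N : ℂ) ≠ 0 := by exact_mod_cast hN
    simp only [om]
    have : ∑ m, F2 j m * Jx m = N * ∑ m, F2 j m * (Jx m / N) := by
      rw [mul_sum]; refine sum_congr rfl fun m _ => ?_
      field_simp
    rw [this]; push_cast; field_simp
  unfold klin
  rw [mul_sum]
  refine sum_congr rfl fun j _ => ?_
  rw [mul_sum]
  refine sum_congr rfl fun l _ => ?_
  have e1 : ∑ m, F3 j l m * Jx m = N * ∑ m, F3 j l m * (Jx m / N) := by
    rw [mul_sum]; refine sum_congr rfl fun m _ => ?_
    field_simp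
  rw [e1, ho, show (3 * zt F1 ξ j ^ 2 * (↑N * om F2 (fun j ↦ Jx j / N) (fun j ↦ Jξ j / N) j) * cJ Km ^ 3)
   = (N : ℂ) * (3 * zt F1 ξ j ^ 2 * om F2 (fun j ↦ Jx j / N) (fun j ↦ Jξ j / N) j * cJ Km ^ 3) by ring,
   re_ofReal_mul]
  ring
lemma plin_smul {n : ℕ} (F1 F2) (ξ : FR) (N : ℝ) (hN : N ≠ 0) (Jx Jξ : FR) :
    plin F1 F2 ξ N Jx Jξ = N * plin F1 F2 ξ 1 Kn JL := by
  have ho : ∀ j, om F2 Jx Jξ j = (N : ℂ) * om F2 Kn JL j := by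
    intro j
    have hN' : (N : ℂ) ≠ 0 := by exact_mod_cast hN
    simp only [om]
    have : ∑ m, F2 j m * Jx m = N * ∑ m, F2 j m * (Jx m / N) := by
      rw [mul_sum]; refine sum_congr rfl fun m _ => ?_
      field_simp
    rw [this]; push_cast; field_simp
  unfold plin
  rw [mul_sum]
  refine sum_congr rfl fun j _ => ?_
  rw [ho]; push_cast; ring
/-- the three regime combination, at the level of numbers -/
lemma affBig (C1 r w ρ τ k : ℝ) (hr : 0 < r) (hr1 : r ≤ 1) (hC1 : 0 ≤ C1) (hw : 1 ≤ w) (hρ : r ≤ ρ) (hτ : τ ≤ r)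
    (hk : -(C1 * w ^ 4 * JW) ≤ k) :
    τ / 2 - Bp / r ^ 2 * w ^ 4 * ρ ^ 2 ≤ k := by
  have hw4 : 1 ≤ w ^ 4 := one_le_pow₀ hw
  have h1 : 1 ≤ ρ ^ 2 / r ^ 2 := by rw [le_div_iff₀ (by positivity)]; nlinarith
  have h2 : ρ ≤ ρ ^ 2 / r ^ 2 := by
    rw [le_div_iff₀ (by positivity)]
    have : r ^ 2 ≤ r := by nlinarith
    nlinarith
  set q := ρ ^ 2 / r ^ 2 with hq
  have e : Bp / r ^ 2 * w ^ 4 * ρ ^ 2 = Bp * w ^ 4 * q := by rw [hq]; ring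
  rw [e]
  have h3 : C1 * w ^ 4 * JW ≤ C1 * w ^ 4 * (2 * q) := by gcongr; linarith
  have h4 : 1 ≤ w ^ 4 * q := by nlinarith
  nlinarith
lemma affFar (C1 C2 κ w ρ τ k p p0 : ℝ) (hC1 : 0 ≤ C1) (hC2 : 0 ≤ C2) (hκ : 0 < κ) (hw : 1 ≤ w) (hρ : 0 ≤ ρ) (hρ1 : ρ ≤ 1) (hτ : τ ≤ 1)
    (hk : -(C1 * w ^ 4 * JW) ≤ k) (hp : κ * w ^ 2 ≤ p0) (hpp : p0 - p ≤ C2 * w ^ 2 * ρ) :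
    τ / 2 - (2 * Bp / κ) * w ^ 2 * p - (2 * Bp / κ * (C2 ^ 2 / JX)) * w ^ 4 * ρ ^ 2 ≤ k := by
  have hw4 : 1 ≤ w ^ 4 := one_le_pow₀ hw
  have h1 : κ / 2 * w ^ 4 ≤ w ^ 2 * p + C2 ^ 2 / JX * w ^ 4 * ρ ^ 2 := by
    have a1 : κ * w ^ 2 - C2 * w ^ 2 * ρ ≤ p := by linarith
    have a2 := mll a1 (sq_nonneg w)
    have a3 : 0 ≤ w ^ 4 * ((κ - C2 * ρ) ^ 2 / JX) := by positivity
    have a4 : w ^ 4 * ((κ - C2 * ρ) ^ 2 / JX) = κ / 2 * w ^ 4 - C2 * w ^ 4 * ρ + C2 ^ 2 / JX * w ^ 4 * ρ ^ 2 := by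
      field_simp; ring
    nlinarith
  have h2 := mll h1 (by positivity : 0 ≤ 2 * Bp / κ)
  have e : 2 * Bp / κ * (κ / 2 * w ^ 4) = Bp * w ^ 4 := by field_simp
  rw [e] at h2
  have h3 : C1 * w ^ 4 * JW ≤ C1 * w ^ 4 * 2 := by gcongr; linarith
  linarith
set_option maxHeartbeats 8000000 in
theorem aff1 (n : ℕ) (B c0 Xb : ℝ) (hB : 0 ≤ B) (hc0 : 0 < c0) (hXb : 0 ≤ Xb) : ∃ Λ lam : ℝ, 0 < Λ ∧ 0 < lam ∧
    ∀ K r : ℝ, 1 ≤ K → 0 < r → r ≤ 1 → ∃ C > 0, ∀ (F1 : FR) (F2 : Fin n → FR)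
      (F3 : Fin n → Fin n → FR) (x : FR) (τ : ℝ),
    (∀ j, |x j| ≤ Xb) → (∀ j, |F1 j| ≤ 2 * B) → (∀ j l, |F2 j l| ≤ 2 * B) → Kj →
    (∀ j l, F2 j l = F2 l j) → c0 ≤ ∑ j, F1 j ^ 2 → 0 < τ → τ ≤ r →
    (∀ (dx : FR) (ρ : ℝ), (∀ m, |dx m| ≤ ρ) → τ ≤ ρ → ρ ≤ r → ∃ (a : FR) (b : Fin n → FR),
      (∀ j, |a j| ≤ B) ∧ (∀ j l, |b j l| ≤ B) ∧ c0 ≤ ∑ j, a j ^ 2 ∧ (∀ ξ, pS a ξ = 0 → 0 ≤ kS a b ξ) ∧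
      (∀ j, |a j - (F1 j + ∑ m, F2 j m * dx m - τ * s1f Λ (exp By) x j)| ≤ K * ρ ^ 2) ∧
      (∀ j l, |b j l - (F2 j l + (∑ m, F3 j l m * dx m - τ * (s2f Λ (exp By) x j l
        + lam * ∑ m, F2 m l * F2 m j)))| ≤ K * ρ ^ 2)) →
    ∀ (ξ : FR) (N : ℝ) (Jx Jξ : FR) (Mm : ℝ), 0 ≤ N → 0 ≤ Mm →
      ∑ j, Jx j ^ 2 + ∑ j, Jξ j ^ 2 ≤ N * Mm →
      τ / 2 * N - C * Bq ^ 2 * ‖plin F1 F2 ξ N Jx Jξ‖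
        - C * Bq ^ 4 * (Mm + τ ^ 2 * N) ≤ klin F1 F2 F3 ξ N Jx Jξ := by
  obtain ⟨M, hM, hA⟩ := lemA n B c0 hB hc0
  obtain ⟨R', hR'0, hR'⟩ := coer n (2 * B) (by positivity)
  obtain ⟨R, hRd⟩ : ∃ R, R = R' + 1 := ⟨_, rfl⟩
  have hR0 : 0 < R := by linarith
  obtain ⟨M2, hM2⟩ : ∃ M2, M2 = M + n * (R + 1 + B) ^ 4 := ⟨_, rfl⟩
  have hM2p : 0 ≤ M2 := by rw [hM2]; positivity
  rcases Nat.eq_zero_or_pos n with hn | hn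
  · subst hn
    refine ⟨1, 1, one_pos, one_pos, fun K r _ _ _ => ⟨1, one_pos, fun F1 F2 F3 x τ _ _ _ _ _ h => ?_⟩⟩
    simp at h; linarith
  have hn' : (0:ℝ) < n := by exact_mod_cast hn
  obtain ⟨c1, hc1⟩ : ∃ c1, c1 = (c0 / n) ^ 3 := ⟨_, rfl⟩
  have hc1p : 0 < c1 := by rw [hc1]; positivity
  obtain ⟨Λ, hΛd⟩ : ∃ Λ, Λ = (4 * M2 ^ 2 + 1) / c1 := ⟨_, rfl⟩
  have hΛ : 0 < Λ := by rw [hΛd]; positivity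
  have hΛc : 4 * M2 ^ 2 + 1 ≤ Λ * c1 := by rw [hΛd, div_mul_cancel₀ _ hc1p.ne']
  obtain ⟨G, hG⟩ : ∃ G, G = exp (Λ * (n * Xb ^ 2) / 2) := ⟨_, rfl⟩
  have hGp : 0 < G := by rw [hG]; positivity
  obtain ⟨S, hS⟩ : ∃ S, S = Λ * Xb * G + (Λ + Λ ^ 2 * (Xb * Xb)) * G := ⟨_, rfl⟩
  have hSp : 0 ≤ S := by rw [hS]; positivity
  obtain ⟨lam, hlam⟩ : ∃ lam, lam = 18 * n * (R + 2 * B) ^ 4 * S ^ 2 + 1 := ⟨_, rfl⟩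
  have hlamp : 0 < lam := by rw [hlam]; positivity
  refine ⟨Λ, lam, hΛ, hlamp, fun K r hK hr hr1 => ?_⟩
  obtain ⟨C0, hC0, hmain⟩ := affMain n B R S lam K M2 hB hR0.le hSp hlamp hK hM2p (by rw [hlam]; linarith)
  obtain ⟨C1, hC1, hlin⟩ := lin_bd (n := n) (K + 2 * B) (by linarith)
  obtain ⟨κ, hκd⟩ : ∃ κ : ℝ, κ = 1 / (2 * (1 + n) ^ 2) := ⟨_, rfl⟩
  have hκ : 0 < κ := by rw [hκd]; positivity
  have g1 : 0 < Bp / r ^ 2 := by positivity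
  have g2 : 0 < 2 * Bp / κ := by positivity
  have g3 : 0 < 2 * Bp / κ * (C1 ^ 2 / JX) := by positivity
  obtain ⟨C, hC⟩ : ∃ C, C = C0 + M2 + Bp / r ^ 2 + 2 * Bp / κ + 2 * Bp / κ * (C1 ^ 2 / JX) := ⟨_, rfl⟩
  have hCp : 0 < C := by linarith
  have hCM : M2 ≤ C := by linarith
  have hCC0 : C0 ≤ C := by linarith
  have hCa : Bp / r ^ 2 ≤ C := by linarith
  have hCb : 2 * Bp / κ ≤ C := by linarith
  have hCc : 2 * Bp / κ * (C1 ^ 2 / JX) ≤ C := by linarith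
  clear hC
  refine ⟨C, hCp, fun F1 F2 F3 x τ hx h1 h2 h3 hsym hc hτ0 hτr H => ?_⟩
  have hg1 : 1 ≤ exp By := one_le_exp (by positivity)
  have hgG : exp By ≤ G := by
    rw [hG]
    have : ∑ j, x j ^ 2 ≤ n * Xb ^ 2 := by
      have : ∀ j ∈ Finset.univ, x j ^ 2 ≤ Xb ^ 2 := fun j _ => sq_le_sq.2 (by rw [abs_of_nonneg hXb]; exact hx j)
      simpa using sum_le_sum this
    gcongr
  obtain ⟨g, hg⟩ : ∃ g, g = exp By := ⟨_, rfl⟩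
  rw [← hg] at H hg1 hgG
  have hg0 : 0 ≤ g := by linarith
  have hs1 : ∀ j, |s1f Λ g x j| ≤ S := fun j => by
    have : |s1f Λ g x j| ≤ Λ * Xb * G := by
      rw [s1f, abs_mul, abs_mul, abs_of_nonneg hΛ.le, abs_of_nonneg hg0]
      gcongr; exact hx j
    have : 0 ≤ (Λ + Λ ^ 2 * (Xb * Xb)) * G := by positivity
    linarith
  have hs2 : ∀ j l, |s2f Λ g x j l| ≤ S := fun j l => by
    have : |s2f Λ g x j l| ≤ (Λ + Λ ^ 2 * (Xb * Xb)) * G := by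
      rw [s2f, abs_mul, abs_of_nonneg hg0]
      have a1 : |(if j = l then Λ else 0) + Λ ^ 2 * (x j * x l)| ≤ Λ + Λ ^ 2 * (Xb * Xb) := by
        refine (abs_add_le _ _).trans (add_le_add ?_ ?_)
        · split_ifs
          · rw [abs_of_nonneg hΛ.le]
          · simpa using hΛ.le
        · rw [abs_mul, abs_of_nonneg (sq_nonneg Λ), abs_mul]
          gcongr; exact hx j; exact hx l
      gcongr
    have : 0 ≤ Λ * Xb * G := by positivity
    linarith
  have norm1 : ∀ (ξ dx dξ : FR) (d : ℝ), ∑ j, dx j ^ 2 + ∑ j, dξ j ^ 2 ≤ d →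
      τ / 2 - C * Bq ^ 2 * ‖plin F1 F2 ξ 1 dx dξ‖
        - C * Bq ^ 4 * (d + τ ^ 2) ≤ klin F1 F2 F3 ξ 1 dx dξ := by
    intro ξ dx dξ d hd
    have hd0 : 0 ≤ d := le_trans (by positivity) hd
    obtain ⟨w, hw⟩ : ∃ w, w = 1 + ∑ j, ξ j ^ 2 := ⟨_, rfl⟩
    have hw1 : 1 ≤ w := by
      have : 0 ≤ ∑ j, ξ j ^ 2 := sum_nonneg fun _ _ => sq_nonneg _
      linarith
    obtain ⟨ρ, hρd⟩ : ∃ ρ, ρ = sqrt (d + τ ^ 2) := ⟨_, rfl⟩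
    have hρ0 : 0 ≤ ρ := by rw [hρd]; positivity
    have hρ2 : ρ ^ 2 = d + τ ^ 2 := by rw [hρd]; exact sq_sqrt (by positivity)
    have hτρ : τ ≤ ρ := by
      rw [hρd]; apply le_sqrt_of_sq_le; linarith
    have hxρ : ∀ m, |dx m| ≤ ρ := fun m => by
      rw [hρd]; apply abs_le_sqrt
      have : dx m ^ 2 ≤ ∑ j, dx j ^ 2 := single_le_sum (f := fun j => dx j ^ 2) (fun _ _ => sq_nonneg _) (Finset.mem_univ m)
      have : 0 ≤ ∑ j, dξ j ^ 2 := by positivity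
      have := sq_nonneg τ
      linarith
    have hξρ : ∀ m, |dξ m| ≤ ρ := fun m => by
      rw [hρd]; apply abs_le_sqrt
      have : dξ m ^ 2 ≤ ∑ j, dξ j ^ 2 := single_le_sum (f := fun j => dξ j ^ 2) (fun _ _ => sq_nonneg _) (Finset.mem_univ m)
      have : 0 ≤ ∑ j, dx j ^ 2 := by positivity
      have := sq_nonneg τ
      linarith
    obtain ⟨L1, L2⟩ := hlin F1 F2 F3 ξ dx dξ ρ hρ0 (fun j => (h1 j).trans (by linarith))
      (fun j l => (h2 j l).trans (by linarith)) (fun j l m => (h3 j l m).trans (by linarith)) hxρ hξρ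
    rw [← hw] at L1 L2 ⊢
    rw [← hρ2]
    have L1' := (abs_le.1 L1).1
    have P0 : 0 ≤ ‖plin F1 F2 ξ 1 dx dξ‖ := norm_nonneg _
    obtain ⟨p, hp⟩ : ∃ p, p = ‖plin F1 F2 ξ 1 dx dξ‖ := ⟨_, rfl⟩
    rw [← hp] at P0 ⊢
    have hw2 : 0 ≤ w ^ 2 := by positivity
    have hw4 : 1 ≤ w ^ 4 := one_le_pow₀ hw1
    have Z1 : 0 ≤ w ^ 2 * p := by positivity
    have Z2 : 0 ≤ w ^ 4 * ρ ^ 2 := by positivity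
    have fin : ∀ c c' k : ℝ, c ≤ C → c' ≤ C → τ / 2 - c * (w ^ 2 * p) - c' * (w ^ 4 * ρ ^ 2) ≤ k →
        τ / 2 - C * w ^ 2 * p - C * w ^ 4 * ρ ^ 2 ≤ k := by
      intro c c' k hc hc' hk
      have := mlr hc Z1
      have := mlr hc' Z2
      linarith
    rcases le_total r ρ with hrρ | hrρ
    · have := affBig C1 r w ρ τ _ hr hr1 hC1.le hw1 hrρ hτr L1'
      refine fin 0 (Bp / r ^ 2) _ hCp.le hCa (le_trans (le_of_eq ?_) this)
      ring
    rcases le_total R ‖ξ‖ with hξR | hξR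
    · have c1 := (hR' F1 ξ F2 h1 h2 (by linarith)).1
      have hsup : w ≤ (1 + n) * ‖ξ‖ ^ 2 := by
        have : ∀ j ∈ Finset.univ, ξ j ^ 2 ≤ ‖ξ‖ ^ 2 := fun j _ =>
          sq_le_sq.2 (by rw [abs_of_nonneg (norm_nonneg ξ)]; exact norm_le_pi_norm ξ j)
        have := sum_le_sum this
        simp at this
        have h1 : 1 ≤ ‖ξ‖ := by linarith
        have h2 : 1 ≤ ‖ξ‖ ^ 2 := one_le_pow₀ h1
        rw [hw]
        clear * - h2 this
        linarith
      have c2 : κ * w ^ 2 ≤ ‖pS F1 ξ‖ := by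
        refine le_trans ?_ c1
        have := pow_le_pow_left₀ (by linarith) hsup 2
        rw [hκd]
        rw [div_mul_eq_mul_div, div_le_div_iff₀ (by positivity) (by positivity)]
        clear * - this
        linarith
      have c3 : ‖pS F1 ξ‖ - p ≤ C1 * w ^ 2 * ρ := by
        rw [hp]
        refine le_trans ?_ L2
        rw [norm_sub_rev]
        exact norm_sub_norm_le _ _
      have := affFar C1 C1 κ w ρ τ _ p _ hC1.le hC1.le hκ hw1 hρ0 (hrρ.trans hr1) (hτr.trans hr1) L1' c2 c3
      refine fin (2 * Bp / κ) (2 * Bp / κ * (C1 ^ 2 / JX)) _ hCb hCc (le_trans (le_of_eq ?_) this)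
      ring
    · obtain ⟨a, b, ha, hb, hca, hbr, ha2, hb2⟩ := H dx ρ hxρ hτρ hrρ
      have hk := hA a b ha hb hca hbr BE
      have hpb : ‖pS a BE‖ ≤ n * (R + 1 + B) ^ 4 := by
        unfold pS
        refine norm_sum_le' _ _ fun j => ?_
        rw [norm_pow]
        refine pow_le_pow_left₀ (norm_nonneg _) ((zt_bd a _ B ha j).trans ?_) 4
        have : ‖dξ‖ ≤ 1 := (pi_norm_le_iff_of_nonneg zero_le_one).2 fun m => (hξρ m).trans (hrρ.trans hr1)
        have := norm_add_le ξ dξ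
        linarith
      have hk2 : -(M2 * ‖pS a BE‖) ≤ kS a b BE := by
        refine le_trans ?_ hk
        rw [hM2]
        have := mll hpb (norm_nonneg (pS a BE))
        rw [neg_le_neg_iff, sq, add_mul]
        linarith
      have := hmain F1 F2 F3 ξ dx dξ ρ τ Λ g x a b c1 h1 h2 h3 hsym hξR hxρ hξρ hτ0.le hτρ (hrρ.trans hr1)
        hg1 hΛ.le hΛc (by rw [hc1]; exact sixlow F1 ξ c0 hc0 hc) hs1 hs2 ha2 hb2 hk2
      rw [← hp] at this
      have b1 : M2 * p ≤ C * (w ^ 2 * p) := by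
        have : 1 ≤ w ^ 2 := one_le_pow₀ hw1
        exact mul_le_mul hCM (le_mul_of_one_le_left P0 this) P0 hCp.le
      have b2 : C0 * ρ ^ 2 ≤ C * (w ^ 4 * ρ ^ 2) := by
        exact mul_le_mul hCC0 (le_mul_of_one_le_left (sq_nonneg _) hw4) (sq_nonneg _) hCp.le
      refine fin C C _ le_rfl le_rfl (le_trans ?_ this)
      clear * - b1 b2
      linarith
  intro ξ N Jx Jξ Mm hN hMm hJ
  rcases hN.eq_or_lt with hN0 | hN0
  · rw [← hN0] at hJ ⊢
    have s1 : ∀ m, Jx m = 0 := fun m => by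
      have : Jx m ^ 2 ≤ ∑ j, Jx j ^ 2 := single_le_sum (f := fun j => Jx j ^ 2) (fun _ _ => sq_nonneg _) (Finset.mem_univ m)
      have : 0 ≤ ∑ j, Jξ j ^ 2 := by positivity
      have : Jx m ^ 2 ≤ 0 := by linarith
      exact pow_eq_zero_iff (two_ne_zero) |>.1 (le_antisymm this (sq_nonneg _))
    have s2 : ∀ m, Jξ m = 0 := fun m => by
      have : Jξ m ^ 2 ≤ ∑ j, Jξ j ^ 2 := single_le_sum (f := fun j => Jξ j ^ 2) (fun _ _ => sq_nonneg _) (Finset.mem_univ m)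
      have : 0 ≤ ∑ j, Jx j ^ 2 := by positivity
      have : Jξ m ^ 2 ≤ 0 := by linarith
      exact pow_eq_zero_iff (two_ne_zero) |>.1 (le_antisymm this (sq_nonneg _))
    have k0 : klin F1 F2 F3 ξ 0 Jx Jξ = 0 := by simp [klin, om, s1, s2]
    rw [k0]
    have : 0 ≤ C * Bq ^ 2 * ‖plin F1 F2 ξ 0 Jx Jξ‖ := by positivity
    have : 0 ≤ C * Bq ^ 4 * (Mm + τ ^ 2 * 0) := by positivity
    linarith
  · rw [klin_smul F1 F2 F3 ξ N hN0.ne', plin_smul F1 F2 ξ N hN0.ne', norm_mul, norm_real, norm_of_nonneg hN]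
    have := norm1 ξ Kn JL (Mm / N) (by
      simp only [div_pow, ← sum_div]
      rw [← add_div, div_le_div_iff₀ (by positivity) hN0]
      calc _ ≤ (N * Mm) * N := mlr hJ hN
        _ = _ := by ring)
    have h5 := mll this hN
    refine le_trans (le_of_eq ?_) h5
    field_simp
end
section
abbrev Eu (n : ℕ) := EuclideanSpace ℝ (Fin n)
def gp {n : ℕ} {V : Type*} [NormedAddCommGroup V] [NormedSpace ℝ V] (j : Fin n) (u : Eu n → V) : Eu n → V :=
  fun x => fderiv ℝ u x (EuclideanSpace.single j 1)
lemma gp_eq_pdR {n : ℕ} (j : Fin n) : (gp j : (ER) → _) = pdR j := rfl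
abbrev Smo {n : ℕ} {V : Type*} [NormedAddCommGroup V] [NormedSpace ℝ V] (u : Eu n → V) : Prop :=
  ContDiff ℝ (⊤ : ℕ∞) u
section
variable {n : ℕ} {V : Type*} [NormedAddCommGroup V] [NormedSpace ℝ V]
lemma Smo.diff {u : Eu n → V} (h : Smo u) : Differentiable ℝ u := h.differentiable (by simp)
lemma Smo.gp {u : Eu n → V} (h : Smo u) (j : Fin n) : Smo (gp j u) := by
  have : Smo (fderiv ℝ u) := h.fderiv_right (by simp)
  exact this.clm_apply contDiff_const
lemma gp_add {u v : Eu n → V} (hu : Smo u) (hv : Smo v) (j : Fin n) : gp j (u + v) = gp j u + gp j v := by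
  ext x; simp only [gp, Pi.add_apply]
  rw [fderiv_add (hu.diff x) (hv.diff x)]; rfl
lemma gp_comm {u : Eu n → V} (hu : Smo u) (j l : Fin n) : gp j (gp l u) = gp l (gp j u) := by
  ext x
  have hf : Smo (fderiv ℝ u) := hu.fderiv_right (by simp)
  have key : ∀ a b : Fin n, gp a (gp b u) x =
      fderiv ℝ (fderiv ℝ u) x (EuclideanSpace.single a 1) (EuclideanSpace.single b 1) := by
    intro a b
    change fderiv ℝ (fun y => fderiv ℝ u y (EuclideanSpace.single b 1)) x _ = _
    rw [fderiv_clm_apply (hf.diff x) (differentiableAt_const _)]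
    simp
  rw [key, key]
  exact (hu.contDiffAt.isSymmSndFDerivAt (by simp; exact WithTop.coe_le_coe.2 le_top)).eq _ _
lemma fderiv_sum_gp (u : Eu n → V) (x e : Eu n) : fderiv ℝ u x e = ∑ m, e m • gp m u x := by
  have : e = ∑ m, e m • EuclideanSpace.single m (1:ℝ) := by
    ext i; simp [Pi.single_apply]
  conv_lhs => rw [this]
  simp [gp]
lemma cbFam {ι : Type*} [Fintype ι] (f : ι → Eu n → V) (hf : ∀ i, Continuous JA) (R : ℝ) :
    ∃ C ≥ 0, ∀ i x, ‖x‖ ≤ R → ‖f i x‖ ≤ C := by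
  have : ∀ i, ∃ C, ∀ x ∈ Metric.closedBall (0 : Eu n) R, ‖f i x‖ ≤ C := fun i =>
    (isCompact_closedBall _ _).exists_bound_of_continuousOn (hf i).continuousOn
  choose C hC using this
  refine ⟨∑ i, |C i|, sum_nonneg fun _ _ => abs_nonneg _, fun i x hx => ?_⟩
  refine (hC i x (by simpa using hx)).trans ((le_abs_self _).trans ?_)
  exact single_le_sum (f := fun i => |C i|) (fun _ _ => abs_nonneg _) (Finset.mem_univ i)
lemma tayFam {ι : Type*} [Fintype ι] (f : ι → Eu n → V) (hf : ∀ i, Smo JA) (R : ℝ) :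
    ∃ C ≥ 0, ∀ i x y, ‖x‖ ≤ R → ‖y‖ ≤ R → ‖f i y - f i x‖ ≤ C * ‖y - x‖ ∧
      ‖f i y - f i x - ∑ m, (y - x) m • gp m JA x‖ ≤ C * ‖y - x‖ ^ 2 := by
  have h1 : ∀ i, Smo (fderiv ℝ JA) := fun i => (hf i).fderiv_right (by simp)
  have h2 : ∀ i, Smo (fderiv ℝ (fderiv ℝ JA)) := fun i => (h1 i).fderiv_right (by simp)
  obtain ⟨C1, hC1, hb1⟩ := cbFam (fun i => fderiv ℝ JA) (fun i => (h1 i).continuous) R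
  obtain ⟨C2, hC2, hb2⟩ := cbFam (fun i => fderiv ℝ (fderiv ℝ JA)) (fun i => (h2 i).continuous) R
  refine ⟨C1 + C2, by positivity, fun i x y hx hy => ⟨?_, ?_⟩⟩
  · have := (convex_closedBall (0 : Eu n) R).norm_image_sub_le_of_norm_fderiv_le (𝕜 := ℝ) (f := f i) (C := C1)
      (fun z _ => (hf i).diff z) (fun z hz => hb1 i z (by simpa using hz)) (x := x) (y := y) (by simpa using hx) (by simpa using hy)
    refine this.trans ?_
    gcongr; linarith
  · rw [← fderiv_sum_gp]
    have hs : Convex ℝ (Metric.closedBall (0 : Eu n) R ∩ Metric.closedBall x ‖y - x‖) :=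
      (convex_closedBall _ _).inter (convex_closedBall _ _)
    have := hs.norm_image_sub_le_of_norm_hasFDerivWithin_le' (𝕜 := ℝ) (f := f i) (f' := fderiv ℝ JA) (φ := fderiv ℝ JA x)
      (C := C2 * ‖y - x‖) (fun z _ => ((hf i).diff z).hasFDerivAt.hasFDerivWithinAt) (fun z hz => ?_)
      (x := x) (y := y) (by simpa using hx) (by simpa [dist_eq_norm] using hy)
    · refine this.trans ?_
      rw [mul_assoc, ← sq]; gcongr; linarith
    · have h3 := (convex_closedBall (0 : Eu n) R).norm_image_sub_le_of_norm_fderiv_le (𝕜 := ℝ) (f := fderiv ℝ JA) (C := C2)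
        (fun z _ => (h1 i).diff z) (fun z hz => hb2 i z (by simpa using hz)) (x := x) (y := z) (by simpa using hx) hz.1
      refine h3.trans ?_
      gcongr
      simpa [dist_eq_norm] using hz.2
end
section
variable {n : ℕ} {A : Type*} [NormedCommRing A] [NormedAlgebra ℝ A]
lemma gp_mul {u v : Eu n → A} (hu : Smo u) (hv : Smo v) (j : Fin n) : gp j Kq = gp j u * v + u * gp j v := by
  ext x; simp only [gp, Pi.add_apply, Pi.mul_apply]
  rw [fderiv_mul (hu.diff x) (hv.diff x)]
  simp; ring
lemma gp_const (c : A) (j : Fin n) : gp j (fun _ : Eu n => c) = 0 := by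
  ext x; simp [gp]
lemma gp_cmul {u : Eu n → A} (hu : Smo u) (c : A) (j : Fin n) : gp j (fun x => c * u x) = fun x => c * gp j u x := by
  have := gp_mul (u := fun _ => c) contDiff_const hu j
  rw [gp_const] at this
  ext x
  have h := congrFun this x
  simp at h
  exact h
lemma gp_sum {ι : Type*} (s : Finset ι) {u : ι → Eu n → A} (hu : ∀ i, Smo (u i)) (j : Fin n) :
    gp j (fun x => ∑ i ∈ s, u i x) = fun x => ∑ i ∈ s, gp j (u i) x := by
  ext x; simp only [gp]
  rw [fderiv_fun_sum (fun i _ => (hu i).diff x)]; simp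
end
end
section
variable {n : ℕ}
def gau (Λ : ℝ) : ER := fun x => exp By
def psi (Λ lam : ℝ) (φ : ER) : ER :=
  fun x => gau Λ x + lam / 2 * ∑ m, (gp m φ x) ^ 2
lemma smo_coord (j : Fin n) : Smo (fun x : Eu n => x j) := by
  exact (BQ).contDiff
lemma smo_gau (Λ : ℝ) : Smo (gau (n := n) Λ) := by
  unfold gau
  refine contDiff_exp.comp ?_
  refine ContDiff.div_const (contDiff_const.mul (ContDiff.sum fun j _ => (smo_coord j).pow 2)) _
lemma gp_coord (j l : Fin n) : gp l (fun x : Eu n => x j) = fun _ => if j = l then 1 else 0 := by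
  ext x
  have : (fun x : Eu n => x j) = BQ := rfl
  simp only [gp]
  rw [this, ContinuousLinearMap.fderiv]
  simp [Pi.single_apply]
lemma gp_sq {u : ER} (hu : Smo u) (j : Fin n) : gp j (fun x => u x ^ 2) = fun x => 2 * u x * gp j u x := by
  have e : (fun x => u x ^ 2) = u * u := by ext x; simp [sq]
  rw [e, gp_mul hu hu]; ext x; simp; ring
lemma gp_gau (Λ : ℝ) (j : Fin n) : gp j (gau Λ) = fun x : Eu n => s1f Λ (gau Λ x) x j := by
  ext x
  have hq : Smo (fun x : Eu n => ∑ j, x j ^ 2) := ContDiff.sum fun j _ => (smo_coord j).pow 2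
  have h1 : gp j (fun x : Eu n => ∑ j, x j ^ 2) = fun x => 2 * x j := by
    rw [gp_sum _ (u := fun i (x : Eu n) => x i ^ 2) (fun i => (smo_coord i).pow 2)]
    ext x
    simp [gp_sq (smo_coord _), gp_coord]
  have h2 : HasFDerivAt (fun x : Eu n => ∑ j, x j ^ 2) (fderiv ℝ (fun x : Eu n => ∑ j, x j ^ 2) x) x := (hq.diff x).hasFDerivAt
  have h3 : HasFDerivAt (gau (n := n) Λ) _ x := ((h2.const_mul Λ).mul_const (2⁻¹ : ℝ)).exp
  simp only [gp, h3.fderiv]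
  have h4 := congrFun h1 x
  simp only [gp] at h4
  simp [h4, s1f, gau]
  simp only [div_eq_mul_inv]
  ring
lemma gp_gau2 (Λ : ℝ) (j l : Fin n) : gp l (gp j (gau Λ)) = fun x : Eu n => s2f Λ (gau Λ x) x j l := by
  rw [gp_gau]
  have e : (fun x : Eu n => s1f Λ (gau Λ x) x j) = (fun x => Λ * (((fun x : Eu n => x j) * gau Λ : ER) x)) := by
    ext x; simp [s1f]; ring
  have h1 : Smo ((fun x : Eu n => x j) * gau Λ : ER) := (smo_coord j).mul (smo_gau Λ)
  rw [e, gp_cmul (u := (fun x : Eu n => x j) * gau Λ) h1, gp_mul (smo_coord j) (smo_gau Λ), gp_coord, gp_gau]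
  ext x
  simp only [s1f, s2f, Pi.add_apply, Pi.mul_apply]
  split_ifs <;> ring
lemma smo_psi (Λ lam : ℝ) {φ : ER} (hφ : Smo φ) : Smo Bb := by
  unfold psi
  exact (smo_gau Λ).add (contDiff_const.mul (ContDiff.sum fun j _ => (BX).pow 2))
lemma gp_psi (Λ lam : ℝ) {φ : ER} (hφ : Smo φ) (j : Fin n) :
    gp j Bb = fun x => s1f Λ (gau Λ x) x j + lam * ∑ m, gp m φ x * gp j BC x := by
  have e : psi Λ lam φ = gau Λ + fun x => lam / 2 * ∑ m, (gp m φ x) ^ 2 := rfl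
  have h1 : Smo (fun x => ∑ m, (gp m φ x) ^ 2) := ContDiff.sum fun j _ => (BX).pow 2
  rw [e, gp_add (smo_gau Λ) (contDiff_const.mul h1), gp_cmul h1, gp_sum _ (u := fun i x => gp i φ x ^ 2) (fun i => (hφ.gp i).pow 2), gp_gau]
  ext x
  simp only [gp_sq (hφ.gp _), Pi.add_apply, mul_assoc, ← mul_sum]
  ring
lemma gp_psi2 (Λ lam : ℝ) {φ : ER} (hφ : Smo φ) (j l : Fin n) :
    gp l Jh = fun x => s2f Λ (gau Λ x) x j l +
      lam * ∑ m, (gp l BC x * gp j BC x + gp m φ x * gp l (gp j BC) x) := by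
  have h0 : ∀ m, Smo (BC * gp j BC) := fun m => (hφ.gp m).mul ((hφ.gp m).gp j)
  have h1 : Smo (fun x => ∑ m, (BC * gp j BC) x) := ContDiff.sum fun m _ => h0 m
  have e : gp j Bb = gp j (gau Λ) + fun x => lam * ∑ m, (BC * gp j BC) x := by
    rw [gp_psi Λ lam hφ, gp_gau]; rfl
  rw [e, gp_add ((smo_gau Λ).gp j) (contDiff_const.mul h1), gp_cmul h1, gp_sum _ h0, gp_gau2]
  ext x
  simp only [gp_mul (hφ.gp _) ((hφ.gp _).gp j), Pi.add_apply, Pi.mul_apply]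
def Fw (Λ lam τ : ℝ) (φ : ER) : ER := fun x => φ x + τ * psi Λ lam φ x
lemma smo_Fw (Λ lam τ : ℝ) {φ : ER} (hφ : Smo φ) : Smo Bg :=
  hφ.add (contDiff_const.mul BY)
lemma gp_lin (τ : ℝ) {u v : ER} (hu : Smo u) (hv : Smo v) (j : Fin n) :
    gp j (fun x => u x + τ * v x) = fun x => gp j u x + τ * gp j v x := by
  have := gp_add hu (contDiff_const.mul hv : Smo (fun x => τ * v x)) j
  rw [gp_cmul hv] at this
  exact this
end
section
set_option maxHeartbeats 4000000 in
theorem AFF {n : ℕ} (φ : ER) (hφ : Smo φ) (K : Set JH) (hK : IsCompact K) (ε : ℝ) (hε : 0 < ε)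
    (hgr : ∀ x ∈ K, ∀ y, ‖y - x‖ ≤ ε → ∃ j, gp j φ y ≠ 0)
    (hbr : ∀ x ∈ K, ∀ y, ‖y - x‖ ≤ ε → ∀ ξ, pS (fun j => gp j φ y) ξ = 0 →
      0 ≤ kS (fun j => gp j φ y) (fun j l => gp l Br y) ξ) :
    ∃ Λ lam : ℝ, ∃ C > 0, ∃ τ0 > 0, ∀ τ, 0 < τ → τ ≤ τ0 → ∀ x ∈ K, ∀ (ξ : FR) (N : ℝ) (Jx Jξ : FR) (Mm : ℝ),
      0 ≤ N → 0 ≤ Mm → ∑ j, Jx j ^ 2 + ∑ j, Jξ j ^ 2 ≤ N * Mm →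
      τ / 2 * N - C * Bq ^ 2 * ‖plin (fun j => gp j Bg x)
          (fun j l => gp l Jp x) ξ N Jx Jξ‖
        - C * Bq ^ 4 * (Mm + τ ^ 2 * N) ≤ klin (fun j => gp j Bg x)
          (fun j l => gp l Jp x)
          (fun j l m => gp m (gp l Jp) x) ξ N Jx Jξ := by
  obtain ⟨Rb, hRb⟩ := (hK.cthickening (r := ε)).isBounded.exists_norm_le
  have hball : ∀ x ∈ K, ∀ y, ‖y - x‖ ≤ ε → ‖y‖ ≤ Rb := fun x hx y hy =>
    hRb y (Metric.mem_cthickening_of_dist_le y x ε K hx (by rwa [dist_eq_norm]))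
  have hball0 : ∀ x ∈ K, ‖x‖ ≤ Rb := fun x hx => hball x hx x (by simpa using hε.le)
  -- lower bound of gradient
  obtain ⟨c0, hc0, hlow⟩ : ∃ c0 > 0, ∀ x ∈ K, ∀ y, ‖y - x‖ ≤ ε → 2 * c0 ≤ ∑ j, gp j φ y ^ 2 := by
    set K2 := (fun p : Eu n × Eu n => p.1 + p.2) '' (K ×ˢ Metric.closedBall 0 ε) with hK2
    have hK2c : IsCompact K2 := (hK.prod (isCompact_closedBall 0 ε)).image continuous_add
    have hmem : ∀ x ∈ K, ∀ y, ‖y - x‖ ≤ ε → y ∈ K2 := fun x hx y hy =>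
      ⟨(x, y - x), ⟨hx, by simpa using hy⟩, by simp⟩
    have hcont : Continuous fun y => ∑ j, gp j φ y ^ 2 :=
      continuous_finsetSum _ fun j _ => ((BX).continuous.pow 2)
    have hpos : ∀ y ∈ K2, 0 < ∑ j, gp j φ y ^ 2 := by
      rintro y ⟨⟨a, b⟩, ⟨ha, hb⟩, rfl⟩
      obtain ⟨j, hj⟩ := hgr a ha (a + b) (by simpa using hb)
      exact Finset.sum_pos' (fun _ _ => sq_nonneg _) ⟨j, Finset.mem_univ j, by positivity⟩
    rcases K2.eq_empty_or_nonempty with he | hne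
    · refine ⟨1, one_pos, fun x hx y hy => ?_⟩
      have := hmem x hx y hy
      simp [he] at this
    · obtain ⟨y0, hy0, hmin⟩ := hK2c.exists_isMinOn hne hcont.continuousOn
      refine ⟨(∑ j, gp j φ y0 ^ 2) / 2, by have := hpos y0 hy0; positivity, fun x hx y hy => ?_⟩
      have := hmin (hmem x hx y hy)
      simp only [mem_setOf_eq] at this
      linarith
  obtain ⟨B1, hB1, hb1⟩ := cbFam (fun j => gp j φ) (fun j => (BX).continuous) Rb
  obtain ⟨B2, hB2, hb2⟩ := cbFam (fun p : Fin n × Fin n => gp p.2 (gp p.1 φ)) (fun p => ((hφ.gp _).gp _).continuous) Rb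
  obtain ⟨B3, hB3, hb3⟩ := cbFam (fun p : Fin n × Fin n × Fin n => gp p.2.2 (gp p.2.1 (gp p.1 φ)))
    (fun p => (((hφ.gp _).gp _).gp _).continuous) Rb
  obtain ⟨B, hBd⟩ : ∃ B, B = B1 + B2 + 1 := ⟨_, rfl⟩
  obtain ⟨Λ, lam, hΛ, hlam, haff⟩ := aff1 n B c0 (|Rb|) (by linarith) hc0 (abs_nonneg _)
  have hψ := smo_psi Λ lam hφ
  obtain ⟨P1, hP1, hp1⟩ := cbFam (fun j => gp j Bb) (fun j => (hψ.gp j).continuous) Rb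
  obtain ⟨P2, hP2, hp2⟩ := cbFam (fun p : Fin n × Fin n => gp p.2 (gp p.1 Bb)) (fun p => ((hψ.gp _).gp _).continuous) Rb
  obtain ⟨P3, hP3, hp3⟩ := cbFam (fun p : Fin n × Fin n × Fin n => gp p.2.2 (gp p.2.1 (gp p.1 Bb)))
    (fun p => (((hψ.gp _).gp _).gp _).continuous) Rb
  obtain ⟨T1, hT1, ht1⟩ := tayFam (fun j => gp j φ) (fun j => BX) Rb
  obtain ⟨T2, hT2, ht2⟩ := tayFam (fun p : Fin n × Fin n => gp p.2 (gp p.1 φ)) (fun p => ((hφ.gp _).gp _)) Rb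
  obtain ⟨Q, hQ⟩ : ∃ Q : ℝ, Q = n + lam * (n * B1) + 1 := ⟨_, rfl⟩
  have hQ0 : 0 < Q := by rw [hQ]; positivity
  obtain ⟨r, hr⟩ : ∃ r : ℝ, r = min 1 (ε / Q) := ⟨_, rfl⟩
  have hr0 : 0 < r := by rw [hr]; positivity
  have hr1 : r ≤ 1 := by rw [hr]; exact min_le_left _ _
  have hrQ : Q * r ≤ ε := by
    have : r ≤ ε / Q := by rw [hr]; exact min_le_right _ _
    rw [le_div_iff₀ hQ0] at this; linarith
  obtain ⟨KK, hKK⟩ : ∃ KK : ℝ, KK = T1 * Q ^ 2 + n * P2 + Bk + (B3 + P3) + 1 := ⟨_, rfl⟩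
  have hKK1 : 1 ≤ KK := by
    rw [hKK]
    have : 0 ≤ T1 * Q ^ 2 + n * P2 + Bk + (B3 + P3) := by positivity
    linarith
  obtain ⟨C, hC, hfin⟩ := haff KK r hKK1 hr0 hr1
  obtain ⟨τ0, hτ0d⟩ : ∃ τ0 : ℝ, τ0 = min r (min (1 / (P1 + P2 + 1)) (c0 / Ku)) := ⟨_, rfl⟩
  have hτ0 : 0 < τ0 := by rw [hτ0d]; positivity
  refine ⟨Λ, lam, C, hC, τ0, hτ0, fun τ hτp hτ x hx => ?_⟩
  have hτr : τ ≤ r := hτ.trans (by rw [hτ0d]; exact min_le_left _ _)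
  have hτ1 : τ * (P1 + P2 + 1) ≤ 1 := by
    have : τ ≤ 1 / (P1 + P2 + 1) := hτ.trans (by rw [hτ0d]; exact (min_le_right _ _).trans (min_le_left _ _))
    rwa [le_div_iff₀ (by positivity)] at this
  have hτ2 : τ * Ku ≤ c0 := by
    have : τ ≤ c0 / Ku := hτ.trans (by rw [hτ0d]; exact (min_le_right _ _).trans (min_le_right _ _))
    rwa [le_div_iff₀ (by positivity)] at this
  have hxR := hball0 x hx
  have f1 : ∀ j, gp j Bg = fun x => gp j φ x + τ * gp j Bb x := fun j => gp_lin τ hφ hψ j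
  have f2 : ∀ j l, gp l Jp = fun x => gp l Br x + τ * gp l Jh x := fun j l => by
    rw [f1]; exact gp_lin τ BX (hψ.gp j) l
  have f3 : ∀ j l m, gp m (gp l Jp) = fun x => gp m (gp l Br) x + τ * gp m (gp l Jh) x :=
    fun j l m => by rw [f2]; exact gp_lin τ ((BX).gp l) ((hψ.gp j).gp l) m
  have g1 : ∀ j, |τ * gp j Bb x| ≤ τ * P1 := fun j => by
    rw [abs_mul, abs_of_pos hτp]; gcongr; exact hp1 j x hxR
  have g2 : ∀ j l, |τ * gp l Jh x| ≤ τ * P2 := fun j l => by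
    rw [abs_mul, abs_of_pos hτp]; gcongr; exact hp2 (j, l) x hxR
  have g3 : ∀ j l m, |τ * gp m (gp l Jh) x| ≤ τ * P3 := fun j l m => by
    rw [abs_mul, abs_of_pos hτp]; gcongr; exact hp3 (j, l, m) x hxR
  have hτle1 : τ ≤ 1 := hτr.trans hr1
  have v1 : τ * P1 ≤ 1 := by
    have : 0 ≤ τ * (P2 + 1) := by positivity
    linarith
  have v2 : τ * P2 ≤ 1 := by
    have : 0 ≤ τ * (P1 + 1) := by positivity
    linarith
  refine hfin _ _ _ (fun j => x j) τ ?_ ?_ ?_ ?_ ?_ ?_ hτp hτr ?_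
  · intro j
    have : |x j| ≤ ‖x‖ := PiLp.norm_apply_le x j
    exact this.trans (hxR.trans (le_abs_self _))
  · intro j
    rw [f1]
    refine (abs_add_le _ _).trans ?_
    have h1 : |gp j φ x| ≤ B1 := hb1 j x hxR
    have := g1 j
    linarith
  · intro j l
    rw [f2]
    refine (abs_add_le _ _).trans ?_
    have h1 : |gp l Br x| ≤ B2 := hb2 (j, l) x hxR
    have := g2 j l
    linarith
  · intro j l m
    rw [f3]
    refine (abs_add_le _ _).trans ?_
    have h1 : |gp m (gp l Br) x| ≤ B3 := hb3 (j, l, m) x hxR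
    have := g3 j l m
    have : τ * P3 ≤ P3 := by nlinarith
    have : 0 ≤ T1 * Q ^ 2 + n * P2 + Bk := by positivity
    linarith
  · intro j l
    rw [gp_comm (smo_Fw Λ lam τ hφ)]
  · have h0 := hlow x hx x (by simpa using hε.le)
    have h1 : ∀ j ∈ Finset.univ, gp j φ x ^ 2 - τ * (2 * (B1 * P1)) ≤ gp j Bg x ^ 2 := by
      intro j _
      rw [f1]
      have a1 : |gp j φ x * gp j Bb x| ≤ B1 * P1 := by
        rw [abs_mul]; exact mul_le_mul (hb1 j x hxR) (hp1 j x hxR) (abs_nonneg _) hB1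
      have a2 := mll (abs_le.1 a1).1 hτp.le
      have a3 := sq_nonneg (τ * gp j Bb x)
      linarith [show (gp j φ x + τ * gp j Bb x) ^ 2 = gp j φ x ^ 2 + 2 * (τ * (gp j φ x * gp j Bb x)) + (τ * gp j Bb x) ^ 2 by ring]
    have h2 := sum_le_sum h1
    rw [sum_sub_distrib] at h2
    simp only [sum_const, Finset.card_univ, Fintype.card_fin, nsmul_eq_mul] at h2
    linarith
  · intro dx ρ hdx hτρ hρr
    have hρ0 : 0 ≤ ρ := hτp.le.trans hτρ
    obtain ⟨e, he⟩ : ∃ e : Eu n, ∀ m, e m = dx m + τ * lam * gp m φ x :=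
      ⟨WithLp.toLp 2 (fun m => dx m + τ * lam * gp m φ x), fun m => rfl⟩
    have hen : ‖e‖ ≤ Q * ρ := by
      have h1 : e = ∑ m, e m • EuclideanSpace.single m (1:ℝ) := by ext i; simp [Pi.single_apply]
      rw [h1]
      have : ∀ m, ‖e m • EuclideanSpace.single m (1:ℝ)‖ ≤ (1 + lam * B1) * ρ := by
        intro m
        rw [norm_smul, EuclideanSpace.norm_single, norm_one, mul_one, he]
        refine (norm_add_le _ _).trans ?_
        have a1 : ‖τ * lam * gp m φ x‖ ≤ ρ * lam * B1 := by
          rw [norm_mul, norm_mul, norm_of_nonneg hτp.le, norm_of_nonneg hlam.le]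
          gcongr; exact hb1 m x hxR
        have a2 : ‖dx m‖ ≤ ρ := hdx m
        linarith
      refine (norm_sum_le' _ _ this).trans ?_
      rw [hQ]
      linarith
    have hee : ‖e‖ ≤ ε := hen.trans ((mll hρr hQ0.le).trans hrQ)
    have hye : ‖Jy - x‖ ≤ ε := by simpa using hee
    have hyR := hball x hx _ hye
    have hee2 : ‖e‖ ^ 2 ≤ Q ^ 2 * ρ ^ 2 := by
      rw [← mul_pow]; exact pow_le_pow_left₀ (norm_nonneg _) hen 2
    refine ⟨fun j => gp j φ Jy, fun j l => gp l Br Jy, ?_, ?_, ?_, hbr x hx _ hye, ?_, ?_⟩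
    · intro j; exact (hb1 j _ hyR).trans (by linarith)
    · intro j l; exact (hb2 (j, l) _ hyR).trans (by linarith)
    · have := hlow x hx _ hye; linarith
    · intro j
      have h1 := (ht1 j x Jy hxR hyR).2
      rw [add_sub_cancel_left] at h1
      have h2 : |∑ m, τ * gp m Jh x * dx m| ≤ n * (P2 * ρ ^ 2) := by
        rw [← norm_eq_abs]
        refine norm_sum_le' _ _ fun m => ?_
        rw [norm_mul, norm_mul, norm_of_nonneg hτp.le]
        calc τ * ‖gp m Jh x‖ * ‖dx m‖ ≤ ρ * P2 * ρ := by
              gcongr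
              · exact hp2 (j, m) x hxR
              · exact hdx m
          _ = _ := by ring
      have e1 : gp j φ Jy - (gp j Bg x + ∑ m, gp m Jp x * dx m
          - τ * s1f Λ (exp By) (fun j => x j) j) =
          (gp j φ Jy - gp j φ x - ∑ m, e m • gp m Br x) - ∑ m, τ * gp m Jh x * dx m := by
        have e0 : gp j Bb x = s1f Λ (gau Λ x) x j + lam * ∑ m, gp m φ x * gp j BC x := by
          rw [gp_psi Λ lam hφ]
        have e4 : gp j Bg x = gp j φ x + τ * gp j Bb x := by rw [f1]
        have e6 : ∀ m, gp m Jp x = gp m Br x + τ * gp m Jh x := fun m => by rw [f2]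
        rw [e4]
        simp only [e6, e0, he, smul_eq_mul, add_mul, sum_add_distrib]
        have e2 : ∑ m, τ * lam * gp m φ x * gp m Br x = τ * (lam * ∑ m, gp m φ x * gp j BC x) := by
          rw [mul_sum, mul_sum]
          refine sum_congr rfl fun m _ => ?_
          rw [gp_comm hφ]; ring
        have e3 : ∑ m, gp m Br x * dx m = ∑ m, dx m * gp m Br x := sum_congr rfl fun m _ => mul_comm _ _
        rw [e2, e3]
        simp only [gau]
        ring
      rw [e1]
      refine (abs_sub _ _).trans ?_
      have h1' : |gp j φ Jy - gp j φ x - ∑ m, e m • gp m Br x| ≤ T1 * (Q ^ 2 * ρ ^ 2) :=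
        h1.trans (by gcongr)
      have h4 : (T1 * Q ^ 2 + n * P2) * ρ ^ 2 ≤ KK * ρ ^ 2 := by
        gcongr
        rw [hKK]
        have : 0 ≤ Bk + (B3 + P3) + 1 := by positivity
        linarith
      linarith
    · intro j l
      have h1 := (ht2 (j, l) x Jy hxR hyR).2
      rw [add_sub_cancel_left] at h1
      simp only at h1
      have h2 : |∑ m, τ * gp m (gp l Jh) x * dx m| ≤ n * (P3 * ρ ^ 2) := by
        rw [← norm_eq_abs]
        refine norm_sum_le' _ _ fun m => ?_
        rw [norm_mul, norm_mul, norm_of_nonneg hτp.le]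
        calc τ * ‖gp m (gp l Jh) x‖ * ‖dx m‖ ≤ ρ * P3 * ρ := by
              gcongr
              · exact hp3 (j, l, m) x hxR
              · exact hdx m
          _ = _ := by ring
      have h3 : |∑ m, τ * Bo| ≤ n * ((P2 * (2 * B2) + P2 * P2) * ρ ^ 2) := by
        rw [← norm_eq_abs]
        refine norm_sum_le' _ _ fun m => ?_
        have q : ∀ a b, ‖gp a (gp b φ) x‖ ≤ B2 := fun a b => hb2 (b, a) x hxR
        have q' : ∀ a b, ‖gp a (gp b Bb) x‖ ≤ P2 := fun a b => hp2 (b, a) x hxR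
        rw [norm_mul, norm_of_nonneg hτp.le]
        have a1 : ‖τ * (gp l BC x * gp j (gp m Bb) x + gp l (gp m Bb) x * gp j BC x)‖ ≤ ρ * (B2 * P2 + P2 * B2) := by
          rw [norm_mul, norm_of_nonneg hτp.le]
          gcongr
          refine (norm_add_le _ _).trans ?_
          rw [norm_mul, norm_mul]
          gcongr <;> first | apply q | apply q'
        have a2 : ‖τ * (τ * (gp l (gp m Bb) x * gp j (gp m Bb) x))‖ ≤ ρ * (1 * (P2 * P2)) := by
          rw [norm_mul, norm_mul, norm_mul, norm_of_nonneg hτp.le]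
          gcongr <;> apply q'
        calc _ ≤ ρ * (ρ * (B2 * P2 + P2 * B2) + ρ * (1 * (P2 * P2))) := by
              gcongr
              exact (norm_add_le _ _).trans (add_le_add a1 a2)
          _ = _ := by ring
      have e1 : gp l Br Jy - (gp l Jp x + (∑ m, gp m (gp l Jp) x * dx m
          - τ * (s2f Λ (exp By) (fun j => x j) j l + lam * ∑ m, gp l (gp m Bg) x * gp j (gp m Bg) x))) =
          (gp l Br Jy - gp l Br x - ∑ m, e m • gp m (gp l Br) x) - ∑ m, τ * gp m (gp l Jh) x * dx m
          + lam * ∑ m, τ * Bo := by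
        simp only [f3]
        have e0 : gp l Jp x = gp l Br x + τ * (s2f Λ (gau Λ x) x j l +
            lam * ∑ m, (gp l BC x * gp j BC x + gp m φ x * gp l (gp j BC) x)) := by
          rw [f2, gp_psi2 Λ lam hφ]
        have e4 : ∀ a m, gp a (gp m Bg) x = gp a BC x + τ * gp a (gp m Bb) x := fun a m => by rw [f2]
        rw [e0]
        simp only [e4, he, smul_eq_mul]
        have e2 : ∑ m, (dx m + τ * lam * gp m φ x) * gp m (gp l Br) x =
           ∑ m, gp m (gp l Br) x * dx m + τ * (lam * ∑ m, gp m φ x * gp l (gp j BC) x) := by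
          rw [mul_sum, mul_sum, ← sum_add_distrib]
          refine sum_congr rfl fun m _ => ?_
          rw [gp_comm hφ j m, gp_comm BX l m]; ring
        rw [e2]
        have e5 : ∑ m, (gp l BC x + τ * gp l (gp m Bb) x) * (gp j BC x + τ * gp j (gp m Bb) x)
          = ∑ m, gp l BC x * gp j BC x + ∑ m, Bo := by
          rw [← sum_add_distrib]
          refine sum_congr rfl fun m _ => ?_
          ring
        rw [e5, ← mul_sum Finset.univ _ τ]
        simp only [gau, add_mul, sum_add_distrib]
        ring
      rw [e1]
      refine (abs_add_le _ _).trans ?_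
      have h5 := abs_sub (gp l Br Jy - gp l Br x - ∑ m, e m • gp m (gp l Br) x) (∑ m, τ * gp m (gp l Jh) x * dx m)
      rw [abs_mul, abs_of_pos hlam]
      have h3' := mll h3 hlam.le
      have h1' : |gp l Br Jy - gp l Br x - ∑ m, e m • gp m (gp l Br) x| ≤ T2 * (Q ^ 2 * ρ ^ 2) :=
        h1.trans (by gcongr)
      have h4 : Bk * ρ ^ 2 ≤ KK * ρ ^ 2 := by
        gcongr
        rw [hKK]
        have : 0 ≤ T1 * Q ^ 2 + n * P2 + (B3 + P3) + 1 := by positivity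
        linarith
      clear * - h5 h3' h1' h4 h2
      linarith
end
section
def Sm (n : ℕ) : Subalgebra ℂ (Eu n → ℂ) where
  carrier := {u | Smo u}
  mul_mem' := by
    intro a b ha hb
    rw [Set.mem_ofPred_eq] at *
    exact ContDiff.mul ha hb
  add_mem' := by
    intro a b ha hb
    rw [Set.mem_ofPred_eq] at *
    exact ContDiff.add ha hb
  algebraMap_mem' := by
    intro r
    rw [Set.mem_ofPred_eq]
    exact contDiff_const
section
variable {n : ℕ}
lemma mem_Sm {f : Eu n → ℂ} : f ∈ Sm n ↔ Smo f := by
  change f ∈ {u : Eu n → ℂ | Smo u} ↔ _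
  rw [Set.mem_ofPred_eq]
lemma smo (u : Sm n) : Smo u.1 := mem_Sm.1 u.2
def mkS (f : Eu n → ℂ) (hf : Smo f) : Sm n := ⟨f, mem_Sm.2 hf⟩
lemma gp_smulc {u : Eu n → ℂ} (hu : Smo u) (c : ℂ) (j : Fin n) : gp j Ks = c • gp j u := by
  have := gp_cmul hu c j
  exact this
def Dd (j : Fin n) : Sm n →ₗ[ℂ] Sm n where
  toFun u := mkS (gp j u.1) ((JS).gp j)
  map_add' u v := Subtype.ext (gp_add JS (smo v) j)
  map_smul' c u := Subtype.ext (gp_smulc JS c j)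
lemma Dd_mul (j : Fin n) (u v : Sm n) : Dd j Kq = Dd j u * v + u * Dd j v :=
  Subtype.ext (gp_mul JS (smo v) j)
lemma Dd_comm (j l : Fin n) (u : Sm n) : Dd j (Dd l u) = Dd l (Dd j u) :=
  Subtype.ext (gp_comm JS j l)
def dd (h : ℝ) (j : Fin n) : Sm n →ₗ[ℂ] Sm n := Be • Dd j
lemma dd_mul (h : ℝ) (j : Fin n) (u v : Sm n) : dd h j Kq = dd h j u * v + u * dd h j v := by
  simp only [dd, LinearMap.smul_apply, Dd_mul, smul_add, smul_mul_assoc, mul_smul_comm]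
lemma dd_apply (h : ℝ) (j : Fin n) (u : Sm n) (y : Eu n) : (BF).1 y = h * gp j u.1 y := rfl
/-- complexification of a real function -/
def cx (f : ER) (hf : Smo f) : Sm n := mkS (fun y => (f y : ℂ)) (Complex.ofRealCLM.contDiff.comp hf)
lemma gp_cx (f : ER) (hf : Smo f) (j : Fin n) (y : Eu n) :
    gp j (fun y => (f y : ℂ)) y = ((gp j f y : ℝ) : ℂ) := by
  have h1 : HasFDerivAt (fun y => (f y : ℂ)) (Complex.ofRealCLM.comp (fderiv ℝ f y)) y :=
    Complex.ofRealCLM.hasFDerivAt.comp y (hf.diff y).hasFDerivAt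
  simp [gp, h1.fderiv]
lemma Dd_cx (f : ER) (hf : Smo f) (j : Fin n) : Dd j Kr = cx (gp j f) (hf.gp j) :=
  Subtype.ext (funext fun y => gp_cx f hf j y)
def cj (u : Sm n) : Sm n := mkS (fun y => cJ (u.1 y)) (Complex.conjCLE.contDiff.comp JS)
lemma gp_cj (u : Sm n) (j : Fin n) (y : Eu n) : gp j (cj u).1 y = cJ (gp j u.1 y) := by
  have h1 : HasFDerivAt (cj u).1 ((Complex.conjCLE : ℂ →L[ℝ] ℂ).comp (fderiv ℝ u.1 y)) y :=
    (Complex.conjCLE : ℂ →L[ℝ] ℂ).hasFDerivAt.comp y ((JS).diff y).hasFDerivAt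
  simp [gp, h1.fderiv]
lemma dd_cj (h : ℝ) (j : Fin n) (u : Sm n) : dd h j (cj u) = cj BF := by
  refine Subtype.ext (funext fun y => ?_)
  rw [dd_apply, gp_cj]
  simp [cj, dd_apply, mkS]
def G (h : ℝ) : ℕ → Sm n → ER
  | 0, u, y => ‖u.1 y‖ ^ 2
  | k + 1, u, y => G h k u y + ∑ j, G h k BF y
lemma G_nonneg (h : ℝ) (k : ℕ) (u : Sm n) (y : Eu n) : 0 ≤ G h k u y := by
  induction k generalizing u with
  | zero => simp only [G]; positivity
  | succ k ih => exact add_nonneg (ih u) (sum_nonneg fun j _ => ih _)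
lemma G_cont (h : ℝ) (k : ℕ) (u : Sm n) : Continuous (G h k u) := by
  induction k generalizing u with
  | zero => exact ((JS).continuous.norm.pow 2)
  | succ k ih => exact (ih u).add (continuous_finsetSum _ fun j _ => ih _)
lemma G_le_succ (h : ℝ) (k : ℕ) (u : Sm n) (y : Eu n) : G h k u y ≤ G h BT u y :=
  le_add_of_nonneg_right (sum_nonneg fun j _ => G_nonneg _ _ _ _)
lemma G_mono (h : ℝ) {k m : ℕ} (hkm : k ≤ m) (u : Sm n) (y : Eu n) : G h k u y ≤ G h m u y := by
  induction m, hkm using Nat.le_induction with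
  | base => exact le_rfl
  | succ m _ ih => exact ih.trans (G_le_succ h m u y)
lemma G_dd (h : ℝ) (k : ℕ) (j : Fin n) (u : Sm n) (y : Eu n) : G h k BF y ≤ G h BT u y := by
  have h1 := single_le_sum (f := fun j => G h k BF y) (fun _ _ => G_nonneg _ _ _ _) (Finset.mem_univ j)
  have h2 := G_nonneg h k u y
  simp only [G]
  linarith
lemma G_add (h : ℝ) (k : ℕ) (u v : Sm n) (y : Eu n) : G h k (u + v) y ≤ 2 * G h k u y + 2 * G h k v y := by
  induction k generalizing u v with
  | zero =>
    simp only [G]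
    have : ‖(u + v).1 y‖ ≤ ‖u.1 y‖ + ‖v.1 y‖ := norm_add_le _ _
    have h2 := pow_le_pow_left₀ (norm_nonneg _) this 2
    nlinarith [sq_nonneg (‖u.1 y‖ - ‖v.1 y‖)]
  | succ k ih =>
    simp only [G, map_add]
    have := sum_le_sum fun j (_ : j ∈ Finset.univ) => ih BF (dd h j v)
    rw [sum_add_distrib, ← mul_sum, ← mul_sum] at this
    linarith [ih u v]
lemma G_smul (h : ℝ) (k : ℕ) (c : ℂ) (u : Sm n) (y : Eu n) : G h k Ks y = ‖c‖ ^ 2 * G h k u y := by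
  induction k generalizing u with
  | zero =>
    simp only [G]
    have : (Ks).1 y = c * u.1 y := rfl
    rw [this, norm_mul, mul_pow]
  | succ k ih => simp only [G, map_smul, ih, mul_add, mul_sum]
lemma G_neg (h : ℝ) (k : ℕ) (u : Sm n) (y : Eu n) : G h k (-u) y = G h k u y := by
  have := G_smul h k Jb u y
  simpa using this
def cG (n : ℕ) (k : ℕ) : ℝ := (1 + 4 * n) ^ k
lemma cG_pos (n k : ℕ) : 0 < cG n k := by unfold cG; positivity
lemma G_mul (h : ℝ) (k : ℕ) (u v : Sm n) (y : Eu n) : G h k Kq y ≤ cG n k * (G h k u y * G h k v y) := by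
  induction k generalizing u v with
  | zero =>
    have : (Kq).1 y = u.1 y * v.1 y := rfl
    simp [G, cG, this, mul_pow]
  | succ k ih =>
    have hc := cG_pos n k
    have h0 : G h k Kq y ≤ cG n k * (G h (k+1) u y * G h (k+1) v y) :=
      (ih u v).trans (mll (mul_le_mul (G_le_succ _ _ _ _) (G_le_succ _ _ _ _)
        (G_nonneg _ _ _ _) (G_nonneg _ _ _ _)) hc.le)
    have h1 : ∀ j ∈ Finset.univ, G h k (dd h j Kq) y ≤ 4 * (cG n k * (G h (k+1) u y * G h (k+1) v y)) := by
      intro j _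
      rw [dd_mul]
      refine (G_add _ _ _ _ _).trans ?_
      have a1 := (ih BF v).trans (mll (mul_le_mul (G_dd _ _ _ _ _) (G_le_succ _ _ _ _)
        (G_nonneg _ _ _ _) (G_nonneg _ _ _ _)) hc.le)
      have a2 := (ih u (dd h j v)).trans (mll (mul_le_mul (G_le_succ _ _ _ _) (G_dd _ _ _ _ _)
        (G_nonneg _ _ _ _) (G_nonneg _ _ _ _)) hc.le)
      linarith
    have h2 := sum_le_sum h1
    simp only [sum_const, Finset.card_univ, Fintype.card_fin, nsmul_eq_mul] at h2
    change G h k Kq y + ∑ j, G h k (dd h j Kq) y ≤ _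
    have e : cG n (k+1) = cG n k * (1 + 4 * n) := pow_succ _ _
    rw [e]
    linarith
lemma dd_loc (h : ℝ) (j : Fin n) {u v : Sm n} {y : Eu n} (huv : u.1 =ᶠ[nhds y] v.1) :
    (BF).1 =ᶠ[nhds y] (dd h j v).1 := by
  filter_upwards [huv.eventuallyEq_nhds] with z hz
  rw [dd_apply, dd_apply, gp, gp, hz.fderiv_eq]
lemma G_loc (h : ℝ) (k : ℕ) {u v : Sm n} {y : Eu n} (huv : u.1 =ᶠ[nhds y] v.1) : G h k u y = G h k v y := by
  induction k generalizing u v with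
  | zero => simp only [G, huv.eq_of_nhds]
  | succ k ih =>
    simp only [G]
    rw [ih huv, sum_congr rfl fun j _ => ih (dd_loc h j huv)]
lemma G_zero (h : ℝ) (k : ℕ) (y : Eu n) : G h k (0 : Sm n) y = 0 := by
  have := G_smul h k 0 (0 : Sm n) y
  simpa using this
lemma G_coef (k : ℕ) (c : Sm n) (R : ℝ) : ∃ C ≥ 0, ∀ h, 0 < h → h ≤ 1 → ∀ y, ‖y‖ ≤ R → G h k c y ≤ C := by
  induction k generalizing c with
  | zero =>
    obtain ⟨C, hC, hb⟩ := cbFam (fun _ : Unit => c.1) (fun _ => (smo c).continuous) R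
    refine ⟨C ^ 2, by positivity, fun h _ _ y hy => ?_⟩
    exact pow_le_pow_left₀ (norm_nonneg _) (hb () y hy) 2
  | succ k ih =>
    obtain ⟨C0, hC0, hb0⟩ := ih c
    choose C hC hb using fun j : Fin n => ih (Dd j c)
    refine ⟨C0 + ∑ j, C j, add_nonneg hC0 (sum_nonneg fun j _ => hC j), fun h h0 h1 y hy => ?_⟩
    refine add_le_add (hb0 h h0 h1 y hy) (sum_le_sum fun j _ => ?_)
    have : dd h j c = Be • Dd j c := rfl
    rw [this, G_smul]
    have h3 := hb j h h0 h1 y hy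
    have h4 := G_nonneg h k (Dd j c) y
    have h5 : ‖Be‖ ^ 2 ≤ 1 := by
      rw [norm_real, norm_of_nonneg h0.le]; exact pow_le_one₀ h0.le h1
    exact (mul_le_of_le_one_left h4 h5).trans h3
/-- supported in the closed ball of radius R -/
def Sup (R : ℝ) (u : Sm n) : Prop := ∀ y, R < ‖y‖ → u.1 y = 0
lemma Sup.ev {R : ℝ} {u : Sm n} (hu : Sup R u) {y : Eu n} (hy : R < ‖y‖) : u.1 =ᶠ[nhds y] (0 : Sm n).1 := by
  filter_upwards [continuous_norm.continuousAt.eventually (lt_mem_nhds hy)] with z hz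
  exact hu z hz
lemma Sup.dd {R : ℝ} {u : Sm n} (hu : Sup R u) (h : ℝ) (j : Fin n) : Sup R BF := fun y hy => by
  rw [(dd_loc h j (hu.ev hy)).eq_of_nhds]; simp
lemma Sup.mul {R : ℝ} {u : Sm n} (hu : Sup R u) (c : Sm n) : Sup R (c * u) := fun y hy => by
  have : (c * u).1 y = c.1 y * u.1 y := rfl
  rw [this, hu y hy, mul_zero]
lemma Sup.add {R : ℝ} {u v : Sm n} (hu : Sup R u) (hv : Sup R v) : Sup R (u + v) := fun y hy => by
  have : (u + v).1 y = u.1 y + v.1 y := rfl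
  rw [this, hu y hy, hv y hy, add_zero]
lemma Sup.smul {R : ℝ} {u : Sm n} (hu : Sup R u) (c : ℂ) : Sup R Ks := fun y hy => by
  have : (Ks).1 y = c * u.1 y := rfl
  rw [this, hu y hy, mul_zero]
lemma Sup.zero (R : ℝ) : Sup R (0 : Sm n) := fun _ _ => rfl
lemma Sup.sum {ι : Type*} (s : Finset ι) {R : ℝ} {u : ι → Sm n} (hu : ∀ i, Sup R (u i)) : Sup R (∑ i ∈ s, u i) := by
  classical
  induction s using Finset.induction_on with
  | empty => simpa using Sup.zero R
  | insert a s ha ih => rw [sum_insert ha]; exact (hu a).add ih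
lemma Sup.G {R : ℝ} {u : Sm n} (hu : Sup R u) (h : ℝ) (k : ℕ) {y : Eu n} (hy : R < ‖y‖) : G h k u y = 0 := by
  rw [G_loc h k (hu.ev hy), G_zero]
lemma hcs_of {V : Type*} [NormedAddCommGroup V] {R : ℝ} {f : Eu n → V} (hf : ∀ y, R < ‖y‖ → f y = 0) : HasCompactSupport f := by
  refine HasCompactSupport.intro (isCompact_closedBall (0 : Eu n) R) fun y hy => hf y ?_
  simpa using hy
lemma int_of {V : Type*} [NormedAddCommGroup V] {R : ℝ} {f : Eu n → V} (hc : Continuous f) (hf : ∀ y, R < ‖y‖ → f y = 0) :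
    Integrable f := hc.integrable_of_hasCompactSupport (hcs_of hf)
def Mk (h : ℝ) (k : ℕ) (u : Sm n) : ℝ := ∫ y, G h k u y
lemma Sup.intG {R : ℝ} {u : Sm n} (hu : Sup R u) (h : ℝ) (k : ℕ) : Integrable (_root_.G h k u) :=
  int_of (G_cont h k u) fun _ hy => hu.G h k hy
lemma Mk_nonneg (h : ℝ) (k : ℕ) (u : Sm n) : 0 ≤ Mk h k u := integral_nonneg fun _ => G_nonneg _ _ _ _
lemma Mk_mono (h : ℝ) {k m : ℕ} (hkm : k ≤ m) {R : ℝ} {u : Sm n} (hu : Sup R u) : Mk h k u ≤ Mk h m u :=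
  integral_mono (hu.intG h k) (hu.intG h m) fun y => G_mono h hkm u y
lemma Mk_dd (h : ℝ) (k : ℕ) (j : Fin n) {R : ℝ} {u : Sm n} (hu : Sup R u) : Mk h k BF ≤ Mk h BT u :=
  integral_mono ((BW).intG h k) (hu.intG h _) fun y => G_dd h k j u y
lemma Mk_add (h : ℝ) (k : ℕ) {R : ℝ} {u v : Sm n} (hu : Sup R u) (hv : Sup R v) :
    Mk h k (u + v) ≤ 2 * Mk h k u + 2 * Mk h k v := by
  unfold Mk
  rw [← integral_const_mul, ← integral_const_mul, ← integral_add ((hu.intG h k).const_mul _) ((hv.intG h k).const_mul _)]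
  exact integral_mono ((hu.add hv).intG h k) (((hu.intG h k).const_mul _).add ((hv.intG h k).const_mul _)) fun y => G_add h k u v y
lemma Mk_smul (h : ℝ) (k : ℕ) (c : ℂ) (u : Sm n) : Mk h k Ks = ‖c‖ ^ 2 * Mk h k u := by
  unfold Mk; simp only [G_smul]; rw [integral_const_mul]
lemma Mk_coef (k : ℕ) (c : Sm n) (R : ℝ) : ∃ C ≥ 0, ∀ h, 0 < h → h ≤ 1 → ∀ u : Sm n, Sup R u →
    Mk h k (c * u) ≤ C * Mk h k u := by
  obtain ⟨C, hC, hb⟩ := G_coef k c R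
  have hc := cG_pos n k
  refine ⟨cG n k * C, by positivity, fun h h0 h1 u hu => ?_⟩
  unfold Mk
  rw [← integral_const_mul]
  refine integral_mono ((hu.mul c).intG h k) ((hu.intG h k).const_mul _) fun y => ?_
  rcases le_or_gt ‖y‖ R with hy | hy
  · refine (G_mul h k c u y).trans ?_
    rw [mul_assoc]
    exact mll (mlr (hb h h0 h1 y hy) (G_nonneg _ _ _ _)) hc.le
  · simp only [(hu.mul c).G h k hy, hu.G h k hy, mul_zero, le_refl]
end
end
section
section
variable {n : ℕ}
inductive Gen (n : ℕ)
  | X : Fin n → Gen n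
  | Y : Fin n → Gen n
  | c : Sm n → Sm n → Gen n
def Gen.ord : Gen n → ℕ
  | .X _ => 1
  | .Y _ => 1
  | .c _ _ => 0
/-- families of operators indexed by (h, τ) -/
def Fam (n : ℕ) := ℝ → ℝ → Module.End ℂ (Sm n)
instance (n : ℕ) : Ring (Fam n) := inferInstanceAs (Ring (ℝ → ℝ → Module.End ℂ (Sm n)))
lemma Fam.ext {S T : Fam n} (hh : ∀ h τ u, S h τ u = T h τ u) : S = T :=
  funext fun h => funext fun τ => LinearMap.ext fun u => hh h τ u
lemma fam_add (S T : Fam n) (h τ : ℝ) (u : Sm n) : (S + T) h τ u = S h τ u + T h τ u := rfl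
lemma fam_sub (S T : Fam n) (h τ : ℝ) (u : Sm n) : (S - T) h τ u = S h τ u - T h τ u := rfl
lemma fam_neg (S : Fam n) (h τ : ℝ) (u : Sm n) : (-S) h τ u = -(S h τ u) := rfl
lemma fam_mul (S T : Fam n) (h τ : ℝ) (u : Sm n) : (S * T) h τ u = S h τ JM := rfl
lemma fam_one (h τ : ℝ) (u : Sm n) : (1 : Fam n) h τ u = u := rfl
lemma fam_zero (h τ : ℝ) (u : Sm n) : (0 : Fam n) h τ u = 0 := rfl
lemma fam_sum {ι : Type*} (s : Finset ι) (T : ι → Fam n) (h τ : ℝ) (u : Sm n) : (∑ i ∈ s, T i) h τ u = ∑ i ∈ s, T i h τ u := by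
  classical
  induction s using Finset.induction_on with
  | empty => simp [fam_zero]
  | insert i s hi ih => rw [sum_insert hi, sum_insert hi, fam_add, ih]
def cf (c0 c1 : Sm n) (τ : ℝ) : Sm n := c0 + Kf • c1
def mulF (c0 c1 : Sm n) : Fam n := fun _ τ => LinearMap.mulLeft ℂ (cf c0 c1 τ)
def dF (j : Fin n) : Fam n := fun h _ => dd h j
def HF : Fam n := fun h _ => Be • 1
lemma mulF_app (c0 c1 : Sm n) (h τ : ℝ) (u : Sm n) : mulF c0 c1 h τ u = (c0 + Kf • c1) * u := rfl
lemma dF_app (j : Fin n) (h τ : ℝ) (u : Sm n) : dF j h τ u = dd h j u := rfl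
lemma HF_app (h τ : ℝ) (u : Sm n) : HF h τ u = Be • u := rfl
variable (a b : Sm n)
def EF : Gen n → Fam n
  | .X j => dF j - mulF Bv Bw
  | .Y j => dF j + mulF Bv Bw
  | .c c0 c1 => mulF c0 c1
inductive WW : ℕ → Fam n → Prop
  | one : WW 0 1
  | cons (g : Gen n) {m : ℕ} {T : Fam n} : WW m T → WW (g.ord + m) (EF a b g * T)
  | add {m : ℕ} {S T : Fam n} : WW m S → WW m T → WW m (S + T)
  | mono {m m' : ℕ} {T : Fam n} : m ≤ m' → WW m T → WW m' T
variable {a b}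
lemma HF_comm (T : Fam n) : T * HF = HF * T := by
  refine Fam.ext fun h τ u => ?_
  simp only [fam_mul, HF_app, map_smul]
lemma WW.mul {m k : ℕ} {S T : Fam n} (hS : WW a b m S) (hT : WW a b k T) : WW a b (m + k) (S * T) := by
  induction hS with
  | one => simpa using hT
  | cons g _ ih => rw [mul_assoc, add_assoc]; exact WW.cons g ih
  | add _ _ i1 i2 => rw [add_mul]; exact i1.add i2
  | mono hm _ ih => exact ih.mono (by omega)
lemma WW.gen (g : Gen n) : WW a b g.ord (EF a b g) := by
  have := WW.cons g (WW.one (a := a) (b := b))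
  simpa using this
lemma WW.coef (c0 c1 : Sm n) : WW a b 0 (mulF c0 c1) := WW.gen (.c c0 c1)
lemma WW.neg {m : ℕ} {T : Fam n} (hT : WW a b m T) : WW a b m (-T) := by
  have := (WW.coef Jb 0).mul hT
  rw [zero_add] at this
  convert this using 1
  refine Fam.ext fun h τ u => ?_
  simp only [mulF_app, fam_mul, fam_neg, smul_zero, add_zero]
  exact (neg_one_mul JM).symm
lemma WW.sub {m : ℕ} {S T : Fam n} (hS : WW a b m S) (hT : WW a b m T) : WW a b m (S - T) := by
  rw [sub_eq_add_neg]; exact hS.add hT.neg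
lemma WW.zero : WW a b 0 0 := by
  have := (WW.one (a := a) (b := b)).sub WW.one
  simpa using this
lemma WW.sum {ι : Type*} (s : Finset ι) {m : ℕ} {T : ι → Fam n} (hT : ∀ i, WW a b m (T i)) : WW a b m (∑ i ∈ s, T i) := by
  classical
  induction s using Finset.induction_on with
  | empty => simpa using WW.zero.mono (Nat.zero_le m)
  | insert i s hi ih => rw [sum_insert hi]; exact (hT i).add ih
lemma WW.pow {m : ℕ} {T : Fam n} (hT : WW a b m T) (k : ℕ) : WW a b (k * m) (T ^ k) := by
  induction k with
  | zero => simpa using WW.one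
  | succ k ih => rw [pow_succ, Nat.succ_mul]; exact ih.mul hT
lemma dF_mulF (j : Fin n) (c0 c1 : Sm n) : dF j * mulF c0 c1 - mulF c0 c1 * dF j = HF * mulF (Dd j c0) (Dd j c1) := by
  refine Fam.ext fun h τ u => ?_
  simp only [fam_sub, fam_mul, dF_app, mulF_app, HF_app, dd_mul, add_sub_cancel_right]
  simp only [dd, LinearMap.smul_apply, map_add, map_smul]
  rw [smul_comm Kf, ← smul_add, smul_mul_assoc]
lemma dF_comm (j l : Fin n) : (dF j * dF l : Fam n) = dF l * dF j := by
  refine Fam.ext fun h τ u => ?_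
  simp only [fam_mul, dF_app, dd, LinearMap.smul_apply, map_smul, Dd_comm j l]
lemma mulF_comm (c0 c1 e0 e1 : Sm n) : mulF c0 c1 * mulF e0 e1 = mulF e0 e1 * mulF c0 c1 := by
  refine Fam.ext fun h τ u => ?_
  simp only [fam_mul, mulF_app]
  ring
lemma mulF_add (c0 c1 e0 e1 : Sm n) : mulF c0 c1 + mulF e0 e1 = mulF (c0 + e0) (c1 + e1) := by
  refine Fam.ext fun h τ u => ?_
  simp only [fam_add, mulF_app, smul_add]
  ring
lemma mulF_neg (c0 c1 : Sm n) : -mulF c0 c1 = mulF (-c0) (-c1) := by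
  refine Fam.ext fun h τ u => ?_
  simp only [fam_neg, mulF_app, smul_neg]
  ring
lemma dF_mulF' (j : Fin n) (c0 c1 : Sm n) : dF j * mulF c0 c1 = mulF c0 c1 * dF j + HF * mulF (Dd j c0) (Dd j c1) := by
  rw [← dF_mulF]; abel
/-- the basic commutator -/
lemma comm_YX (l j : Fin n) : EY * EX - EX * EY =
    -(2 * (HF * mulF (Dd l Bv) (Dd l Bw))) := by
  simp only [EF, add_mul, mul_add, sub_mul, mul_sub, dF_mulF', dF_comm l j, mulF_comm (Dd l a)]
  rw [Dd_comm j l a, Dd_comm j l b]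
  noncomm_ring
lemma comm_gen (g g' : Gen n) : ∃ c0 c1, EF a b g * EF a b g' - EF a b g' * EF a b g = HF * mulF c0 c1 := by
  have hz : (mulF 0 0 : Fam n) = 0 := by
    refine Fam.ext fun h τ u => ?_
    simp [mulF_app, fam_zero]
  rcases g with j | j | ⟨c0, c1⟩ <;> rcases g' with l | l | ⟨e0, e1⟩
  · refine ⟨0, 0, ?_⟩
    simp only [EF, mul_sub, sub_mul, dF_mulF', dF_comm l j, mulF_comm (Dd l a), hz]
    rw [Dd_comm j l a, Dd_comm j l b]
    noncomm_ring
  · refine ⟨2 * Dd l Bv, 2 * Dd l Bw, ?_⟩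
    rw [← neg_sub, comm_YX, neg_neg]
    rw [two_mul, two_mul, two_mul, ← mulF_add]; noncomm_ring
  · refine ⟨Dd j e0, Dd j e1, ?_⟩
    simp only [EF, mul_sub, sub_mul, dF_mulF', mulF_comm e0]
    noncomm_ring
  · refine ⟨-(2 * Dd j (Dd l a)), -(2 * Dd j (Dd l b)), ?_⟩
    rw [comm_YX, ← mulF_neg, two_mul, two_mul, two_mul, ← mulF_add]; noncomm_ring
  · refine ⟨0, 0, ?_⟩
    simp only [EF, mul_add, add_mul, dF_mulF', dF_comm l j, mulF_comm (Dd l a), hz]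
    rw [Dd_comm j l a, Dd_comm j l b]
    noncomm_ring
  · refine ⟨Dd j e0, Dd j e1, ?_⟩
    simp only [EF, mul_add, add_mul, dF_mulF', mulF_comm e0]
    noncomm_ring
  · refine ⟨-Dd l c0, -Dd l c1, ?_⟩
    rw [← mulF_neg]
    simp only [EF, mul_sub, sub_mul, dF_mulF', mulF_comm c0]
    noncomm_ring
  · refine ⟨-Dd l c0, -Dd l c1, ?_⟩
    rw [← mulF_neg]
    simp only [EF, mul_add, add_mul, dF_mulF', mulF_comm c0]
    noncomm_ring
  · refine ⟨0, 0, ?_⟩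
    simp only [EF, hz, mulF_comm c0, sub_self, mul_zero]
lemma comm_gW (g : Gen n) {m : ℕ} {T : Fam n} (hT : WW a b m T) :
    ∃ R, WW a b (g.ord + m) R ∧ EF a b g * T - T * EF a b g = HF * R := by
  induction hT with
  | one => exact ⟨0, WW.zero.mono (Nat.zero_le _), by simp⟩
  | cons g' hT ih =>
    rename_i m T
    obtain ⟨R, hR, e⟩ := ih
    obtain ⟨c0, c1, e'⟩ := comm_gen (a := a) (b := b) g g'
    refine ⟨mulF c0 c1 * T + EF a b g' * R, ?_, ?_⟩
    · refine WW.add (((WW.coef c0 c1).mul hT).mono (by omega)) ((WW.cons g' hR).mono (by omega))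
    · rw [mul_add, ← mul_assoc HF, ← e', ← mul_assoc HF, ← HF_comm, mul_assoc _ HF, ← e]
      noncomm_ring
  | add _ _ i1 i2 =>
    obtain ⟨R, hR, e⟩ := i1
    obtain ⟨R', hR', e'⟩ := i2
    exact ⟨R + R', hR.add hR', by rw [mul_add HF, ← e, ← e']; noncomm_ring⟩
  | mono hm _ ih =>
    obtain ⟨R, hR, e⟩ := ih
    exact ⟨R, hR.mono (by omega), e⟩
lemma comm_WW {m k : ℕ} {S T : Fam n} (hS : WW a b m S) (hT : WW a b k T) :
    ∃ R, WW a b (m + k) R ∧ S * T - T * S = HF * R := by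
  induction hS with
  | one => exact ⟨0, WW.zero.mono (Nat.zero_le _), by simp⟩
  | cons g hS ih =>
    rename_i m S
    obtain ⟨R, hR, e⟩ := ih
    obtain ⟨Q, hQ, e'⟩ := comm_gW g hT
    refine ⟨EF a b g * R + Q * S, ?_, ?_⟩
    · refine WW.add ((WW.cons g hR).mono (by omega)) ((hQ.mul hS).mono (by omega))
    · rw [mul_add, ← mul_assoc HF Q, ← e', ← mul_assoc HF, ← HF_comm, mul_assoc _ HF, ← e]
      noncomm_ring
  | add _ _ i1 i2 =>
    obtain ⟨R, hR, e⟩ := i1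
    obtain ⟨R', hR', e'⟩ := i2
    exact ⟨R + R', hR.add hR', by rw [mul_add HF, ← e, ← e']; noncomm_ring⟩
  | mono hm _ ih =>
    obtain ⟨R, hR, e⟩ := ih
    exact ⟨R, hR.mono (by omega), e⟩
end
end
section
section
variable {n : ℕ}
def ip (u v : Sm n) : ℂ := ∫ y, u.1 y * cJ (v.1 y)
lemma ip_int {R : ℝ} {u : Sm n} (hu : Sup R u) (v : Sm n) : Integrable (fun y => u.1 y * cJ (v.1 y)) :=
  int_of ((JS).continuous.mul (Complex.continuous_conj.comp (smo v).continuous)) fun y hy => by rw [hu y hy, zero_mul]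
lemma ip_add {R : ℝ} {u u' : Sm n} (hu : Sup R u) (hu' : Sup R u') (v : Sm n) : ip (u + u') v = ip u v + ip u' v := by
  unfold ip
  rw [← integral_add (ip_int hu v) (ip_int hu' v)]
  congr 1; funext y; exact add_mul _ _ _
lemma ip_smul (c : ℂ) (u v : Sm n) : ip Ks v = c * ip u v := by
  unfold ip
  rw [← integral_const_mul]
  congr 1; funext y; exact mul_assoc c (u.1 y) _
lemma ip_conj (u v : Sm n) : ip v u = cJ (ip u v) := by
  unfold ip
  rw [← integral_conj]
  congr 1; funext y
  simp [mul_comm]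
lemma ip_neg (u v : Sm n) : ip (-u) v = -ip u v := by
  have := ip_smul Jb u v
  simpa using this
lemma ip_sub {R : ℝ} {u u' : Sm n} (hu : Sup R u) (hu' : Sup R u') (v : Sm n) : ip (u - u') v = ip u v - ip u' v := by
  rw [sub_eq_add_neg, ip_add hu (by simpa using hu'.smul Jb), ip_neg, sub_eq_add_neg]
lemma ip_add_right {R : ℝ} {u v v' : Sm n} (hv : Sup R v) (hv' : Sup R v') : ip u (v + v') = ip u v + ip u v' := by
  rw [ip_conj, ip_add hv hv', map_add, ← ip_conj, ← ip_conj]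
lemma ip_sum {ι : Type*} (s : Finset ι) {R : ℝ} {u : ι → Sm n} (hu : ∀ i, Sup R (u i)) (v : Sm n) :
    ip (∑ i ∈ s, u i) v = ∑ i ∈ s, ip (u i) v := by
  classical
  induction s using Finset.induction_on with
  | empty => simp [ip]
  | insert a s ha ih => rw [sum_insert ha, sum_insert ha, ip_add (hu a) (Sup.sum s hu), ih]
lemma ip_self (h : ℝ) (u : Sm n) : ip u u = ((Mk h 0 u : ℝ) : ℂ) := by
  unfold ip Mk
  rw [← integral_complex_ofReal]
  congr 1; funext y
  simp [G, mul_conj, normSq_eq_norm_sq]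
lemma ip_le (h : ℝ) {R : ℝ} {u v : Sm n} (hu : Sup R u) (hv : Sup R v) : ‖ip u v‖ ≤ Mk h 0 u + Mk h 0 v := by
  unfold ip Mk
  refine (norm_integral_le_integral_norm _).trans ?_
  rw [← integral_add (hu.intG h 0) (hv.intG h 0)]
  refine integral_mono (ip_int hu v).norm ((hu.intG h 0).add (hv.intG h 0)) fun y => ?_
  simp only [G, norm_mul, RCLike.norm_conj]
  nlinarith [sq_nonneg (‖u.1 y‖ - ‖v.1 y‖), sq_nonneg ‖u.1 y‖, sq_nonneg ‖v.1 y‖]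
lemma ip_mul_left (c u v : Sm n) : ip (c * u) v = ip u (cj c * v) := by
  unfold ip
  congr 1; funext y
  have h1 : (c * u).1 y = c.1 y * u.1 y := rfl
  have h2 : (cj c * v).1 y = cJ (c.1 y) * v.1 y := rfl
  rw [h1, h2, map_mul, conj_conj]; ring
lemma ip_dd (h : ℝ) (j : Fin n) {R : ℝ} {u v : Sm n} (hu : Sup R u) (hv : Sup R v) :
    ip BF v = -ip u (dd h j v) := by
  have e1 : ∀ y, cJ ((dd h j v).1 y) = (dd h j JB).1 y := fun y => by rw [dd_cj]; rfl
  have e2 : ∀ y, cJ (v.1 y) = (JB).1 y := fun y => rfl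
  unfold ip
  simp only [e1, e2]; simp only [dd_apply]
  have hu1 : ∀ y, R < ‖y‖ → gp j u.1 y = 0 := fun y hy => by
    have := hu.dd 1 j y hy
    rw [dd_apply] at this
    simpa using this
  have hcu := ((JS).gp j).continuous
  have hcv := ((smo JB).gp j).continuous
  have i1 : Integrable (fun y => gp j u.1 y * (JB).1 y) :=
    int_of (R := R) (hcu.mul (smo JB).continuous) fun y hy => by rw [hu1 y hy, zero_mul]
  have i2 : Integrable (fun y => u.1 y * gp j (JB).1 y) :=
    int_of (R := R) ((JS).continuous.mul hcv) fun y hy => by rw [hu y hy, zero_mul]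
  have i3 : Integrable (fun y => u.1 y * (JB).1 y) :=
    int_of (R := R) ((JS).continuous.mul (smo JB).continuous) fun y hy => by rw [hu y hy, zero_mul]
  have key := integral_mul_fderiv_eq_neg_fderiv_mul_of_integrable (𝕜 := ℂ) (μ := volume) (f := u.1) (g := (JB).1)
    (v := EuclideanSpace.single j 1) i1 i2 i3
    (fun y _ => (JS).diff y) (fun y _ => (smo JB).diff y)
  change ∫ y, u.1 y * gp j (JB).1 y = - ∫ y, gp j u.1 y * (JB).1 y at key
  have e3 : (fun y => u.1 y * (Be * gp j (JB).1 y)) = fun y => Be * (u.1 y * gp j (JB).1 y) := by funext y; ring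
  have e4 : (fun y => (Be * gp j u.1 y) * (JB).1 y) = fun y => Be * (gp j u.1 y * (JB).1 y) := by funext y; ring
  rw [e3, e4, integral_const_mul, integral_const_mul, key]
  ring
lemma cj_add (u v : Sm n) : cj (u + v) = cj u + cj v := Subtype.ext (funext fun y => map_add _ _ _)
lemma cj_smulR (c : ℝ) (u : Sm n) : cj ((c : ℂ) • u) = (c : ℂ) • cj u := Subtype.ext (funext fun y => by
  have h1 : ((c : ℂ) • u).1 y = c * u.1 y := rfl
  have h2 : ((c : ℂ) • cj u).1 y = c * cJ (u.1 y) := rfl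
  rw [h2]
  change cJ (((c : ℂ) • u).1 y) = _
  rw [h1, map_mul, conj_ofReal])
lemma cj_Dd (j : Fin n) (u : Sm n) : cj (Dd j u) = Dd j (cj u) := Subtype.ext (funext fun y => (gp_cj u j y).symm)
variable {a b : Sm n}
def Pr (h τ : ℝ) : Prop := 0 < h ∧ h ≤ 1 ∧ 0 ≤ τ ∧ τ ≤ 1
lemma bdc (c0 c1 : Sm n) (k : ℕ) (R : ℝ) : ∃ C ≥ 0, ∀ h τ, Pr h τ → ∀ u, Sup R u →
    Sup R (mulF c0 c1 h τ u) ∧ Mk h k (mulF c0 c1 h τ u) ≤ C * Mk h k u := by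
  obtain ⟨C0, h0, hb0⟩ := Mk_coef k c0 R
  obtain ⟨C1, h1, hb1⟩ := Mk_coef k c1 R
  refine ⟨2 * C0 + 2 * C1, by positivity, fun h τ hp u hu => ⟨hu.mul _, ?_⟩⟩
  rw [mulF_app, add_mul, smul_mul_assoc]
  have e := Mk_add h k (hu.mul c0) ((hu.mul c1).smul Kf)
  rw [Mk_smul] at e
  have e0 := hb0 h hp.1 hp.2.1 u hu
  have e1 := hb1 h hp.1 hp.2.1 u hu
  have e2 : ‖Kf‖ ^ 2 ≤ 1 := by
    rw [norm_real, norm_eq_abs, sq_abs]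
    nlinarith [hp.2.2.1, hp.2.2.2]
  have e3 := mlr e2 (Mk_nonneg h k (c1 * u))
  linarith
lemma bdg (g : Gen n) (k : ℕ) (R : ℝ) : ∃ C ≥ 0, ∀ h τ, Pr h τ → ∀ u, Sup R u →
    Sup R (EF a b g h τ u) ∧ Mk h k (EF a b g h τ u) ≤ C * Mk h (k + g.ord) u := by
  have key : ∀ j : Fin n, ∃ C ≥ 0, ∀ h τ, Pr h τ → ∀ u, Sup R u → ∀ σ : ℂ, ‖σ‖ = 1 →
      Mk h k (dd h j u + σ • mulF Bv Bw h τ u) ≤ C * Mk h BT u := by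
    intro j
    obtain ⟨C, hC, hb⟩ := bdc Bv Bw k R
    refine ⟨2 + 2 * C, by positivity, fun h τ hp u hu σ hσ => ?_⟩
    obtain ⟨s1, b1⟩ := hb h τ hp u hu
    have e := Mk_add h k BW (s1.smul σ)
    rw [Mk_smul, hσ] at e
    have e1 := Mk_dd h k j hu
    have e2 := mll (Mk_mono h (Nat.le_succ k) hu) hC
    rw [Nat.succ_eq_add_one] at e2
    linarith
  rcases g with j | j | ⟨c0, c1⟩
  · obtain ⟨C, hC, hb⟩ := key j
    refine ⟨C, hC, fun h τ hp u hu => ?_⟩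
    have e : EX h τ u = dd h j u + (-1 : ℂ) • mulF Bv Bw h τ u := by
      simp only [EF, sub_eq_add_neg, neg_smul, one_smul]; rfl
    rw [e]
    exact ⟨(BW).add ((hu.mul _).smul _), hb h τ hp u hu Jb (by simp)⟩
  · obtain ⟨C, hC, hb⟩ := key j
    refine ⟨C, hC, fun h τ hp u hu => ?_⟩
    have e : EF a b (.Y j) h τ u = dd h j u + (1 : ℂ) • mulF Bv Bw h τ u := by
      simp only [EF, fam_add, dF_app, one_smul]
    rw [e]
    exact ⟨(BW).add ((hu.mul _).smul _), hb h τ hp u hu 1 (by simp)⟩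
  · exact bdc c0 c1 k R
lemma bd1 {m : ℕ} {T : Fam n} (hT : WW a b m T) (k : ℕ) (R : ℝ) : ∃ C ≥ 0, ∀ h τ, Pr h τ → ∀ u, Sup R u →
    Sup R JM ∧ Mk h k JM ≤ C * Mk h (k + m) u := by
  induction hT generalizing k with
  | one => exact ⟨1, zero_le_one, fun h τ hp u hu => ⟨hu, by rw [one_mul]; exact le_rfl⟩⟩
  | cons g hT ih =>
    rename_i m T
    obtain ⟨C, hC, hb⟩ := bdg (a := a) (b := b) g k R
    obtain ⟨C', hC', hb'⟩ := ih (k + g.ord)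
    refine ⟨C * C', by positivity, fun h τ hp u hu => ?_⟩
    obtain ⟨s1, b1⟩ := hb' h τ hp u hu
    obtain ⟨s2, b2⟩ := hb h τ hp _ s1
    refine ⟨s2, b2.trans ?_⟩
    rw [mul_assoc, ← add_assoc]
    exact mll b1 hC
  | add _ _ i1 i2 =>
    obtain ⟨C, hC, hb⟩ := i1 k
    obtain ⟨C', hC', hb'⟩ := i2 k
    refine ⟨2 * C + 2 * C', by positivity, fun h τ hp u hu => ?_⟩
    obtain ⟨s1, b1⟩ := hb h τ hp u hu
    obtain ⟨s2, b2⟩ := hb' h τ hp u hu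
    refine ⟨s1.add s2, ?_⟩
    have := Mk_add h k s1 s2
    rw [fam_add]
    linarith
  | mono hm _ ih =>
    obtain ⟨C, hC, hb⟩ := ih k
    refine ⟨C, hC, fun h τ hp u hu => ⟨(hb h τ hp u hu).1, (hb h τ hp u hu).2.trans ?_⟩⟩
    exact mll (Mk_mono h (by omega) hu) hC
lemma WW.sup {m : ℕ} {T : Fam n} (hT : WW a b m T) {R h τ : ℝ} (hp : Pr h τ) {u : Sm n} (hu : Sup R u) : Sup R JM := by
  obtain ⟨C, hC, hb⟩ := bd1 hT 0 R
  exact (hb h τ hp u hu).1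
lemma ip_X (ha : cj a = a) (hb : cj b = b) (j : Fin n) {R h τ : ℝ} {u v : Sm n} (hu : Sup R u) (hv : Sup R v) :
    ip (EX h τ u) v = -ip u (EF a b (.Y j) h τ v) := by
  simp only [EF, fam_sub, fam_add, dF_app, mulF_app]
  rw [ip_sub BW (hu.mul _), ip_add_right (hv.dd h j) (hv.mul _), ip_mul_left, cj_add, cj_smulR, cj_Dd, cj_Dd, ha, hb,
    ip_dd h j hu hv]
  ring
lemma ip_Y (ha : cj a = a) (hb : cj b = b) (j : Fin n) {R h τ : ℝ} {u v : Sm n} (hu : Sup R u) (hv : Sup R v) :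
    ip (EF a b (.Y j) h τ u) v = -ip u (EX h τ v) := by
  have e := congrArg cJ (ip_X ha hb j (h := h) (τ := τ) hv hu)
  rw [map_neg, ← ip_conj, ← ip_conj] at e
  rw [e, neg_neg]
lemma ip_c (c0 c1 : Sm n) {h τ : ℝ} (u v : Sm n) :
    ip (mulF c0 c1 h τ u) v = ip u (mulF (cj c0) (cj c1) h τ v) := by
  simp only [mulF_app]
  rw [ip_mul_left, cj_add, cj_smulR]
lemma bd2 (ha : cj a = a) (hb : cj b = b) {m : ℕ} {T : Fam n} (hT : WW a b m T) (i j : ℕ) (hm : m ≤ i + j) (R : ℝ) :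
    ∃ C ≥ 0, ∀ h τ, Pr h τ → ∀ u v, Sup R u → Sup R v → ‖ip JM v‖ ≤ C * (Mk h i u + Mk h j v) := by
  induction hT generalizing i j with
  | one =>
    refine ⟨1, zero_le_one, fun h τ hp u v hu hv => ?_⟩
    rw [one_mul]
    exact (ip_le h hu hv).trans (add_le_add (Mk_mono h (Nat.zero_le _) hu) (Mk_mono h (Nat.zero_le _) hv))
  | cons g hT ih =>
    rename_i m T
    have hord : ∀ g' : Gen n, g'.ord = 1 → ∀ j', j = j' + 1 → m ≤ i + j' →
      (∀ R h τ u v, Sup R u → Sup R v → ip (EF a b g h τ u) v = -ip u (EF a b g' h τ v)) →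
      ∃ C ≥ 0, ∀ h τ, Pr h τ → ∀ u v, Sup R u → Sup R v → ‖ip ((EF a b g * T) h τ u) v‖ ≤ C * (Mk h i u + Mk h j v) := by
      intro g' ho j' hj hm' hg
      obtain ⟨C, hC, hbb⟩ := ih i j' hm'
      obtain ⟨C', hC', hb'⟩ := bdg (a := a) (b := b) g' j' R
      refine ⟨C + C * C', by positivity, fun h τ hp u v hu hv => ?_⟩
      rw [fam_mul, hg R h τ _ v (hT.sup hp hu) hv, norm_neg]
      refine (hbb h τ hp u _ hu (hb' h τ hp v hv).1).trans ?_
      have e := (hb' h τ hp v hv).2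
      rw [ho, ← hj] at e
      have e1 := mll e hC
      have e2 := Mk_nonneg h i u
      have e3 := Mk_nonneg h j v
      have e4 : 0 ≤ C * C' * Mk h i u := by positivity
      have e5 : 0 ≤ C * Mk h j v := by positivity
      linarith
    rcases Nat.eq_zero_or_pos j with hj | hj
    · subst hj
      obtain ⟨C, hC, hbb⟩ := bd1 (hT.cons g) 0 R
      refine ⟨C + 1, by positivity, fun h τ hp u v hu hv => ?_⟩
      obtain ⟨s1, b1⟩ := hbb h τ hp u hu
      have e := ip_le h s1 hv
      have e1 := mll (Mk_mono h (show 0 + (g.ord + m) ≤ i by omega) hu) hC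
      have e2 := Mk_nonneg h i u
      have e3 := Mk_nonneg h 0 v
      have e4 : 0 ≤ C * Mk h 0 v := by positivity
      linarith
    · obtain ⟨j', rfl⟩ := Nat.exists_eq_add_of_le' hj
      rcases g with l | l | ⟨c0, c1⟩
      · exact hord (.Y l) rfl j' rfl (by simp only [Gen.ord] at hm; omega) fun R h τ u v hu hv => ip_X ha hb l hu hv
      · exact hord (.X l) rfl j' rfl (by simp only [Gen.ord] at hm; omega) fun R h τ u v hu hv => ip_Y ha hb l hu hv
      · obtain ⟨C, hC, hbb⟩ := ih i (j' + 1) (by simp only [Gen.ord] at hm; omega)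
        obtain ⟨C', hC', hb'⟩ := bdc (cj c0) (cj c1) (j' + 1) R
        refine ⟨C + C * C', by positivity, fun h τ hp u v hu hv => ?_⟩
        have e0 : ip ((EF a b (.c c0 c1) * T) h τ u) v = ip JM (mulF (cj c0) (cj c1) h τ v) := ip_c c0 c1 _ v
        rw [e0]
        refine (hbb h τ hp u _ hu (hb' h τ hp v hv).1).trans ?_
        have e := (hb' h τ hp v hv).2
        have e1 := mll e hC
        have e2 := Mk_nonneg h i u
        have e3 := Mk_nonneg h (j' + 1) v
        have e4 : 0 ≤ C * C' * Mk h i u := by positivity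
        have e5 : 0 ≤ C * Mk h (j' + 1) v := by positivity
        linarith
  | add hS hT i1 i2 =>
    obtain ⟨C, hC, hb⟩ := i1 i j hm
    obtain ⟨C', hC', hb'⟩ := i2 i j hm
    refine ⟨C + C', by positivity, fun h τ hp u v hu hv => ?_⟩
    rw [fam_add, ip_add (hS.sup hp hu) (hT.sup hp hu)]
    refine (norm_add_le _ _).trans ?_
    have := hb h τ hp u v hu hv
    have := hb' h τ hp u v hu hv
    linarith
  | mono hm' _ ih => exact ih i j (by omega)
end
end
section
lemma comm4 {A : Type*} [Ring A] (y z : A) : y ^ 4 * z - z * y ^ 4 = ∑ i ∈ Finset.range 4, y ^ i * (y * z - z * y) * y ^ BU := by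
  simp only [Finset.sum_range_succ, Finset.sum_range_zero, show 3 - 3 = 0 from rfl, pow_zero]
  noncomm_ring
lemma comm44 {A : Type*} [Ring A] (y x : A) : y ^ 4 * x ^ 4 - x ^ 4 * y ^ 4 =
    ∑ i ∈ Finset.range 4, ∑ k ∈ Finset.range 4, y ^ i * (x ^ k * (y * x - x * y) * x ^ (3 - k)) * y ^ BU := by
  rw [comm4]
  refine sum_congr rfl fun i _ => ?_
  rw [← neg_sub (x ^ 4 * y), comm4, ← sum_mul, ← mul_sum]
  congr 2
  rw [← sum_neg_distrib]
  refine sum_congr rfl fun k _ => ?_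
  noncomm_ring
section
variable {n : ℕ} {a b : Sm n}
lemma reord {x y F : Fam n} (hx : WW a b 1 x) (hy : WW a b 1 y) (hF : WW a b 0 F) {i k : ℕ} (hi : i < 4) (hk : k < 4) :
    ∃ R, WW a b 6 R ∧ y ^ i * (x ^ k * F * x ^ (3 - k)) * y ^ BU = y ^ 3 * F * x ^ 3 + HF * R := by
  obtain ⟨R1, h1, e1⟩ := comm_WW (hx.pow k) hF
  obtain ⟨R2, h2, e2⟩ := comm_WW (hF.mul (hx.pow 3)) (hy.pow BU)
  refine ⟨y ^ i * R1 * x ^ (3 - k) * y ^ BU + y ^ i * R2, ?_, ?_⟩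
  · refine WW.add ((((hy.pow i).mul h1).mul (hx.pow (3 - k))).mul (hy.pow BU) |>.mono (by omega)) (((hy.pow i).mul h2).mono (by omega))
  · have p1 : y ^ 3 = y ^ i * y ^ BU := by rw [← pow_add]; congr 1; omega
    have p2 : x ^ 3 = x ^ k * x ^ (3 - k) := by rw [← pow_add]; congr 1; omega
    have e1' : x ^ k * F = F * x ^ k + HF * R1 := by rw [← e1]; abel
    have e2' : F * x ^ 3 * y ^ BU = y ^ BU * (F * x ^ 3) + HF * R2 := by rw [← e2]; abel
    have e3 : y ^ i * (x ^ k * F * x ^ (3 - k)) * y ^ BU = y ^ i * (F * x ^ 3 * y ^ BU) + (y ^ i * HF) * R1 * x ^ (3 - k) * y ^ BU := by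
      rw [e1', p2]; noncomm_ring
    rw [e3, e2', p1, HF_comm, mul_add (y ^ i), ← mul_assoc (y ^ i) HF, HF_comm]
    noncomm_ring
def PF (a b : Sm n) : Fam n := ∑ j, EX ^ 4
def QF (a b : Sm n) : Fam n := ∑ j, EF a b (.Y j) ^ 4
def Fjl (a b : Sm n) (j l : Fin n) : Fam n := mulF (Dd l Bv) (Dd l Bw)
def KF (a b : Sm n) : Fam n := -∑ j, ∑ l, EY ^ 3 * Fjl a b j l * EX ^ 3
lemma WWX (j : Fin n) (k : ℕ) : WW a b k (EX ^ k) := by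
  have := (WW.gen (a := a) (b := b) (.X j)).pow k
  simpa [Gen.ord] using this
lemma WWY (j : Fin n) (k : ℕ) : WW a b k (EF a b (.Y j) ^ k) := by
  have := (WW.gen (a := a) (b := b) (.Y j)).pow k
  simpa [Gen.ord] using this
lemma WW_PF : WW a b 4 (PF a b) := WW.sum _ fun j => WWX j 4
lemma WW_QF : WW a b 4 (QF a b) := WW.sum _ fun j => WWY j 4
lemma WW_KF : WW a b 6 (KF a b) :=
  (WW.sum _ fun j => WW.sum _ fun l => ((WWY l 3).mul (WW.coef _ _)).mul (WWX j 3)).neg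
lemma comm_one (j l : Fin n) : ∃ R, WW a b 6 R ∧ EY ^ 4 * EX ^ 4 - EX ^ 4 * EY ^ 4 =
    HF * (32 * (-Jc)) + HF * (HF * R) := by
  have hF : WW a b 0 (Fjl a b j l) := WW.coef _ _
  have hx : WW a b 1 (EX) := WW.gen (.X j)
  have hy : WW a b 1 (EY) := WW.gen (.Y l)
  have hr : ∀ i k : ℕ, ∃ R, WW a b 6 R ∧ (i < 4 → k < 4 →
      EY ^ i * Kb * EY ^ BU =
      EY ^ 3 * Fjl a b j l * EX ^ 3 + HF * R) := by
    intro i k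
    by_cases hh : i < 4 ∧ k < 4
    · obtain ⟨R, hR, e⟩ := reord hx hy hF hh.1 hh.2
      exact ⟨R, hR, fun _ _ => e⟩
    · exact ⟨0, WW.zero.mono (by omega), fun h1 h2 => absurd ⟨h1, h2⟩ hh⟩
  choose R hR e using hr
  refine ⟨-(∑ i ∈ Finset.range 4, ∑ k ∈ Finset.range 4, R i k + ∑ i ∈ Finset.range 4, ∑ k ∈ Finset.range 4, R i k), ?_, ?_⟩
  · have := WW.sum (a := a) (b := b) (Finset.range 4) (T := fun i => ∑ k ∈ Finset.range 4, R i k) fun i => WW.sum _ fun k => hR i k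
    exact (this.add this).neg
  · rw [comm44, comm_YX]
    change ∑ i ∈ Finset.range 4, ∑ k ∈ Finset.range 4, EY ^ i * Jk * EY ^ BU = _
    have e1 : ∀ i ∈ Finset.range 4, ∀ k ∈ Finset.range 4, EY ^ i * Jk * EY ^ BU =
      -(HF * Jc + HF * Jc)
        + HF * (HF * -(R i k + R i k)) := by
      intro i hi k hk
      have h0 : EY ^ i * Jk * EY ^ BU
        = -(HF * (EY ^ i * Kb * EY ^ BU)
          + HF * (EY ^ i * Kb * EY ^ BU)) := by
        have h1 : EX ^ k * -(2 * (HF * Fjl a b j l)) = HF * -(EX ^ k * Fjl a b j l + EX ^ k * Fjl a b j l) := by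
          rw [two_mul, mul_neg, mul_add, ← mul_assoc, HF_comm]; noncomm_ring
        rw [h1, mul_assoc HF, ← mul_assoc _ HF, HF_comm]; noncomm_ring
      rw [h0, e i k (Finset.mem_range.1 hi) (Finset.mem_range.1 hk)]
      noncomm_ring
    rw [sum_congr rfl fun i hi => sum_congr rfl fun k hk => e1 i hi k hk]
    simp only [sum_add_distrib, sum_const, Finset.card_range, ← mul_sum, sum_neg_distrib]
    congr 1
    generalize Jc = Z
    noncomm_ring
lemma PQ_gen {A ι : Type*} [Ring A] [Fintype ι] (x y : ι → A) (z r : ι → ι → A) (H : A)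
    (e : ∀ j l, y l ^ 4 * x j ^ 4 - x j ^ 4 * y l ^ 4 = H * (32 * (-z j l)) + H * (H * r j l)) :
    (∑ j, y j ^ 4) * (∑ j, x j ^ 4) - (∑ j, x j ^ 4) * (∑ j, y j ^ 4) = H * (32 * (-∑ j, ∑ l, z j l)) + H * (H * ∑ j, ∑ l, r j l) := by
  have : (∑ j, y j ^ 4) * (∑ j, x j ^ 4) - (∑ j, x j ^ 4) * (∑ j, y j ^ 4) = ∑ j, ∑ l, (y l ^ 4 * x j ^ 4 - x j ^ 4 * y l ^ 4) := by
    simp only [sum_sub_distrib]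
    congr 1
    · rw [sum_mul_sum, sum_comm]
    · rw [sum_mul_sum]
  rw [this, sum_congr rfl fun j _ => sum_congr rfl fun l _ => e j l]
  simp only [sum_add_distrib, ← mul_sum, sum_neg_distrib]
lemma comm_PQ (a b : Sm n) : ∃ R, WW a b 6 R ∧ QF a b * PF a b - PF a b * QF a b = HF * (32 * KF a b) + HF * (HF * R) := by
  choose R hR e using fun j l => comm_one (a := a) (b := b) j l
  refine ⟨∑ j, ∑ l, R j l, WW.sum _ fun j => WW.sum _ fun l => hR j l, ?_⟩
  exact PQ_gen _ _ (fun j l => EY ^ 3 * Fjl a b j l * EX ^ 3) R HF e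
lemma ip_Xk (ha : cj a = a) (hb : cj b = b) (j : Fin n) {R h τ : ℝ} (hp : Pr h τ) {u v : Sm n} (hu : Sup R u) (hv : Sup R v) (k : ℕ) :
    ip ((EX ^ k) h τ u) v = Jb ^ k * ip u ((EF a b (.Y j) ^ k) h τ v) := by
  induction k generalizing u v with
  | zero => simp [fam_one]
  | succ k ih =>
    rw [pow_succ', fam_mul, ip_X ha hb j ((WWX j k).sup hp hu) hv, ih hu, pow_succ (EF a b (.Y j)), fam_mul]
    · ring
    · have := (WWY (a := a) (b := b) j 1).sup hp hv
      rwa [pow_one] at this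
lemma ip_P (ha : cj a = a) (hb : cj b = b) {R h τ : ℝ} (hp : Pr h τ) {u v : Sm n} (hu : Sup R u) (hv : Sup R v) :
    ip BM v = ip u (QF a b h τ v) := by
  unfold PF QF
  rw [fam_sum, fam_sum, ip_sum _ (fun j => (WWX j 4).sup hp hu), ip_conj, ip_sum _ (fun j => (WWY j 4).sup hp hv), map_sum]
  refine sum_congr rfl fun j _ => ?_
  rw [ip_Xk ha hb j hp hu hv, ← ip_conj]; norm_num
lemma main_comm (ha : cj a = a) (hb : cj b = b) (R : ℝ) : ∃ C ≥ 0, ∀ h τ, Pr h τ → ∀ u, Sup R u →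
    32 * h * (ip (KF a b h τ u) u).re ≤ Mk h 0 BM - Mk h 0 (QF a b h τ u) + C * h ^ 2 * Mk h 4 u := by
  obtain ⟨T, hT, e⟩ := comm_PQ a b
  obtain ⟨C, hC, hbd⟩ := bd2 ha hb hT 3 3 (by norm_num) R
  refine ⟨2 * C, by positivity, fun h τ hp u hu => ?_⟩
  have sP := WW_PF.sup (a := a) (b := b) hp hu
  have sQ := WW_QF.sup (a := a) (b := b) hp hu
  have sK := WW_KF.sup (a := a) (b := b) hp hu
  have sT := hT.sup hp hu
  have e32 : ∀ S : Fam n, (HF * (32 * S) : Fam n) h τ u = ((32 * h : ℝ) : ℂ) • S h τ u := by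
    intro S
    have : (32 : Fam n) * S = (32 : ℕ) • S := by rw [nsmul_eq_mul]; norm_num
    rw [this, fam_mul, HF_app]
    have h2 : ((32 : ℕ) • S) h τ u = (32 : ℕ) • (S h τ u) := rfl
    rw [h2, ← Nat.cast_smul_eq_nsmul ℂ, smul_smul]; push_cast; ring_nf
  have eH : (HF * (HF * T) : Fam n) h τ u = ((h ^ 2 : ℝ) : ℂ) • T h τ u := by
    rw [fam_mul, fam_mul, HF_app, HF_app, smul_smul]; push_cast; ring_nf
  have e1 : ip (QF a b h τ BM - PF a b h τ (QF a b h τ u)) u =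
      ip (((32 * h : ℝ) : ℂ) • KF a b h τ u + ((h ^ 2 : ℝ) : ℂ) • T h τ u) u := by
    rw [← e32, ← eH]; exact congrArg (fun S : Fam n => ip (S h τ u) u) e
  rw [ip_sub (WW_QF.sup (a := a) (b := b) hp sP) (WW_PF.sup (a := a) (b := b) hp sQ), ip_add (sK.smul _) (sT.smul _), ip_smul, ip_smul,
    ip_P ha hb hp sQ hu, ip_self h] at e1
  have e2 : ip (QF a b h τ BM) u = ((Mk h 0 BM : ℝ) : ℂ) := by
    rw [ip_conj, ← ip_P ha hb hp hu sP, ip_self h, conj_ofReal]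
  rw [e2] at e1
  have e3 := congrArg Complex.re e1
  simp only [sub_re, add_re, ofReal_re, re_ofReal_mul] at e3
  have e4 := (abs_re_le_norm _).trans (hbd h τ hp u u hu hu)
  have e5 := (abs_le.1 e4).1
  have e6 := Mk_mono h (show 3 ≤ 4 by norm_num) hu
  have e7 : h ^ 2 * -(C * (Mk h 3 u + Mk h 3 u)) ≤ h ^ 2 * (ip JM u).re := mll e5 (by positivity)
  have e8 : C * h ^ 2 * Mk h 3 u ≤ C * h ^ 2 * Mk h 4 u := mll e6 (by positivity)
  linarith
end
end
section
section
open FourierTransform SchwartzMap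
variable {n : ℕ}
def ft (u : Sm n) (η : Eu n) : ℂ := 𝓕 u.1 η
def sch {R : ℝ} {u : Sm n} (hu : Sup R u) : 𝓢(Eu n, ℂ) := (hcs_of hu).toSchwartzMap JS
lemma ft_sch {R : ℝ} {u : Sm n} (hu : Sup R u) (η : Eu n) : ft u η = 𝓕 (sch hu) η := rfl
lemma ft_cont {R : ℝ} {u : Sm n} (hu : Sup R u) : Continuous (ft u) := (𝓕 (sch hu)).continuous
lemma ft_dd (h : ℝ) (j : Fin n) {R : ℝ} {u : Sm n} (hu : Sup R u) (η : Eu n) :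
    ft BF η = I * ((2 * π * h * η j : ℝ) : ℂ) * ft u η := by
  have hs : (sch BW) = Be • LineDeriv.lineDerivOp (EuclideanSpace.single j (1 : ℝ) : Eu n) (sch hu) := by
    ext y
    rw [SchwartzMap.smul_apply, SchwartzMap.lineDerivOp_apply_eq_fderiv]
    rfl
  rw [ft_sch BW, hs, FourierTransform.fourier_smul, SchwartzMap.smul_apply, SchwartzMap.fourier_lineDerivOp_eq, SchwartzMap.smul_apply,
    SchwartzMap.smulLeftCLM_apply_apply (by fun_prop), ← ft_sch]
  simp only [EuclideanSpace.inner_single_right, smul_eq_mul, Complex.real_smul]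
  push_cast
  simp
  ring
lemma ft_add {R : ℝ} {u v : Sm n} (hu : Sup R u) (hv : Sup R v) (η : Eu n) : ft (u + v) η = ft u η + ft v η := by
  have hs : sch (hu.add hv) = sch hu + sch hv := by ext y; rfl
  rw [ft_sch (hu.add hv), hs, FourierTransform.fourier_add]; rfl
lemma ft_smul (c : ℂ) {R : ℝ} {u : Sm n} (hu : Sup R u) (η : Eu n) : ft Ks η = c * ft u η := by
  have hs : sch (hu.smul c) = c • sch hu := by ext y; rfl
  rw [ft_sch (hu.smul c), hs, FourierTransform.fourier_smul]; rfl
lemma ft_zero (η : Eu n) : ft (0 : Sm n) η = 0 := by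
  have := ft_smul 0 (Sup.zero 0 : Sup 0 (0 : Sm n)) η
  simpa using this
lemma ft_sum {ι : Type*} (s : Finset ι) {R : ℝ} {u : ι → Sm n} (hu : ∀ i, Sup R (u i)) (η : Eu n) :
    ft (∑ i ∈ s, u i) η = ∑ i ∈ s, ft (u i) η := by
  classical
  induction s using Finset.induction_on with
  | empty => simp [ft_zero]
  | insert a s ha ih => rw [sum_insert ha, sum_insert ha, ft_add (hu a) (Sup.sum s hu), ih]
def xi (h : ℝ) (η : Eu n) (j : Fin n) : ℝ := 2 * π * h * η j
def wt (h : ℝ) (η : Eu n) : ℝ := 1 + ∑ j, xi h η j ^ 2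
lemma one_le_wt (h : ℝ) (η : Eu n) : 1 ≤ wt h η := le_add_of_nonneg_right (sum_nonneg fun _ _ => sq_nonneg _)
lemma wt_cont (h : ℝ) : Continuous (wt h : ER) := by
  unfold wt xi; fun_prop
lemma ip_ft {R : ℝ} {u v : Sm n} (hu : Sup R u) (hv : Sup R v) :
    Integrable (fun η => ft u η * cJ (ft v η)) ∧ ∫ η, ft u η * cJ (ft v η) = ip u v := by
  have hm : ∀ f : 𝓢(Eu n, ℂ), MemLp (fun η => f η) 2 := fun f => f.memLp 2
  constructor
  · exact (hm (𝓕 (sch hu))).integrable_mul (hm (𝓕 (sch hv))).star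
  · have := SchwartzMap.integral_inner_fourier_fourier (sch hv) (sch hu)
    exact this
lemma Mk_ft (h : ℝ) (k : ℕ) {R : ℝ} {u : Sm n} (hu : Sup R u) :
    Integrable (fun η => wt h η ^ k * ‖ft u η‖ ^ 2) ∧ ∫ η, wt h η ^ k * ‖ft u η‖ ^ 2 = Mk h k u := by
  induction k generalizing u with
  | zero =>
    simp only [pow_zero, one_mul]
    constructor
    · have := ((𝓕 (sch hu)).memLp 2 volume).integrable_norm_pow (p := 2) (by norm_num)
      exact this
    · exact SchwartzMap.integral_norm_sq_fourier (sch hu)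
  | succ k ih =>
    have e : (fun η => wt h η ^ BT * ‖ft u η‖ ^ 2) = fun η => wt h η ^ k * ‖ft u η‖ ^ 2 + ∑ j, wt h η ^ k * ‖ft BF η‖ ^ 2 := by
      funext η
      have : ∀ j, wt h η ^ k * ‖ft BF η‖ ^ 2 = wt h η ^ k * (xi h η j ^ 2 * ‖ft u η‖ ^ 2) := by
        intro j
        rw [ft_dd h j hu, norm_mul, norm_mul, norm_I, norm_real, norm_eq_abs, one_mul, mul_pow, sq_abs]; rfl
      rw [sum_congr rfl fun j _ => this j, ← mul_sum, ← sum_mul, pow_succ]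
      conv_lhs => enter [1, 2]; rw [wt]
      ring
    have i2 : Integrable (fun η => ∑ j, wt h η ^ k * ‖ft BF η‖ ^ 2) := integrable_finsetSum _ fun j _ => (ih BW).1
    rw [e]
    refine ⟨(ih hu).1.add i2, ?_⟩
    rw [integral_add (ih hu).1 i2, integral_finsetSum _ fun j _ => (ih BW).1, (ih hu).2]
    have e2 : Mk h BT u = Mk h k u + ∑ j, Mk h k BF := by
      unfold Mk
      rw [← integral_finsetSum _ fun j _ => (BW).intG h k, ← integral_add (hu.intG h k) (integrable_finsetSum _ fun j _ => (BW).intG h k)]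
      rfl
    rw [e2, sum_congr rfl fun j _ => (ih BW).2]
end
end
section
section
variable {n : ℕ} {a b : Sm n}
lemma dF4_sub (j : Fin n) : WW a b 3 (dF j ^ 4 - EX ^ 4) := by
  have hx : WW a b 1 (EX) := WW.gen (.X j)
  have hf : WW a b 0 (mulF Bv Bw) := WW.coef _ _
  have e : dF j = EX + mulF Bv Bw := by simp only [EF]; abel
  rw [e]
  generalize EX = x at *
  generalize mulF Bv Bw = f at *
  have hs : WW a b 1 (x + f) := hx.add (hf.mono zero_le_one)
  have e2 : (x + f) ^ 4 - x ^ 4 = f * (x + f) ^ 3 + x * f * (x + f) ^ 2 + x ^ 2 * f * (x + f) + x ^ 3 * f := by noncomm_ring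
  rw [e2]
  refine WW.add (WW.add (WW.add ?_ ?_) ?_) ?_
  · exact (hf.mul (hs.pow 3)).mono (by norm_num)
  · exact ((hx.mul hf).mul (hs.pow 2)).mono (by norm_num)
  · exact (((hx.pow 2).mul hf).mul hs).mono (by norm_num)
  · exact ((hx.pow 3).mul hf).mono (by norm_num)
lemma ft_dpow (h τ : ℝ) (j : Fin n) {R : ℝ} {u : Sm n} (hu : Sup R u) (k : ℕ) (η : Eu n) :
    Sup R ((dF j ^ k) h τ u) ∧ ft ((dF j ^ k) h τ u) η = (I * (xi h η j : ℂ)) ^ k * ft u η := by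
  induction k with
  | zero => exact ⟨hu, by simp [fam_one]⟩
  | succ k ih =>
    rw [pow_succ', fam_mul, dF_app]
    refine ⟨ih.1.dd h j, ?_⟩
    rw [ft_dd h j ih.1, ih.2, pow_succ', xi]; ring
lemma wt_interp (δ : ℝ) (hδ : 0 < δ) {w : ℝ} (hw : 1 ≤ w) : w ^ 3 ≤ δ * w ^ 4 + (1 / δ) ^ 3 := by
  rcases le_or_gt (1 / δ) w with h | h
  · have : 1 ≤ δ * w := by rw [div_le_iff₀ hδ] at h; linarith
    have h2 : w ^ 3 * 1 ≤ w ^ 3 * (δ * w) := mll this (by positivity)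
    have : 0 < (1 / δ) ^ 3 := by positivity
    nlinarith
  · have : w ^ 3 ≤ (1 / δ) ^ 3 := pow_le_pow_left₀ (by linarith) h.le 3
    have : 0 ≤ δ * w ^ 4 := by positivity
    linarith
lemma Mk_interp (δ : ℝ) (hδ : 0 < δ) (h : ℝ) {R : ℝ} {u : Sm n} (hu : Sup R u) : Mk h 3 u ≤ δ * Mk h 4 u + (1 / δ) ^ 3 * Mk h 0 u := by
  rw [← (Mk_ft h 3 hu).2, ← (Kz).2, ← (JZ).2, ← integral_const_mul, ← integral_const_mul,
    ← integral_add ((Kz).1.const_mul _) ((JZ).1.const_mul _)]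
  refine integral_mono (Mk_ft h 3 hu).1 (((Kz).1.const_mul _).add ((JZ).1.const_mul _)) fun η => ?_
  have := mlr (wt_interp δ hδ (one_le_wt h η)) (sq_nonneg ‖ft u η‖)
  simp only [pow_zero, one_mul]
  linarith
lemma wt4_le (h : ℝ) (η : Eu n) : wt h η ^ 4 ≤ 8 + 8 * n ^ 2 * (∑ j, xi h η j ^ 4) ^ 2 := by
  unfold wt
  set r := ∑ j, xi h η j ^ 2 with hr
  have h0 : 0 ≤ r := sum_nonneg fun _ _ => sq_nonneg _
  have h1 : r ^ 2 ≤ n * ∑ j, xi h η j ^ 4 := by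
    have := sq_sum_le_card_mul_sum_sq (s := Finset.univ) (f := fun j => xi h η j ^ 2)
    simp only [Finset.card_univ, Fintype.card_fin, ← pow_mul] at this
    exact this
  have h2 : (r ^ 2) ^ 2 ≤ (n * ∑ j, xi h η j ^ 4) ^ 2 := pow_le_pow_left₀ (by positivity) h1 2
  have h3 : (1 + r) ^ 4 ≤ 8 + 8 * (r ^ 2) ^ 2 := by
    have e1 : (1 + r) ^ 2 ≤ 2 + 2 * r ^ 2 := by nlinarith [sq_nonneg (1 - r)]
    have e2 : ((1 + r) ^ 2) ^ 2 ≤ (2 + 2 * r ^ 2) ^ 2 := pow_le_pow_left₀ (by positivity) e1 2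
    nlinarith [sq_nonneg (1 - r ^ 2)]
  rw [mul_pow] at h2
  linarith
lemma elliptic (a b : Sm n) (R : ℝ) : ∃ C ≥ 0, ∀ h τ, Pr h τ → ∀ u, Sup R u →
    Mk h 4 u ≤ C * (Mk h 0 BM + Mk h 0 u) := by
  have hW : WW a b 3 (∑ j, (dF j ^ 4 - EX ^ 4)) := WW.sum _ fun j => dF4_sub j
  obtain ⟨C, hC, hb⟩ := bd1 hW 0 R
  obtain ⟨D, hD⟩ : ∃ D : ℝ, D = 16 * n ^ 2 * C + 1 := ⟨_, rfl⟩
  have hD0 : 1 ≤ D := by rw [hD]; have : 0 ≤ 16 * (n : ℝ) ^ 2 * C := by positivity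
                         linarith
  obtain ⟨E, hE⟩ : ∃ E : ℝ, E = (1 / (1 / (2 * D))) ^ 3 := ⟨_, rfl⟩
  have hE0 : 0 ≤ E := by rw [hE]; positivity
  refine ⟨16 + 32 * n ^ 2 + 2 * D * E, by positivity, fun h τ hp u hu => ?_⟩
  set v : Sm n := ∑ j, (dF j ^ 4) h τ u with hv
  have sv : Sup R v := Sup.sum _ fun j => (ft_dpow h τ j hu 4 0).1
  have ev : v = PF a b h τ u + (∑ j, (dF j ^ 4 - EX ^ 4) : Fam n) h τ u := by
    rw [hv, ← fam_sum, ← fam_add, sum_sub_distrib, PF, add_sub_cancel]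
  have h1 : Mk h 0 v ≤ 2 * Mk h 0 BM + 2 * (C * Mk h 3 u) := by
    obtain ⟨s1, b1⟩ := hb h τ hp u hu
    rw [ev]
    have := Mk_add h 0 (WW_PF.sup (a := a) (b := b) hp hu) s1
    rw [zero_add] at b1
    linarith
  have h2 : Mk h 4 u ≤ 8 * Mk h 0 u + 8 * n ^ 2 * Mk h 0 v := by
    rw [← (Kz).2, ← (JZ).2, ← (Mk_ft h 0 sv).2, ← integral_const_mul, ← integral_const_mul,
      ← integral_add ((JZ).1.const_mul _) ((Mk_ft h 0 sv).1.const_mul _)]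
    refine integral_mono (Kz).1 (((JZ).1.const_mul _).add ((Mk_ft h 0 sv).1.const_mul _)) fun η => ?_
    have e1 : ft v η = ((∑ j, xi h η j ^ 4 : ℝ) : ℂ) * ft u η := by
      rw [hv, ft_sum _ (fun j => (ft_dpow h τ j hu 4 0).1), sum_congr rfl fun j _ => (ft_dpow h τ j hu 4 η).2, ← sum_mul]
      push_cast
      simp only [mul_pow, Complex.I_pow_four, one_mul]
    have e2 := mlr (wt4_le h η) (sq_nonneg ‖ft u η‖)
    simp only [pow_zero, one_mul, e1, norm_mul, norm_real, norm_eq_abs, mul_pow, sq_abs]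
    linarith
  have h3 := Mk_interp (1 / (2 * D)) (by positivity) h hu
  rw [← hE] at h3
  have m0 := Mk_nonneg h 0 u
  have mP := Mk_nonneg h 0 BM
  have m4 := Mk_nonneg h 4 u
  have h4 : Mk h 4 u ≤ 8 * Mk h 0 u + 16 * n ^ 2 * Mk h 0 BM + D * Mk h 3 u := by
    have e1 := mll h1 (show 0 ≤ 8 * (n : ℝ) ^ 2 by positivity)
    have e2 := Mk_nonneg h 3 u
    rw [hD]; linarith
  have h5 := mll h3 (show 0 ≤ D by linarith)
  have h6 : D * (1 / (2 * D) * Mk h 4 u) = Mk h 4 u / 2 := by field_simp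
  have h7 : Mk h 4 u ≤ 16 * Mk h 0 u + 32 * n ^ 2 * Mk h 0 BM + 2 * D * E * Mk h 0 u := by linarith
  have h8 : 0 ≤ 32 * (n : ℝ) ^ 2 * Mk h 0 u := by positivity
  have h9 : 0 ≤ 2 * D * E * Mk h 0 BM := by positivity
  linarith
end
end
section
structure Ix (n : ℕ) (R0 R : ℝ) where
  x0 : Eu n
  s : ℝ
  t : ℝ
  u : Sm n
  hx : ‖x0‖ ≤ R0
  s0 : 0 < s
  s1 : s ≤ 1
  t0 : 0 ≤ t
  t1 : t ≤ 1
  hu : Sup R u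
section
variable {n : ℕ} {R0 R : ℝ}
lemma Ix.nb (i : IX) {y : Eu n} (hy : ‖y - i.x0‖ ≤ i.s) : ‖y‖ ≤ R0 + 1 := by
  have : ‖y‖ ≤ ‖y - i.x0‖ + ‖i.x0‖ := by
    have := norm_add_le (y - i.x0) i.x0
    rwa [sub_add_cancel] at this
  linarith [i.hx, i.s1]
lemma Ix.nx (i : IX) : ‖i.x0‖ ≤ R0 + 1 := by linarith [i.hx]
lemma Ix.pr (i : IX) : Pr Ba i.t :=
  ⟨by have := i.s0; positivity, pow_le_one₀ i.s0.le i.s1, i.t0, i.t1⟩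
/-- window functions of size s^k, with s-derivatives -/
def Tc (k : ℕ) (r : ISm) : Prop :=
  ∀ m, ∃ C ≥ 0, ∀ i y, ‖y - i.x0‖ ≤ i.s → G i.s m Jm y ≤ C * i.s ^ (2 * k)
def Zs (r : ISm) : Prop := ∀ i y, i.s < ‖y - i.x0‖ → (Jm).1 y = 0
lemma Tc.add {k : ℕ} {r q : ISm} (hr : Tc k r) (hq : Tc k q) : Tc k (fun i => r i + q i) := by
  intro m
  obtain ⟨C, hC, h1⟩ := hr m
  obtain ⟨D, hD, h2⟩ := hq m
  refine ⟨2 * C + 2 * D, by positivity, fun i y hy => (G_add _ _ _ _ _).trans ?_⟩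
  linarith [h1 i y hy, h2 i y hy]
lemma Tc.mul {k l : ℕ} {r q : ISm} (hr : Tc k r) (hq : Tc l q) : Tc (k + l) (fun i => r i * q i) := by
  intro m
  obtain ⟨C, hC, h1⟩ := hr m
  obtain ⟨D, hD, h2⟩ := hq m
  have := cG_pos n m
  refine ⟨cG n m * (C * D), by positivity, fun i y hy => (G_mul _ _ _ _ _).trans ?_⟩
  have e : i.s ^ (2 * (k + l)) = i.s ^ (2 * k) * i.s ^ (2 * l) := by rw [← pow_add]; congr 1; ring
  have := mul_le_mul (h1 i y hy) (h2 i y hy) (G_nonneg _ _ _ _) (mul_nonneg hC (pow_nonneg i.s0.le _))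
  rw [e, mul_assoc]
  refine mll (this.trans (le_of_eq ?_)) (cG_pos n m).le
  ring
lemma Tc.smul {k : ℕ} {r : ISm} (hr : Tc k r) {c : IX → ℂ} (hc : ∃ C ≥ 0, ∀ i, ‖c i‖ ≤ C) : Tc k (fun i => c i • r i) := by
  intro m
  obtain ⟨C, hC, h1⟩ := hr m
  obtain ⟨D, hD, h2⟩ := hc
  refine ⟨D ^ 2 * C, by positivity, fun i y hy => ?_⟩
  rw [G_smul, mul_assoc]
  exact mul_le_mul (pow_le_pow_left₀ (norm_nonneg _) (h2 i) 2) (h1 i y hy) (G_nonneg _ _ _ _) (by positivity)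
lemma Tc.neg {k : ℕ} {r : ISm} (hr : Tc k r) : Tc k (fun i => - r i) := by
  intro m
  obtain ⟨C, hC, h1⟩ := hr m
  exact ⟨C, hC, fun i y hy => by rw [G_neg]; exact h1 i y hy⟩
lemma Tc.sub {k : ℕ} {r q : ISm} (hr : Tc k r) (hq : Tc k q) : Tc k (fun i => r i - q i) := by
  simpa only [sub_eq_add_neg] using hr.add hq.neg
lemma Tc.zero (k : ℕ) : Tc k (fun _ : IX => (0 : Sm n)) := fun m =>
  ⟨0, le_rfl, fun i y _ => by rw [G_zero, zero_mul]⟩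
lemma Tc.sum {ι : Type*} (S : Finset ι) {k : ℕ} {r : ι → ISm} (hr : ∀ j, Tc k (r j)) : Tc k (fun i => ∑ j ∈ S, r j i) := by
  classical
  induction S using Finset.induction_on with
  | empty => simpa using Tc.zero k
  | insert a s ha ih => simp only [sum_insert ha]; exact (hr a).add ih
lemma Tc.mono {k l : ℕ} (hkl : l ≤ k) {r : ISm} (hr : Tc k r) : Tc l r := by
  intro m
  obtain ⟨C, hC, h1⟩ := hr m
  refine ⟨C, hC, fun i y hy => (h1 i y hy).trans (mll ?_ hC)⟩
  exact pow_le_pow_of_le_one i.s0.le i.s1 (by omega)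
lemma Tc.ssmul {k : ℕ} {r : ISm} (hr : Tc k r) : Tc BT (fun i => JJ • r i) := by
  intro m
  obtain ⟨C, hC, h1⟩ := hr m
  refine ⟨C, hC, fun i y hy => ?_⟩
  rw [G_smul, norm_real, norm_of_nonneg i.s0.le]
  have := mll (h1 i y hy) (sq_nonneg i.s)
  refine this.trans (le_of_eq ?_)
  ring
lemma dd_sq (s : ℝ) (j : Fin n) (u : Sm n) : dd BB j u = (s : ℂ) • dd s j u := by
  simp only [dd, LinearMap.smul_apply, smul_smul]; push_cast; rw [sq]
lemma Tc.dds {k : ℕ} {r : ISm} (hr : Tc k r) (l : Fin n) : Tc k (fun i => dd i.s l Jm) := by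
  intro m
  obtain ⟨C, hC, h1⟩ := hr (m + 1)
  exact ⟨C, hC, fun i y hy => (G_dd _ _ _ _ _).trans (h1 i y hy)⟩
lemma Tc.dd {k : ℕ} {r : ISm} (hr : Tc k r) (l : Fin n) : Tc BT (fun i => _root_.dd Ba l Jm) := by
  simp only [dd_sq]; exact (hr.dds l).ssmul
lemma Tc.intro {k : ℕ} {r : ISm} (h0 : ∃ C ≥ 0, ∀ i y, ‖y - i.x0‖ ≤ i.s → ‖(Jm).1 y‖ ≤ C * i.s ^ k)
    (h1 : ∀ l, Tc k (fun i => _root_.dd i.s l Jm)) : Tc k r := by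
  have hz : ∃ C ≥ 0, ∀ i y, ‖y - i.x0‖ ≤ i.s → G i.s 0 Jm y ≤ C * i.s ^ (2 * k) := by
    obtain ⟨C, hC, h⟩ := h0
    refine ⟨C ^ 2, by positivity, fun i y hy => (pow_le_pow_left₀ (norm_nonneg _) (h i y hy) 2).trans (le_of_eq ?_)⟩
    rw [mul_pow, ← pow_mul, mul_comm k 2]
  intro m
  induction m with
  | zero => exact hz
  | succ m ih =>
    obtain ⟨C, hC, hb⟩ := ih
    choose D hD hd using fun l => h1 l m
    refine ⟨C + ∑ l, D l, add_nonneg hC (sum_nonneg fun l _ => hD l), fun i y hy => ?_⟩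
    rw [add_mul, sum_mul]
    exact add_le_add (hb i y hy) (sum_le_sum fun l _ => hd l i y hy)
lemma Tc.coef (c : Sm n) : Tc 0 (fun _ : IX => c) := by
  intro m
  obtain ⟨C, hC, h⟩ := G_coef m c (R0 + 1)
  exact ⟨C, hC, fun i y hy => by simpa using h i.s i.s0 i.s1 y (i.nb hy)⟩
lemma Tc.lift {k : ℕ} {f : Sm n → ISm} (hf : ∀ c, Tc k (f c)) (c0 c1 : Sm n) :
    Tc k (fun i => f c0 i + (i.t : ℂ) • f c1 i) :=
  (hf c0).add ((hf c1).smul ⟨1, zero_le_one, fun i => by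
    rw [norm_real, norm_of_nonneg i.t0]; exact i.t1⟩)
lemma cbd (c : Sm n) : ∃ C ≥ 0, ∀ i : IX, ‖c.1 i.x0‖ ≤ C := by
  obtain ⟨C, hC, h⟩ := cbFam (fun _ : Unit => c.1) (fun _ => (smo c).continuous) R0
  exact ⟨C, hC, fun i => h () _ i.hx⟩
def dlt (c : Sm n) (i : IX) : Sm n := c - (c.1 i.x0) • (1 : Sm n)
lemma Dd_one (l : Fin n) : Dd l (1 : Sm n) = 0 := by
  have := Dd_mul l (1 : Sm n) 1
  simpa using this
lemma dd_smul_one (h : ℝ) (l : Fin n) (c : ℂ) : dd h l (c • (1 : Sm n)) = 0 := by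
  rw [map_smul, dd, LinearMap.smul_apply, Dd_one, smul_zero, smul_zero]
lemma dd_dlt (h : ℝ) (l : Fin n) (c : Sm n) (i : IX) : dd h l (dlt c i) = Be • Dd l c := by
  rw [dlt, map_sub, dd_smul_one, sub_zero]; rfl
lemma dlt_app (c : Sm n) (i : IX) (y : Eu n) : (dlt c i).1 y = c.1 y - c.1 i.x0 := by
  change c.1 y - c.1 i.x0 * 1 = _
  rw [mul_one]
lemma Tc.dlt (c : Sm n) : Tc 1 (_root_.dlt c : ISm) := by
  refine Tc.intro ?_ fun l => ?_
  · obtain ⟨C, hC, h⟩ := tayFam (fun _ : Unit => c.1) (fun _ => smo c) (R0 + 1)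
    refine ⟨C, hC, fun i y hy => ?_⟩
    rw [dlt_app, pow_one]
    exact ((h () i.x0 y i.nx (i.nb hy)).1).trans (mll hy hC)
  · simp only [dd_dlt]; exact (Tc.coef (Dd l c)).ssmul
def crd (m : Fin n) : Sm n := cx (fun x : Eu n => x m) (smo_coord m)
/-- linear function `(y - x0)_m` -/
def lin (m : Fin n) : ISm := dlt (crd m)
lemma Dd_crd (l m : Fin n) : Dd l (crd m) = (if m = l then (1 : ℂ) else 0) • (1 : Sm n) := by
  rw [crd, Dd_cx]
  refine Subtype.ext (funext fun y => ?_)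
  change ((gp l (fun x : Eu n => x m) y : ℝ) : ℂ) = (if m = l then (1 : ℂ) else 0) * 1
  rw [gp_coord]
  split_ifs <;> simp
def rem (c : Sm n) (i : IX) : Sm n := dlt c i - ∑ m, ((Dd m c).1 i.x0) • lin m i
lemma sm_sum_app {ι : Type*} (S : Finset ι) (f : ι → Sm n) (y : Eu n) : (∑ j ∈ S, f j).1 y = ∑ j ∈ S, (f j).1 y := by
  classical
  induction S using Finset.induction_on with
  | empty => rfl
  | insert a s ha ih => rw [sum_insert ha, sum_insert ha, ← ih]; rfl
lemma Tc.rem (c : Sm n) : Tc 2 (_root_.rem c : ISm) := by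
  refine Tc.intro ?_ fun l => ?_
  · obtain ⟨C, hC, h⟩ := tayFam (fun _ : Unit => c.1) (fun _ => smo c) (R0 + 1)
    refine ⟨C, hC, fun i y hy => ?_⟩
    have e : (_root_.rem c i).1 y = c.1 y - c.1 i.x0 - ∑ m, (y - i.x0) m • gp m c.1 i.x0 := by
      change (_root_.dlt c i).1 y - (∑ m, ((Dd m c).1 i.x0) • lin m i).1 y = _
      rw [dlt_app, sm_sum_app]
      congr 1
      refine sum_congr rfl fun m _ => ?_
      change (Dd m c).1 i.x0 * (_root_.dlt (crd m) i).1 y = _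
      rw [dlt_app]
      change gp m c.1 i.x0 * (((y m : ℝ) : ℂ) - ((i.x0 m : ℝ) : ℂ)) = _
      rw [Complex.real_smul]
      simp [mul_comm]
    rw [e]
    exact ((h () i.x0 y i.nx (i.nb hy)).2).trans (mll (pow_le_pow_left₀ (norm_nonneg _) hy 2) hC)
  · have e : (fun i : IX => _root_.dd i.s l (_root_.rem c i)) = fun i => JJ • _root_.dlt (Dd l c) i := by
      funext i
      rw [_root_.rem, map_sub, dd_dlt, map_sum, _root_.dlt, smul_sub]
      congr 1
      have : ∀ m, _root_.dd i.s l (((Dd m c).1 i.x0) • lin m i) = if m = l then JJ • ((Dd m c).1 i.x0 • (1 : Sm n)) else 0 := by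
        intro m
        rw [map_smul, lin, dd_dlt, Dd_crd]
        split_ifs
        · rw [one_smul, smul_comm]
        · rw [zero_smul, smul_zero, smul_zero]
      rw [sum_congr rfl fun m _ => this m]
      simp
    rw [e]; exact (Tc.dlt (Dd l c)).ssmul
/-- rescaled window -/
def sc (g : Sm n) (i : IX) : Sm n := mkS (fun y => g.1 BJ)
  ((smo g).comp (by fun_prop))
lemma dd_sc (g : Sm n) (l : Fin n) (i : IX) : dd i.s l (sc g i) = sc (Dd l g) i := by
  refine Subtype.ext (funext fun y => ?_)
  rw [dd_apply]
  change JJ * fderiv ℝ (fun y => g.1 BJ) y _ = fderiv ℝ g.1 BJ _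
  have h1 : HasFDerivAt (fun y : Eu n => i.s⁻¹ • (y - i.x0)) (i.s⁻¹ • ContinuousLinearMap.id ℝ JH) y :=
    ((hasFDerivAt_id y).sub_const i.x0).const_smul i.s⁻¹
  have h2 := (((smo g).diff BJ).hasFDerivAt.comp y h1).fderiv
  have h3 : fderiv ℝ (fun y => g.1 BJ) y = _ := h2
  rw [h3]
  simp only [ContinuousLinearMap.comp_apply, ContinuousLinearMap.smul_apply, ContinuousLinearMap.id_apply, map_smul, Complex.real_smul]
  have : JJ ≠ 0 := by exact_mod_cast i.s0.ne'
  push_cast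
  field_simp
lemma Tc.sc (g : Sm n) : Tc 0 (_root_.sc g : ISm) := by
  intro m
  obtain ⟨C, hC, h⟩ := G_coef m g 1
  have key : ∀ (g : Sm n) (i : IX) y, G i.s m (_root_.sc g i) y = G 1 m g BJ := by
    clear h
    intro g i y
    induction m generalizing g with
    | zero => rfl
    | succ m ih =>
      simp only [G, dd_sc, ih]
      simp [_root_.dd]
  refine ⟨C, hC, fun i y hy => ?_⟩
  rw [key, mul_zero, pow_zero, mul_one]
  refine h 1 one_pos le_rfl _ ?_
  rw [norm_smul, norm_inv, norm_of_nonneg i.s0.le, inv_mul_le_iff₀ i.s0, mul_one]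
  exact hy
lemma Zs.sc {g : Sm n} (hg : Sup 1 g) : Zs (_root_.sc g : ISm) := fun i y hy => by
  refine hg _ ?_
  rw [norm_smul, norm_inv, norm_of_nonneg i.s0.le, lt_inv_mul_iff₀ i.s0, mul_one]
  exact hy
lemma Zs.add {r q : ISm} (hr : Zs r) (hq : Zs q) : Zs (fun i => r i + q i) := fun i y hy => by
  change (Jm).1 y + (q i).1 y = 0
  rw [hr i y hy, hq i y hy, add_zero]
lemma Zs.sub {r q : ISm} (hr : Zs r) (hq : Zs q) : Zs (fun i => r i - q i) := fun i y hy => by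
  change (Jm).1 y - (q i).1 y = 0
  rw [hr i y hy, hq i y hy, sub_zero]
lemma Zs.mul {q : ISm} (hq : Zs q) (r : ISm) : Zs (fun i => r i * q i) := fun i y hy => by
  change (Jm).1 y * (q i).1 y = 0
  rw [hq i y hy, mul_zero]
lemma Zs.smul {q : ISm} (hq : Zs q) (c : IX → ℂ) : Zs (fun i => c i • q i) := fun i y hy => by
  change c i * (q i).1 y = 0
  rw [hq i y hy, mul_zero]
lemma Zs.ev {r : ISm} (hr : Zs r) (i : IX) {y : Eu n} (hy : i.s < ‖y - i.x0‖) : (Jm).1 =ᶠ[nhds y] (0 : Sm n).1 := by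
  have hc : Continuous fun y : Eu n => ‖y - i.x0‖ := by fun_prop
  filter_upwards [hc.continuousAt.eventually (lt_mem_nhds hy)] with z hz
  exact hr i z hz
lemma Zs.dd {r : ISm} (hr : Zs r) (l : Fin n) : Zs (fun i => _root_.dd Ba l Jm) := fun i y hy => by
  change (_root_.dd Ba l Jm).1 y = 0
  rw [(dd_loc _ l (hr.ev i hy)).eq_of_nhds]; simp
lemma G_sq_le (i : IX) (m : ℕ) (u : Sm n) (y : Eu n) : G Ba m u y ≤ G i.s m u y := by
  induction m generalizing u with
  | zero => exact le_rfl
  | succ m ih =>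
    refine add_le_add (ih u) (sum_le_sum fun j _ => ?_)
    rw [dd_sq, G_smul, norm_real, norm_of_nonneg i.s0.le]
    exact (mul_le_of_le_one_left (G_nonneg _ _ _ _) (pow_le_one₀ i.s0.le i.s1)).trans (ih _)
/-- local mass -/
def Lm (i : IX) : ℝ := ∫ y in Metric.closedBall i.x0 i.s, G Ba 4 i.u y
def TZ (k : ℕ) (r : ISm) : Prop := Tc k r ∧ Zs r
lemma TZ.bd {k : ℕ} {r : ISm} (hr : TZ k r) : ∃ C ≥ 0, ∀ i,
    Mk Ba 4 (r i * i.u) ≤ C * i.s ^ (2 * k) * Lm i := by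
  obtain ⟨C, hC, h⟩ := hr.1 4
  have hc := cG_pos n 4
  refine ⟨cG n 4 * C, by positivity, fun i => ?_⟩
  unfold Mk Lm
  rw [← integral_const_mul, ← integral_indicator Metric.isClosed_closedBall.measurableSet]
  refine integral_mono ((i.hu.mul _).intG _ _) (((i.hu.intG _ _).const_mul _).indicator Metric.isClosed_closedBall.measurableSet) fun y => ?_
  by_cases hy : ‖y - i.x0‖ ≤ i.s
  · have hy' : y ∈ Metric.closedBall i.x0 i.s := by rw [Metric.mem_closedBall, dist_eq_norm]; exact hy
    simp only [Set.indicator_of_mem hy']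
    refine (G_mul _ 4 _ _ y).trans ?_
    rw [mul_assoc, mul_assoc, ← mul_assoc C]
    exact mll (mlr ((G_sq_le i 4 _ y).trans (h i y hy)) (G_nonneg _ _ _ _)) hc.le
  · have hy' : y ∉ Metric.closedBall i.x0 i.s := by rw [Metric.mem_closedBall, dist_eq_norm]; exact hy
    simp only [Set.indicator_of_notMem hy']
    push Not at hy
    have e : (r i * i.u).1 =ᶠ[nhds y] (0 : Sm n).1 := by
      filter_upwards [hr.2.ev i hy] with z hz
      change (Jm).1 z * i.u.1 z = 0
      rw [hz]; exact zero_mul _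
    rw [G_loc _ _ e, G_zero]
lemma TZ.mono {k l : ℕ} (hkl : l ≤ k) {r : ISm} (hr : TZ k r) : TZ l r := ⟨hr.1.mono hkl, hr.2⟩
lemma TZ.add {k : ℕ} {r q : ISm} (hr : TZ k r) (hq : TZ k q) : TZ k (fun i => r i + q i) := ⟨hr.1.add hq.1, hr.2.add hq.2⟩
lemma TZ.sub {k : ℕ} {r q : ISm} (hr : TZ k r) (hq : TZ k q) : TZ k (fun i => r i - q i) := ⟨hr.1.sub hq.1, hr.2.sub hq.2⟩
lemma TZ.mul {k l : ℕ} {r q : ISm} (hq : TZ l q) (hr : Tc k r) : TZ (k + l) (fun i => r i * q i) := ⟨hr.mul hq.1, hq.2.mul r⟩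
lemma TZ.smul {k : ℕ} {q : ISm} (hq : TZ k q) {c : IX → ℂ} (hc : ∃ C ≥ 0, ∀ i, ‖c i‖ ≤ C) : TZ k (fun i => c i • q i) := ⟨hq.1.smul hc, hq.2.smul c⟩
lemma TZ.dd {k : ℕ} {r : ISm} (hr : TZ k r) (l : Fin n) : TZ BT (fun i => _root_.dd Ba l Jm) := ⟨hr.1.dd l, hr.2.dd l⟩
lemma TZ.sc {g : Sm n} (hg : Sup 1 g) : TZ 0 (_root_.sc g : ISm) := ⟨Tc.sc g, Zs.sc hg⟩
end
end
section
abbrev Ex (n : ℕ) (R0 R : ℝ) := IX → Eu n → ℂ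
section
variable {n : ℕ} {R0 R : ℝ}
def vv (i : IX) (η : Eu n) : ℝ := Real.sqrt (wt Ba η)
lemma vv_sq (i : IX) (η : Eu n) : vv i η ^ 2 = wt Ba η :=
  sq_sqrt (zero_le_one.trans (one_le_wt _ η))
lemma one_le_vv (i : IX) (η : Eu n) : 1 ≤ vv i η := Real.one_le_sqrt.2 (one_le_wt _ η)
def Bd (e : IX → ER) : Prop :=
  (∀ i, Continuous (e i)) ∧ (∀ i η, 0 ≤ e i η) ∧ (∀ i, Integrable fun η => wt Ba η ^ 4 * e i η ^ 2) ∧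
  ∃ C ≥ 0, ∀ i, ∫ η, wt Ba η ^ 4 * e i η ^ 2 ≤ C * i.s ^ 4 * Lm i
lemma Bd.add {e f : IX → ER} (he : Bd e) (hf : Bd f) : Bd (fun i η => e i η + f i η) := by
  obtain ⟨c1, p1, i1, C, hC, b1⟩ := he
  obtain ⟨c2, p2, i2, D, hD, b2⟩ := hf
  have key : ∀ i η, wt Ba η ^ 4 * (e i η + f i η) ^ 2 ≤
      2 * (wt Ba η ^ 4 * e i η ^ 2) + 2 * (wt Ba η ^ 4 * f i η ^ 2) := by
    intro i η
    have h1 : (e i η + f i η) ^ 2 ≤ 2 * e i η ^ 2 + 2 * f i η ^ 2 := by nlinarith [sq_nonneg (e i η - f i η)]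
    have h2 : 0 ≤ wt Ba η ^ 4 := pow_nonneg (zero_le_one.trans (one_le_wt _ η)) 4
    have := mll h1 h2
    linarith
  have hI : ∀ i, Integrable fun η => 2 * (wt Ba η ^ 4 * e i η ^ 2) + 2 * (wt Ba η ^ 4 * f i η ^ 2) :=
    fun i => ((i1 i).const_mul 2).add ((i2 i).const_mul 2)
  have hJ : ∀ i, Integrable fun η => wt Ba η ^ 4 * (e i η + f i η) ^ 2 := fun i => by
    refine (hI i).mono' ((((wt_cont _).pow 4).mul (((c1 i).add (c2 i)).pow 2)).aestronglyMeasurable) (of_forall fun η => ?_)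
    rw [norm_of_nonneg]
    · exact key i η
    · exact mul_nonneg (pow_nonneg (zero_le_one.trans (one_le_wt _ η)) 4) (sq_nonneg _)
  refine ⟨fun i => (c1 i).add (c2 i), fun i η => add_nonneg (p1 i η) (p2 i η), hJ, 2 * C + 2 * D, by positivity, fun i => ?_⟩
  refine (integral_mono (hJ i) (hI i) (key i)).trans ?_
  rw [integral_add ((i1 i).const_mul 2) ((i2 i).const_mul 2), integral_const_mul, integral_const_mul]
  linarith [b1 i, b2 i]
lemma Bd.const {e : IX → ER} (he : Bd e) {c : ℝ} (hc : 0 ≤ c) : Bd (fun i η => c * e i η) := by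
  obtain ⟨c1, p1, i1, C, hC, b1⟩ := he
  have e1 : ∀ i, (fun η => wt Ba η ^ 4 * (c * e i η) ^ 2) = fun η => c ^ 2 * (wt Ba η ^ 4 * e i η ^ 2) := fun i => by
    funext η; ring
  refine ⟨fun i => continuous_const.mul (c1 i), fun i η => mul_nonneg hc (p1 i η), fun i => ?_, c ^ 2 * C, by positivity, fun i => ?_⟩
  · rw [e1]; exact (i1 i).const_mul _
  · rw [e1, integral_const_mul]
    have := mll (b1 i) (sq_nonneg c)
    linarith
lemma Bd.base {r : ISm} (hr : TZ 2 r) : Bd (fun i η => ‖ft (r i * i.u) η‖) := by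
  obtain ⟨C, hC, h⟩ := hr.bd
  refine ⟨fun i => (ft_cont (i.hu.mul Jm)).norm, fun i η => norm_nonneg _, fun i => (Mk_ft _ 4 (i.hu.mul Jm)).1, C, hC, fun i => ?_⟩
  rw [(Mk_ft Ba 4 (i.hu.mul Jm)).2]
  exact h i
def Er (a : ℕ) (E : EEx) : Prop := ∃ e, Bd e ∧ ∀ i η, ‖E i η‖ ≤ vv i η ^ a * e i η
def Sy (σ : EEx) : Prop := ∃ C ≥ 0, ∀ i η, ‖σ i η‖ ≤ C * vv i η
lemma Er.add {a : ℕ} {E F : EEx} (hE : Er a E) (hF : Er a F) : Er a (E + F) := by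
  obtain ⟨e, h1, h2⟩ := hE
  obtain ⟨f, h3, h4⟩ := hF
  refine ⟨_, h1.add h3, fun i η => (norm_add_le _ _).trans ?_⟩
  rw [mul_add]
  exact add_le_add (h2 i η) (h4 i η)
lemma Er.neg {a : ℕ} {E : EEx} (hE : Er a E) : Er a (-E) := by
  obtain ⟨e, h1, h2⟩ := hE
  exact ⟨e, h1, fun i η => by rw [Pi.neg_apply, Pi.neg_apply, norm_neg]; exact h2 i η⟩
lemma Er.sub {a : ℕ} {E F : EEx} (hE : Er a E) (hF : Er a F) : Er a (E - F) := by
  rw [sub_eq_add_neg]; exact hE.add hF.neg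
lemma Er.mono {a b : ℕ} (hab : a ≤ b) {E : EEx} (hE : Er a E) : Er b E := by
  obtain ⟨e, h1, h2⟩ := hE
  exact ⟨e, h1, fun i η => (h2 i η).trans (mlr (pow_le_pow_right₀ (one_le_vv i η) hab) (h1.2.1 i η))⟩
lemma Er.mulS {a : ℕ} {E σ : EEx} (hE : Er a E) (hs : Sy σ) : Er (a + 1) (σ * E) := by
  obtain ⟨e, h1, h2⟩ := hE
  obtain ⟨C, hC, h3⟩ := hs
  refine ⟨_, h1.const hC, fun i η => ?_⟩
  have : (σ * E) i η = σ i η * E i η := rfl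
  rw [this, norm_mul]
  refine (mul_le_mul (h3 i η) (h2 i η) (norm_nonneg _) (mul_nonneg hC (zero_le_one.trans (one_le_vv i η)))).trans (le_of_eq ?_)
  ring
lemma Er.mulSk {a : ℕ} {E σ : EEx} (hE : Er a E) (hs : Sy σ) (k : ℕ) : Er (a + k) (σ ^ k * E) := by
  induction k with
  | zero => simpa using hE
  | succ k ih => rw [pow_succ', mul_assoc, ← add_assoc]; exact ih.mulS hs
def kc (c : IX → ℂ) : EEx := fun i _ => c i
lemma Er.mulc {a : ℕ} {E : EEx} (hE : Er a E) {c : IX → ℂ} (hc : ∃ C ≥ 0, ∀ i, ‖c i‖ ≤ C) : Er a (kc c * E) := by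
  obtain ⟨e, h1, h2⟩ := hE
  obtain ⟨C, hC, h3⟩ := hc
  refine ⟨_, h1.const hC, fun i η => ?_⟩
  have : (kc c * E) i η = c i * E i η := rfl
  rw [this, norm_mul]
  refine (mul_le_mul (h3 i) (h2 i η) (norm_nonneg _) hC).trans (le_of_eq ?_)
  ring
lemma Er.zero (a : ℕ) : Er a (0 : EEx) := by
  refine ⟨fun _ _ => 0, ⟨fun i => continuous_const, fun i η => le_rfl, fun i => by simp, 0, le_rfl, fun i => by simp⟩, fun i η => by simp⟩
lemma Er.sum {ι : Type*} (S : Finset ι) {a : ℕ} {E : ι → EEx} (hE : ∀ j, Er a (E j)) : Er a (∑ j ∈ S, E j) := by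
  classical
  induction S using Finset.induction_on with
  | empty => simpa using Er.zero a
  | insert x s hx ih => rw [sum_insert hx]; exact (hE x).add ih
def Ph (f : ISm) (T : Fam n) : EEx := fun i η => ft (f i * T Ba i.t i.u) η
variable {a b : Sm n}
lemma Ph_sup {m : ℕ} {T : Fam n} (hT : WW a b m T) (f : ISm) (i : IX) : Sup R (f i * T Ba i.t i.u) :=
  (hT.sup i.pr i.hu).mul _
lemma Ph_add {m : ℕ} {T : Fam n} (hT : WW a b m T) (f g : ISm) : Ph (fun i => f i + g i) T = Ph f T + Ph g T := by
  funext i η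
  change ft _ η = ft _ η + ft _ η
  rw [add_mul, ft_add (Ph_sup hT f i) (Ph_sup hT g i)]
lemma Ph_smul {m : ℕ} {T : Fam n} (hT : WW a b m T) (c : IX → ℂ) (f : ISm) : Ph (fun i => c i • f i) T = kc c * Ph f T := by
  funext i η
  change ft _ η = c i * ft _ η
  rw [smul_mul_assoc, ft_smul _ (Ph_sup hT f i)]
lemma Ph_sub {m : ℕ} {T : Fam n} (hT : WW a b m T) (f g : ISm) : Ph (fun i => f i - g i) T = Ph f T - Ph g T := by
  have h1 := Ph_add hT (fun i => f i - g i) g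
  simp only [sub_add_cancel] at h1
  rw [h1, add_sub_cancel_right]
lemma Ph_sum {ι : Type*} (S : Finset ι) {m : ℕ} {T : Fam n} (hT : WW a b m T) (f : ι → ISm) : Ph (fun i => ∑ j ∈ S, f j i) T = ∑ j ∈ S, Ph (f j) T := by
  classical
  induction S using Finset.induction_on with
  | empty =>
    funext i η
    change ft _ η = 0
    have : (fun i => ∑ j ∈ (∅ : Finset ι), f j i) i = (0 : Sm n) := Finset.sum_empty
    rw [this, zero_mul, ft_zero]
  | insert x s hx ih => simp only [sum_insert hx]; rw [Ph_add hT, ih]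
lemma Ph_addT {m : ℕ} {S T : Fam n} (hS : WW a b m S) (hT : WW a b m T) (f : ISm) : Ph f (S + T) = Ph f S + Ph f T := by
  funext i η
  change ft (f i * (S + T : Fam n) Ba i.t i.u) η = ft _ η + ft _ η
  rw [fam_add, mul_add, ft_add (Ph_sup hS f i) (Ph_sup hT f i)]
lemma Ph_sumT {ι : Type*} (J : Finset ι) {m : ℕ} {T : ι → Fam n} (hT : ∀ j, WW a b m (T j)) (f : ISm) : Ph f (∑ j ∈ J, T j) = ∑ j ∈ J, Ph f (T j) := by
  classical
  induction J using Finset.induction_on with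
  | empty =>
    funext i η
    change ft (f i * (∑ j ∈ (∅ : Finset ι), T j : Fam n) Ba i.t i.u) η = 0
    rw [Finset.sum_empty, fam_zero, mul_zero, ft_zero]
  | insert x s hx ih => rw [sum_insert hx, sum_insert hx, Ph_addT (hT x) (WW.sum s hT), ih]
lemma Ph_negT {m : ℕ} {T : Fam n} (hT : WW a b m T) (f : ISm) : Ph f (-T) = - Ph f T := by
  have h1 := Ph_addT hT hT.neg f
  rw [add_neg_cancel] at h1
  have h2 : Ph f (0 : Fam n) = 0 := by
    funext i η
    change ft (f i * (0 : Fam n) Ba i.t i.u) η = 0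
    rw [fam_zero, mul_zero, ft_zero]
  rw [h2] at h1
  exact (neg_eq_of_add_eq_zero_right h1.symm).symm
def Fc (c0 c1 : Sm n) (i : IX) : Sm n := cf c0 c1 i.t
def Fv (c0 c1 : Sm n) (i : IX) : ℂ := (cf c0 c1 i.t).1 i.x0
def dl (c0 c1 : Sm n) (i : IX) : Sm n := Fc c0 c1 i - Fv c0 c1 i • (1 : Sm n)
def rm (c0 c1 : Sm n) (i : IX) : Sm n := dl c0 c1 i - ∑ m, Fv (Dd m c0) (Dd m c1) i • lin m i
lemma Fv_eq (c0 c1 : Sm n) (i : IX) : Fv c0 c1 i = c0.1 i.x0 + (i.t : ℂ) * c1.1 i.x0 := rfl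
lemma Fv_bd (c0 c1 : Sm n) : ∃ C ≥ 0, ∀ i : IX, ‖Fv c0 c1 i‖ ≤ C := by
  obtain ⟨C, hC, h⟩ := cbd (R0 := R0) (R := R) c0
  obtain ⟨D, hD, h'⟩ := cbd (R0 := R0) (R := R) c1
  refine ⟨C + D, by positivity, fun i => ?_⟩
  rw [Fv_eq]
  refine (norm_add_le _ _).trans (add_le_add (h i) ?_)
  rw [norm_mul, norm_real, norm_of_nonneg i.t0]
  exact (mul_le_of_le_one_left (norm_nonneg _) i.t1).trans (h' i)
lemma Tc.Fc (c0 c1 : Sm n) : Tc 0 (_root_.Fc c0 c1 : ISm) := Tc.lift Tc.coef c0 c1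
lemma dl_eq (c0 c1 : Sm n) (i : IX) : dl c0 c1 i = dlt c0 i + (i.t : ℂ) • dlt c1 i := by
  rw [dl, Fv_eq, Fc, cf, dlt, dlt, add_smul, smul_sub, smul_smul]; abel
lemma Tc.dl (c0 c1 : Sm n) : Tc 1 (_root_.dl c0 c1 : ISm) := by
  have := Tc.lift (R0 := R0) (R := R) Tc.dlt c0 c1
  simpa only [← dl_eq] using this
lemma rm_eq (c0 c1 : Sm n) (i : IX) : rm c0 c1 i = rem c0 i + (i.t : ℂ) • rem c1 i := by
  rw [rm, dl_eq, rem, rem, smul_sub, Finset.smul_sum]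
  simp only [Fv_eq, add_smul, sum_add_distrib, smul_smul]; abel
lemma Tc.rm (c0 c1 : Sm n) : Tc 2 (_root_.rm c0 c1 : ISm) := by
  have := Tc.lift (R0 := R0) (R := R) Tc.rem c0 c1
  simpa only [← rm_eq] using this
lemma Tc.lin (m : Fin n) : Tc 1 (_root_.lin m : ISm) := Tc.dlt _
/-- first-order letters -/
def IsL (a b : Sm n) (ε : ℂ) (j : Fin n) (L : Fam n) : Prop :=
  WW a b 1 L ∧ ‖ε‖ ≤ 1 ∧ ∀ h τ u, L h τ u = dd h j u + ε • (cf Bv Bw τ * u)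
lemma isX (j : Fin n) : IsL a b Jb j (EX) := ⟨WW.gen (.X j), by simp, fun h τ u => by
  change dd h j u - cf Bv Bw τ * u = _
  rw [neg_smul, one_smul, sub_eq_add_neg]⟩
lemma isY (j : Fin n) : IsL a b 1 j (EF a b (.Y j)) := ⟨WW.gen (.Y j), by simp, fun h τ u => by
  change dd h j u + cf Bv Bw τ * u = _
  rw [one_smul]⟩
def sg (a b : Sm n) (ε : ℂ) (j : Fin n) : EEx := fun i η =>
  I * ((xi Ba η j : ℝ) : ℂ) + ε * Fv Bv Bw i
def Nn (a b : Sm n) (ε : ℂ) (j : Fin n) (f : ISm) (i : IX) : Sm n :=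
  dd Ba j JA - ε • (dl Bv Bw i * f i)
lemma xi_le (i : IX) (η : Eu n) (j : Fin n) : |xi Ba η j| ≤ vv i η := by
  refine abs_le_sqrt ?_
  have := single_le_sum (f := fun j => xi Ba η j ^ 2) (fun _ _ => sq_nonneg _) (Finset.mem_univ j)
  unfold wt
  linarith
lemma Sy_sg {ε : ℂ} (hε : ‖ε‖ ≤ 1) (j : Fin n) : Sy (sg a b ε j : EEx) := by
  obtain ⟨C, hC, h⟩ := Fv_bd (R0 := R0) (R := R) Bv Bw
  refine ⟨1 + C, by positivity, fun i η => (norm_add_le _ _).trans ?_⟩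
  rw [norm_mul, norm_I, one_mul, norm_real, norm_mul, norm_eq_abs, add_mul, one_mul]
  have h1 : ‖ε‖ * ‖Fv Bv Bw i‖ ≤ C := (mul_le_of_le_one_left (norm_nonneg _) hε).trans (h i)
  exact add_le_add (xi_le i η j) (h1.trans (le_mul_of_one_le_right hC (one_le_vv i η)))
lemma TZ.Nn {k : ℕ} {f : ISm} (hf : TZ k f) (ε : ℂ) (j : Fin n) : TZ BT (_root_.Nn a b ε j f) := by
  refine TZ.sub (hf.dd j) (TZ.smul (c := fun _ => ε) ?_ ⟨‖ε‖, norm_nonneg _, fun _ => le_rfl⟩)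
  have := hf.mul (Tc.dl (R0 := R0) (R := R) Bv Bw)
  rwa [add_comm] at this
lemma letter {ε : ℂ} {j : Fin n} {L : Fam n} (hL : IsL a b ε j L) {m : ℕ} {T : Fam n} (hT : WW a b m T) (f : ISm) :
    Ph f (L * T) = sg a b ε j * Ph f T - Ph Jf T := by
  funext i η
  change ft (f i * (L * T : Fam n) Ba i.t i.u) η = (I * ((xi Ba η j : ℝ) : ℂ) + ε * Fv Bv Bw i) *
    ft (f i * T Ba i.t i.u) η - ft (Nn a b ε j f i * T Ba i.t i.u) η
  rw [fam_mul, hL.2.2]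
  have hw := hT.sup i.pr i.hu
  generalize T Ba i.t i.u = w at hw ⊢
  have e : f i * (dd Ba j w + ε • (cf Bv Bw i.t * w)) = dd Ba j (f i * w) +
      ((ε * Fv Bv Bw i) • (f i * w) + (-1 : ℂ) • (Nn a b ε j f i * w)) := by
    rw [dd_mul, Nn, dl, Fc]
    simp only [Algebra.smul_def, map_mul, map_neg, map_one]
    ring
  rw [e, ft_add ((hw.mul JA).dd _ j) (((hw.mul JA).smul _).add ((hw.mul _).smul _)), ft_dd _ j (hw.mul JA),
    ft_add ((hw.mul JA).smul _) ((hw.mul _).smul _), ft_smul _ (hw.mul JA), ft_smul _ (hw.mul _)]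
  unfold xi
  ring
lemma letter_c (c0 c1 : Sm n) (T : Fam n) (f : ISm) : Ph f (mulF c0 c1 * T) = Ph (fun i => Fc c0 c1 i * f i) T := by
  funext i η
  change ft (f i * (mulF c0 c1 * T : Fam n) Ba i.t i.u) η = ft (Fc c0 c1 i * f i * T Ba i.t i.u) η
  rw [fam_mul, mulF_app]
  congr 1
  change f i * (Fc c0 c1 i * _) = _
  ring
lemma E2 {m : ℕ} {T : Fam n} (hT : WW a b m T) {f : ISm} (hf : TZ 2 f) : Er m (Ph f T) := by
  induction hT generalizing f with
  | one => exact ⟨_, Bd.base hf, fun i η => by rw [pow_zero, one_mul]; exact le_rfl⟩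
  | cons g hT ih =>
    rename_i m T
    have lt : ∀ {ε : ℂ} {j : Fin n} {L : Fam n}, IsL a b ε j L → Er (1 + m) (Ph f (L * T)) := by
      intro ε j L hL
      rw [letter hL hT, add_comm 1 m]
      exact ((ih hf).mulS (Sy_sg hL.2.1 j)).sub ((ih ((hf.Nn ε j).mono (by omega))).mono (by omega))
    rcases g with j | j | ⟨c0, c1⟩
    · exact lt (isX j)
    · exact lt (isY j)
    · change Er (0 + m) (Ph f (mulF c0 c1 * T))
      rw [letter_c, zero_add]
      have := hf.mul (Tc.Fc c0 c1)
      exact ih (this.mono (by omega))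
  | add hS hT i1 i2 => rw [Ph_addT hS hT]; exact (i1 hf).add (i2 hf)
  | mono hm _ ih => exact (ih hf).mono hm
lemma E1 {ε : ℂ} {j : Fin n} {L : Fam n} (hL : IsL a b ε j L) {m : ℕ} {T : Fam n} (hT : WW a b m T) {f : ISm} (hf : TZ 1 f) (k : ℕ) :
    Er (m + k) (Ph f (L ^ k * T) - sg a b ε j ^ k * Ph f T) := by
  induction k with
  | zero => simpa using Er.zero m
  | succ k ih =>
    have hW : WW a b (m + k) (L ^ k * T) := ((hL.1.pow k).mul hT).mono (by omega)
    rw [pow_succ', mul_assoc, letter hL hW]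
    have h1 := ih.mulS (Sy_sg (a := a) (b := b) hL.2.1 j)
    have h2 := (E2 hW ((hf.Nn ε j).mono (by omega) : TZ 2 Jf)).mono (show m + k ≤ m + k + 1 by omega)
    have := h1.sub h2
    refine (congrArg (Er (m + k + 1)) ?_).mpr this
    generalize Ph f (L ^ k * T) = A1
    generalize Ph Jf (L ^ k * T) = A2
    generalize sg a b ε j = A3
    generalize Ph f T = A4
    ring
lemma E0 {ε : ℂ} {j : Fin n} {L : Fam n} (hL : IsL a b ε j L) {m : ℕ} {T : Fam n} (hT : WW a b m T) {f : ISm} (hf : TZ 0 f) (k : ℕ) :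
    Er (m + k + 1) (Ph f (L ^ BT * T) - (sg a b ε j ^ BT * Ph f T - ((k : EEx) + 1) * sg a b ε j ^ k * Ph Jf T)) := by
  induction k with
  | zero =>
    have e := letter hL hT f
    have : Ph f (L ^ (0 + 1) * T) - (sg a b ε j ^ (0 + 1) * Ph f T - (((0 : ℕ) : EEx) + 1) * sg a b ε j ^ 0 * Ph Jf T) = 0 := by
      rw [zero_add, pow_one, e]; push_cast; ring
    rw [this]; exact Er.zero _
  | succ k ih =>
    have hW : WW a b (m + k + 1) (L ^ BT * T) := ((hL.1.pow BT).mul hT).mono (by omega)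
    rw [pow_succ', mul_assoc, letter hL hW]
    have h1 := ih.mulS (Sy_sg (a := a) (b := b) hL.2.1 j)
    have h2 := (E1 hL hT (hf.Nn ε j : TZ 1 Jf) BT).mono (show m + BT ≤ m + k + 1 + 1 by omega)
    have := h1.sub h2
    refine (congrArg (Er (m + k + 1 + 1)) ?_).mpr this
    generalize Ph f (L ^ BT * T) = A1
    generalize Ph Jf (L ^ BT * T) = A2
    generalize sg a b ε j = A3
    generalize Ph f T = A4
    generalize Ph Jf T = A5
    push_cast
    ring
end
end
section
section
variable {n : ℕ} {R0 R : ℝ} {a b : Sm n}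
def Qe (a : ℕ) (E F : EEx) : Prop := Er a (E - F)
lemma Qe.trans {k : ℕ} {E F H : EEx} (h1 : Qe k E F) (h2 : Qe k F H) : Qe k E H := by
  have := Er.add h1 h2
  rwa [sub_add_sub_cancel] at this
lemma Qe.add {k : ℕ} {E F E' F' : EEx} (h1 : Qe k E F) (h2 : Qe k E' F') : Qe k (E + E') (F + F') := by
  have := Er.add h1 h2
  rwa [← add_sub_add_comm] at this
lemma Qe.sub {k : ℕ} {E F E' F' : EEx} (h1 : Qe k E F) (h2 : Qe k E' F') : Qe k (E - E') (F - F') := by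
  have := Er.sub h1 h2
  rwa [← sub_sub_sub_comm] at this
lemma Qe.neg {k : ℕ} {E F : EEx} (h1 : Qe k E F) : Qe k (-E) (-F) := by
  have := Er.neg h1
  rwa [neg_sub', sub_neg_eq_add, ← sub_neg_eq_add] at this
lemma Qe.refl (k : ℕ) (E : EEx) : Qe k E E := by
  unfold Qe; rw [sub_self]; exact Er.zero k
lemma Qe.mono {k l : ℕ} (hkl : k ≤ l) {E F : EEx} (h1 : Qe k E F) : Qe l E F := Er.mono hkl h1
lemma Qe.mulSk {k : ℕ} {E F σ : EEx} (h1 : Qe k E F) (hs : Sy σ) (l : ℕ) : Qe (k + l) (σ ^ l * E) (σ ^ l * F) := by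
  have := Er.mulSk h1 hs l
  rwa [mul_sub] at this
lemma Qe.mulc {k : ℕ} {E F : EEx} (h1 : Qe k E F) {c : IX → ℂ} (hc : ∃ C ≥ 0, ∀ i, ‖c i‖ ≤ C) : Qe k (kc c * E) (kc c * F) := by
  have := Er.mulc h1 hc
  rwa [mul_sub] at this
lemma Qe.num {k : ℕ} {E F : EEx} (h1 : Qe k E F) (c : ℕ) : Qe k ((c : EEx) * E) ((c : EEx) * F) :=
  h1.mulc (c := fun _ => (c : ℂ)) ⟨‖(c : ℂ)‖, norm_nonneg _, fun _ => le_rfl⟩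
lemma Qe.sum {ι : Type*} (S : Finset ι) {k : ℕ} {E F : ι → EEx} (h : ∀ j, Qe k (E j) (F j)) : Qe k (∑ j ∈ S, E j) (∑ j ∈ S, F j) := by
  have := Er.sum S h
  rwa [sum_sub_distrib] at this
lemma Qe.of_eq {k : ℕ} {E F : EEx} (h : E = F) : Qe k E F := h ▸ Qe.refl k E
lemma qE2 {m : ℕ} {T : Fam n} (hT : WW a b m T) {f g r : ISm} (hr : TZ 2 r) (he : ∀ i, f i = g i + r i) :
    Qe m (Ph f T) (Ph g T) := by
  have e : f = fun i => g i + r i := funext he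
  unfold Qe
  rw [e, Ph_add hT, add_sub_cancel_left]
  exact E2 hT hr
lemma fv2 (c0 c1 : Sm n) (i : IX) : Fc c0 c1 i = Fv c0 c1 i • (1 : Sm n) + (∑ m, Fv (Dd m c0) (Dd m c1) i • lin m i + rm c0 c1 i) := by
  rw [rm, dl]; abel
lemma fv1 (c0 c1 : Sm n) (i : IX) : Fc c0 c1 i = Fv c0 c1 i • (1 : Sm n) + dl c0 c1 i := by
  rw [dl]; abel
/-- multiplying a first-order window by a coefficient -/
lemma q1c {m : ℕ} {T : Fam n} (hT : WW a b m T) {f : ISm} (hf : TZ 1 f) (c0 c1 : Sm n) :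
    Qe m (Ph (fun i => Fc c0 c1 i * f i) T) (kc Kv * Ph f T) := by
  rw [← Ph_smul hT]
  refine qE2 hT (hf.mul (Tc.dl c0 c1)) fun i => ?_
  rw [fv1 c0 c1 i, add_mul, smul_mul_assoc, one_mul]
variable (a b) in
def UU (ch : ISm) (ε : ℂ) (j : Fin n) : EEx :=
  Ph JC 1 - kc (fun _ => ε) * ∑ m, kc (Fv (Dd m Bv) (Dd m Bw)) * Ph Bt 1
lemma q0c {ch : ISm} (hc : TZ 0 ch) (c0 c1 : Sm n) :
    Qe 0 (Ph BH 1) BL := by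
  have h1 : WW (0 : Sm n) 0 0 (1 : Fam n) := WW.one
  have e : kc Kv * Ph ch 1 + ∑ m, kc (Fv (Dd m c0) (Dd m c1)) * Ph Bt 1 =
      Ph (fun i => Fv c0 c1 i • ch i + ∑ m, Fv (Dd m c0) (Dd m c1) i • (lin m i * ch i)) 1 := by
    rw [Ph_add h1, Ph_smul h1, Ph_sum _ h1]
    congr 1
    exact sum_congr rfl fun m _ => (Ph_smul h1 _ _).symm
  rw [e]
  refine qE2 h1 (hc.mul (Tc.rm c0 c1)) fun i => ?_
  rw [fv2 c0 c1 i]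
  simp only [add_mul, sum_mul, smul_mul_assoc, one_mul]
  abel
lemma qN {ch : ISm} (hc : TZ 0 ch) (ε : ℂ) (j : Fin n) : Qe 0 (Ph (Nn a b ε j ch) 1) (UU a b ch ε j) := by
  have h1 : WW a b 0 (1 : Fam n) := WW.one
  have e : UU a b ch ε j = Ph (fun i => dd Ba j (ch i) - ε • ∑ m, Fv (Dd m Bv) (Dd m Bw) i • (lin m i * ch i)) 1 := by
    rw [Ph_sub h1, UU]
    congr 1
    have := Ph_smul h1 (fun _ => ε) (fun i => ∑ m, Fv (Dd m Bv) (Dd m Bw) i • (lin m i * ch i))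
    rw [this, Ph_sum _ h1]
    congr 1
    exact sum_congr rfl fun m _ => (Ph_smul h1 _ _).symm
  rw [e]
  refine qE2 h1 (TZ.smul (hc.mul (Tc.rm Bv Bw)) (c := fun _ => -ε) ⟨‖-ε‖, norm_nonneg _, fun _ => le_rfl⟩) fun i => ?_
  rw [Nn, rm, sub_mul, sum_mul]
  simp only [smul_mul_assoc, neg_smul, smul_sub]
  abel
lemma qL {ch : ISm} (hc : TZ 0 ch) {ε : ℂ} {j : Fin n} {L : Fam n} (hL : IsL a b ε j L) :
    Qe 4 (Ph ch (L ^ 4)) (sg a b ε j ^ 4 * Ph ch 1 - 4 * sg a b ε j ^ 3 * UU a b ch ε j) := by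
  have h1 : WW a b 0 (1 : Fam n) := WW.one
  have h := E0 hL h1 hc 3
  rw [mul_one] at h
  have h2 : Qe 4 (4 * (sg a b ε j ^ 3 * Ph (Nn a b ε j ch) 1)) (4 * (sg a b ε j ^ 3 * UU a b ch ε j)) :=
    (((qN hc ε j).mulSk (Sy_sg (a := a) (b := b) hL.2.1 j) 3).num 4).mono (by norm_num)
  have h3 : Qe 4 (Ph ch (L ^ 4)) (sg a b ε j ^ 4 * Ph ch 1 - 4 * (sg a b ε j ^ 3 * Ph (Nn a b ε j ch) 1)) := by
    refine (congrArg (Er 4) ?_).mpr h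
    push_cast
    ring
  refine (h3.trans ((Qe.refl 4 _).sub h2)).trans (Qe.of_eq ?_)
  ring
lemma qK {ch : ISm} (hc : TZ 0 ch) (j l : Fin n) (c0 c1 : Sm n) :
    Qe 6 (Ph ch (EY ^ 3 * mulF c0 c1 * EX ^ 3))
      (sg a b 1 l ^ 3 * (sg a b Jb j ^ 3 * BL
        - 3 * sg a b Jb j ^ 2 * (kc Kv * UU a b ch Jb j))
      - 3 * sg a b 1 l ^ 2 * (sg a b Jb j ^ 3 * (kc Kv * UU a b ch 1 l))) := by
  have h1 : WW a b 0 (1 : Fam n) := WW.one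
  have hX := isX (a := a) (b := b) j
  have hY := isY (a := a) (b := b) l
  have sX : Sy (sg a b Jb j : EEx) := Sy_sg hX.2.1 j
  have sY : Sy (sg a b 1 l : EEx) := Sy_sg hY.2.1 l
  have hT : WW a b 3 JD := ((WW.coef c0 c1).mul (WWX j 3)).mono (by norm_num)
  have hfv := Fv_bd (R0 := R0) (R := R) c0 c1
  -- inner expansions
  have hcc : TZ 0 BH := hc.mul (Tc.Fc c0 c1)
  have i1 : Qe 3 (Ph ch JD)
      (sg a b Jb j ^ 3 * BL
        - 3 * (sg a b Jb j ^ 2 * (kc Kv * UU a b ch Jb j))) := by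
    rw [letter_c]
    have h := E0 hX h1 hcc 2
    rw [mul_one] at h
    have h3 : Qe 3 (Ph BH (EX ^ 3)) (sg a b Jb j ^ 3 * Ph BH 1
        - 3 * (sg a b Jb j ^ 2 * Ph (Nn a b Jb j BH) 1)) := by
      refine (congrArg (Er 3) ?_).mpr h
      push_cast
      ring
    have h4 : Qe 3 (sg a b Jb j ^ 3 * Ph BH 1) _ := ((q0c hc c0 c1).mulSk sX 3).mono (by norm_num)
    have h5 : Qe 0 (Ph (Nn a b Jb j BH) 1) (Ph (fun i => Fc c0 c1 i * Nn a b Jb j ch i) 1) := by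
      have hr : TZ 2 (fun i => dd Ba j (Fc c0 c1 i) * ch i) := by
        have e : (fun i : IX => dd Ba j (Fc c0 c1 i)) = fun i => JJ • (JJ • Fc (Dd j c0) (Dd j c1) i) := by
          funext i
          rw [smul_smul]
          change ((i.s ^ 2 : ℝ) : ℂ) • Dd j (c0 + (i.t : ℂ) • c1) = _
          rw [map_add, map_smul]; push_cast; rw [sq]; rfl
        have h6 : Tc 2 (fun i : IX => dd Ba j (Fc c0 c1 i)) := by
          rw [e]; exact ((Tc.Fc (Dd j c0) (Dd j c1)).ssmul).ssmul
        exact hc.mul h6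
      refine qE2 h1 hr fun i => ?_
      rw [Nn, Nn, dd_mul, Algebra.smul_def, Algebra.smul_def]
      ring
    have h6 := (h5.trans (q1c h1 (hc.Nn (a := a) (b := b) Jb j) c0 c1)).trans ((qN hc Jb j).mulc hfv)
    have h7 : Qe 3 _ _ := ((h6.mulSk sX 2).num 3).mono (by norm_num)
    exact h3.trans (h4.sub h7)
  have i2 : Qe 3 (Ph (Nn a b 1 l ch) JD) (sg a b Jb j ^ 3 * (kc Kv * UU a b ch 1 l)) := by
    rw [letter_c]
    have hN : TZ 1 (Nn a b 1 l ch) := hc.Nn 1 l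
    have h := E1 hX h1 (hN.mul (Tc.Fc c0 c1) : TZ (0 + 1) JR) 3
    rw [mul_one, zero_add] at h
    have h4 := (q1c h1 hN c0 c1).trans ((qN hc 1 l).mulc hfv)
    have h' : Qe 3 (Ph JR (EX ^ 3)) (sg a b Jb j ^ 3 * Ph JR 1) := h
    have h5 : Qe 3 _ _ := h'.trans ((h4.mulSk sX 3).mono (by norm_num))
    exact h5
  have h := E0 hY hT hc 2
  have h3 : Qe 6 (Ph ch (EY ^ 3 * mulF c0 c1 * EX ^ 3)) (sg a b 1 l ^ 3 * Ph ch JD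
        - 3 * (sg a b 1 l ^ 2 * Ph (Nn a b 1 l ch) JD)) := by
    rw [mul_assoc]
    refine (congrArg (Er 6) ?_).mpr h
    push_cast
    ring
  have h4 : Qe 6 _ _ := (i1.mulSk sY 3).mono (by norm_num)
  have h5 : Qe 6 _ _ := ((i2.mulSk sY 2).num 3).mono (by norm_num)
  refine (h3.trans (h4.sub h5)).trans (Qe.of_eq ?_)
  push_cast
  ring
end
end
section
section
variable {n : ℕ}
def Sw (F2 : Fin n → FR) (W : Fin n → ℂ) (j : Fin n) : ℂ := ∑ m, (F2 j m : ℂ) * W m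
def jx (V : ℂ) (W : Fin n → ℂ) (m : Fin n) : ℝ := (W m * cJ V).re
def jxi (V : ℂ) (W' : Fin n → ℂ) (m : Fin n) : ℝ := -(W' m * cJ V).im
lemma sw_re (V : ℂ) (F : FR) (W : Fin n → ℂ) :
    ((∑ m, (F m : ℂ) * W m) * cJ V).re = ∑ m, F m * jx V W m := by
  rw [sum_mul, re_sum]
  refine sum_congr rfl fun m _ => ?_
  rw [mul_assoc, re_ofReal_mul]; rfl
lemma om_id (F2 : Fin n → FR) (V : ℂ) (W W' : Fin n → ℂ) (j : Fin n) :
    2 * om F2 (jx V W) (jxi V W') j = I * JE * cJ V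
      + cJ Kd := by
  have h : ∑ m, F2 j m * jx V W m = (Sw F2 W j * cJ V).re := (sw_re V (F2 j) W).symm
  rw [om, h, jxi]
  generalize Sw F2 W j = S
  generalize W' j = U
  apply Complex.ext
  · simp; ring
  · simp; ring
lemma conj_mul_self (V : ℂ) : V * cJ V = ((‖V‖ ^ 2 : ℝ) : ℂ) := by
  rw [Complex.mul_conj']; push_cast; rfl
lemma alg_p (F1 : FR) (F2 : Fin n → FR) (ξ : FR) (V : ℂ) (W W' : Fin n → ℂ) :
    2 * plin F1 F2 ξ (‖V‖ ^ 2) (jx V W) (jxi V W') =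
      (∑ j, ((I * zt F1 ξ j) ^ 4 * V - 4 * (I * zt F1 ξ j) ^ 3 * JE)) * cJ V
      + cJ ((∑ j, ((I * cJ (zt F1 ξ j)) ^ 4 * V - 4 * (I * cJ (zt F1 ξ j)) ^ 3 * (W' j - Sw F2 W j))) * cJ V) := by
  rw [plin, mul_sum, sum_mul, sum_mul, map_sum, ← sum_add_distrib]
  refine sum_congr rfl fun j _ => ?_
  have h := om_id F2 V W W' j
  rw [← conj_mul_self]
  have e : 2 * (zt F1 ξ j ^ 4 * (V * cJ V) + 4 * zt F1 ξ j ^ 3 * om F2 (jx V W) (jxi V W') j) =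
    2 * (zt F1 ξ j ^ 4 * (V * cJ V)) + 4 * zt F1 ξ j ^ 3 * (2 * om F2 (jx V W) (jxi V W') j) := by ring
  rw [e, h]
  simp only [map_mul, map_sub, map_pow, map_add, conj_conj, Complex.conj_I, map_ofNat]
  generalize cJ V = v
  generalize cJ (W' j) = w
  generalize cJ (Sw F2 W j) = t
  have hI3 : I ^ 3 = -I := Complex.I_pow_three
  have hI4 : I ^ 4 = 1 := Complex.I_pow_four
  simp only [mul_pow, hI3, hI4, neg_pow I]
  ring
lemma alg_k (F1 : FR) (F2 : Fin n → FR) (F3 : Fin n → Fin n → FR) (ξ : FR) (V : ℂ) (W W' : Fin n → ℂ)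
    (h2 : ∀ j l, F2 j l = F2 l j) (h3 : ∀ j l m, F3 j l m = F3 l j m) :
    klin F1 F2 F3 ξ (‖V‖ ^ 2) (jx V W) (jxi V W') =
      (Bj * cJ V).re := by
  have hI3 : I ^ 3 = -I := Complex.I_pow_three
  have hI2 : I ^ 2 = -1 := Complex.I_sq
  have e1 : Bj * cJ V
      = (∑ j, ∑ l, Js * ((‖V‖ ^ 2 : ℝ) : ℂ) * Bf)
        + Jq
        + (∑ j, ∑ l, 3 * Js * BG * (I * JE * cJ V))
        + Ja := by
    simp only [← sum_add_distrib, ← sum_neg_distrib, sum_mul]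
    refine sum_congr rfl fun j _ => sum_congr rfl fun l _ => ?_
    rw [← conj_mul_self]
    have e0 : ∑ m, (F3 j l m : ℂ) * W m * cJ V = Bs * cJ V := by rw [sum_mul]
    rw [e0]
    generalize cJ V = v
    generalize Bs = t
    generalize cJ Km = y
    simp only [mul_pow, hI3, hI2]
    linear_combination (y ^ 3 * zt F1 ξ j ^ 3 * (Js * V + t) * v) * (-hI2)
  rw [e1, add_re, add_re, add_re]
  -- the third-derivative sum
  have e2 : (Jq).re
      = ∑ j, ∑ l, (∑ m, F3 j l m * jx V W m) * (Bf).re := by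
    have s1 : 2 * (Jq).re
        = ∑ j, ∑ l, ((Bf * (Bs * cJ V)).re +
          (Ju).re) := by
      simp only [sum_add_distrib, re_sum]
      rw [sum_comm (f := fun j l => (Ju).re)]
      ring
    have s2 : 2 * (Jq).re
        = 2 * ∑ j, ∑ l, (∑ m, F3 j l m * jx V W m) * (Bf).re := by
      rw [s1, mul_sum]
      refine sum_congr rfl fun j _ => ?_
      rw [mul_sum]
      refine sum_congr rfl fun l _ => ?_
      simp only [h3 l j]
      rw [← sw_re]
      have s3 : zt F1 ξ l ^ 3 * cJ (zt F1 ξ j) ^ 3 = cJ Bf := by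
        simp only [map_mul, map_pow, conj_conj]; ring
      rw [s3]
      generalize zt F1 ξ j ^ 3 * cJ Km ^ 3 = z
      generalize Bs * cJ V = t
      simp only [Complex.mul_re, Complex.conj_re, Complex.conj_im]
      ring
    linarith
  have e3 : (Ja).re
      = (∑ j, ∑ l, 3 * Js * BG * cJ Kd).re := by
    rw [sum_comm, ← Complex.conj_re]
    congr 1
    rw [map_sum]
    refine sum_congr rfl fun j _ => ?_
    rw [map_sum]
    refine sum_congr rfl fun l _ => ?_
    rw [h2 l j]
    simp only [map_mul, map_pow, conj_conj, conj_ofReal, map_ofNat]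
    ring
  rw [e2, e3, add_assoc _ (Complex.re _) (Complex.re _), ← add_re (∑ j, ∑ l, 3 * Js * BG * (I * JE * cJ V))]
  simp only [← sum_add_distrib, re_sum]
  rw [klin]
  refine sum_congr rfl fun j _ => sum_congr rfl fun l _ => ?_
  have e4 : 3 * Js * BG * (I * JE * cJ V) +
      3 * Js * BG * cJ Kd
      = ((2 * F2 j l : ℝ) : ℂ) * (3 * zt F1 ξ j ^ 2 * om F2 (jx V W) (jxi V W') j * cJ Km ^ 3) := by
    rw [← mul_add, ← om_id]; push_cast; ring
  rw [e4, re_ofReal_mul, ← ofReal_mul, re_ofReal_mul]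
  ring
lemma j_le (V : ℂ) (W W' : Fin n → ℂ) : ∑ m, jx V W m ^ 2 + ∑ m, jxi V W' m ^ 2 ≤ ‖V‖ ^ 2 * Jl := by
  rw [mul_add, mul_sum, mul_sum]
  refine add_le_add (sum_le_sum fun m _ => ?_) (sum_le_sum fun m _ => ?_)
  · have h := abs_re_le_norm (W m * cJ V)
    rw [norm_mul, norm_conj] at h
    have := sq_le_sq.2 (h.trans (le_abs_self _))
    rw [mul_pow, mul_comm (‖W m‖ ^ 2)] at this
    exact this
  · have h := abs_im_le_norm (W' m * cJ V)
    rw [norm_mul, norm_conj] at h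
    have := sq_le_sq.2 (h.trans (le_abs_self _))
    rw [mul_pow, mul_comm (‖W' m‖ ^ 2)] at this
    rw [jxi, neg_sq]
    exact this
lemma amgm (h x y : ℝ) (hh : 0 < h) : x * y ≤ x ^ 2 / h / 32 + 8 * h * y ^ 2 := by
  have h1 : x ^ 2 / h / 32 + 8 * h * y ^ 2 - x * y = (x - 16 * h * y) ^ 2 / h / 32 := by field_simp; ring
  have : 0 ≤ (x - 16 * h * y) ^ 2 / h / 32 := by positivity
  linarith
lemma amgm2 (h x y : ℝ) (hh : 0 < h) : x * y ≤ (x ^ 2 / h + h * y ^ 2) / 2 := by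
  have h1 : (x ^ 2 / h + h * y ^ 2) / 2 - x * y = (x - h * y) ^ 2 / h / 2 := by field_simp; ring
  have : 0 ≤ (x - h * y) ^ 2 / h / 2 := by positivity
  linarith
lemma pt_comb (w v h t C Mm e1 e2 e3 kl : ℝ) (V A B Kc P Q KK pl : ℂ) (hw : 1 ≤ w) (hv : v ^ 2 = w) (hh : 0 < h) (ht2 : t ^ 2 ≤ h)
    (hC : 0 < C) (hM : 0 ≤ Mm) (he1 : 0 ≤ e1) (he2 : 0 ≤ e2) (he3 : 0 ≤ e3)
    (hA : t / 2 * ‖V‖ ^ 2 - C * w ^ 2 * ‖pl‖ - C * w ^ 4 * (Mm + t ^ 2 * ‖V‖ ^ 2) ≤ kl)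
    (hp : 2 * pl = A * cJ V + cJ (B * cJ V))
    (hk : kl = (Kc * cJ V).re)
    (h1 : ‖P - A‖ ≤ v ^ 4 * e1) (h2 : ‖Q - B‖ ≤ v ^ 4 * e2) (h3 : ‖KK - Kc‖ ≤ v ^ 6 * e3) :
    t / 2 * ‖V‖ ^ 2 ≤ (KK * cJ V).re + (‖P‖ ^ 2 + ‖Q‖ ^ 2) / h / 32
      + BP * (w ^ 4 * Mm + h * (w ^ 4 * ‖V‖ ^ 2) + KB / h) := by
  have v4 : v ^ 4 = w ^ 2 := by rw [← hv]; ring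
  have v6 : v ^ 6 = w ^ 3 := by rw [← hv]; ring
  rw [v4] at h1 h2
  rw [v6] at h3
  obtain ⟨N, hN⟩ : ∃ N, N = ‖V‖ := ⟨_, rfl⟩
  have N0 : 0 ≤ N := hN ▸ norm_nonneg _
  have hpl : ‖pl‖ ≤ (‖P‖ + w ^ 2 * e1 + (‖Q‖ + w ^ 2 * e2)) * N / 2 := by
    have a1 : ‖A‖ ≤ ‖P‖ + w ^ 2 * e1 := by
      have : A = P - (P - A) := by ring
      rw [this]; exact (norm_sub_le _ _).trans (by linarith)
    have a2 : ‖B‖ ≤ ‖Q‖ + w ^ 2 * e2 := by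
      have : B = Q - (Q - B) := by ring
      rw [this]; exact (norm_sub_le _ _).trans (by linarith)
    have a3 : 2 * ‖pl‖ ≤ ‖A‖ * N + ‖B‖ * N := by
      have : 2 * ‖pl‖ = ‖2 * pl‖ := by rw [norm_mul]; norm_num
      rw [this, hp]
      refine (norm_add_le _ _).trans ?_
      rw [norm_conj, norm_mul, norm_mul, norm_conj, hN]
    have a4 := mlr a1 N0
    have a5 := mlr a2 N0
    linarith
  have hkk : kl ≤ (KK * cJ V).re + w ^ 3 * e3 * N := by
    have a1 : kl = (KK * cJ V).re - ((KK - Kc) * cJ V).re := by rw [hk, sub_mul, sub_re]; ring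
    have a2 := abs_re_le_norm ((KK - Kc) * cJ V)
    rw [norm_mul, norm_conj, ← hN] at a2
    have a3 := mlr h3 N0
    have a4 := neg_le_abs ((KK - Kc) * cJ V).re
    linarith
  rw [← hN] at hA ⊢
  generalize (KK * cJ V).re = kr at hkk ⊢
  generalize ‖P‖ = p at hpl ⊢
  generalize ‖Q‖ = q at hpl ⊢
  generalize ‖pl‖ = l at hpl hA
  clear h1 h2 h3 hp hk hN v4 v6 hv
  have w0 : 0 ≤ w := by linarith
  have b0 : C * w ^ 2 * l ≤ C * w ^ 2 * ((p + w ^ 2 * e1 + (q + w ^ 2 * e2)) * N / 2) := mll hpl (by positivity)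
  have b1 := amgm h p (C / 2 * w ^ 2 * N) hh
  have b2 := amgm h q (C / 2 * w ^ 2 * N) hh
  have c0 : 0 ≤ C / 2 * w ^ 4 := by positivity
  have b3 := mll (amgm2 h e1 N hh) c0
  have b4 := mll (amgm2 h e2 N hh) c0
  have b5 := mll (amgm2 h e3 N hh) (by positivity : 0 ≤ w ^ 4)
  have b6 : w ^ 3 * e3 * N ≤ w ^ 4 * (e3 * N) := by
    have : w ^ 3 ≤ w ^ 4 := pow_le_pow_right₀ hw (by norm_num)
    have := mlr this (mul_nonneg he3 N0)
    linarith
  have b7 : C * w ^ 4 * (t ^ 2 * N ^ 2) ≤ C * w ^ 4 * (h * N ^ 2) :=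
    mll (mlr ht2 (sq_nonneg _)) (by positivity)
  have X1 : 0 ≤ w ^ 4 * Mm := by positivity
  have X2 : 0 ≤ h * Ko := by positivity
  have X3 : 0 ≤ w ^ 4 * e1 ^ 2 / h := by positivity
  have X4 : 0 ≤ w ^ 4 * e2 ^ 2 / h := by positivity
  have X5 : 0 ≤ w ^ 4 * e3 ^ 2 / h := by positivity
  have C2 : 0 ≤ C ^ 2 := sq_nonneg C
  have e : BP * (w ^ 4 * Mm + h * Ko + KB / h)
     - (C * (w ^ 4 * Mm) + (4 * C ^ 2 + C / 2 + 1 / 2 + C) * (h * Ko) + C / 4 * (w ^ 4 * e1 ^ 2 / h) + C / 4 * (w ^ 4 * e2 ^ 2 / h) + 1 / 2 * (w ^ 4 * e3 ^ 2 / h))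
     = (4 * C ^ 2 + C + 1) * (w ^ 4 * Mm) + (C / 2 + 1 / 2) * (h * Ko) + Jw * (w ^ 4 * e1 ^ 2 / h)
      + Jw * (w ^ 4 * e2 ^ 2 / h) + (4 * C ^ 2 + 2 * C + 1 / 2) * (w ^ 4 * e3 ^ 2 / h) := by ring
  have e' : 0 ≤ (4 * C ^ 2 + C + 1) * (w ^ 4 * Mm) + (C / 2 + 1 / 2) * (h * Ko) + Jw * (w ^ 4 * e1 ^ 2 / h)
      + Jw * (w ^ 4 * e2 ^ 2 / h) + (4 * C ^ 2 + 2 * C + 1 / 2) * (w ^ 4 * e3 ^ 2 / h) := by positivity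
  rw [← e] at e'
  ring_nf at b0 b1 b2 b3 b4 b5 b6 b7 e' hA hkk ⊢
  linarith
end
end
section
def AffC {n : ℕ} (φ : ER) (K : Set JH) (Λ lam C τ0 : ℝ) : Prop :=
  ∀ τ, 0 < τ → τ ≤ τ0 → ∀ x ∈ K, ∀ (ξ : FR) (N : ℝ) (Jx Jξ : FR) (Mm : ℝ),
      0 ≤ N → 0 ≤ Mm → ∑ j, Jx j ^ 2 + ∑ j, Jξ j ^ 2 ≤ N * Mm →
      τ / 2 * N - C * Bq ^ 2 * ‖plin (fun j => gp j Bg x)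
          (fun j l => gp l Jp x) ξ N Jx Jξ‖
        - C * Bq ^ 4 * (Mm + τ ^ 2 * N) ≤ klin (fun j => gp j Bg x)
          (fun j l => gp l Jp x)
          (fun j l m => gp m (gp l Jp) x) ξ N Jx Jξ
section
variable {n : ℕ} {R0 R : ℝ}
lemma ex_sum {ι : Type*} (S : Finset ι) (E : ι → EEx) (i : IX) (η : Eu n) : (∑ j ∈ S, E j) i η = ∑ j ∈ S, E j i η := by
  rw [Finset.sum_apply, Finset.sum_apply]
section
variable {a b : Sm n}
lemma qP {ch : ISm} (hc : TZ 0 ch) : Qe 4 (Ph ch (PF a b)) (∑ j, (sg a b Jb j ^ 4 * Ph ch 1 - 4 * sg a b Jb j ^ 3 * UU a b ch Jb j)) := by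
  rw [PF, Ph_sumT _ (fun j => WWX (a := a) (b := b) j 4)]
  exact Qe.sum _ fun j => qL hc (isX j)
lemma qQ {ch : ISm} (hc : TZ 0 ch) : Qe 4 (Ph ch (QF a b)) (∑ j, (sg a b 1 j ^ 4 * Ph ch 1 - 4 * sg a b 1 j ^ 3 * UU a b ch 1 j)) := by
  rw [QF, Ph_sumT _ (fun j => WWY (a := a) (b := b) j 4)]
  exact Qe.sum _ fun j => qL hc (isY j)
lemma qKF {ch : ISm} (hc : TZ 0 ch) : Qe 6 (Ph ch (KF a b)) (-∑ j, ∑ l,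
      (sg a b 1 l ^ 3 * (sg a b Jb j ^ 3 * (kc (Fv (Dd l Bv) (Dd l Bw)) * Ph ch 1 + ∑ m, kc (Fv (Dd m (Dd l Bv)) (Dd m (Dd l Bw))) * Ph Bt 1)
        - 3 * sg a b Jb j ^ 2 * (kc (Fv (Dd l Bv) (Dd l Bw)) * UU a b ch Jb j))
      - 3 * sg a b 1 l ^ 2 * (sg a b Jb j ^ 3 * (kc (Fv (Dd l Bv) (Dd l Bw)) * UU a b ch 1 l)))) := by
  have hw : ∀ j l, WW a b 6 Jc := fun j l => ((WWY l 3).mul (WW.coef _ _)).mul (WWX j 3)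
  rw [KF, Ph_negT (WW.sum _ fun j => WW.sum _ fun l => hw j l), Ph_sumT _ (fun j => WW.sum _ fun l => hw j l)]
  refine (Qe.sum _ fun j => ?_).neg
  rw [Ph_sumT _ (fun l => hw j l)]
  exact Qe.sum _ fun l => qK hc j l _ _
end
lemma Fv_cx (f g : ER) (hf : Smo f) (hg : Smo g) (i : IX) : Fv Kr (cx g hg) i = ((f i.x0 + i.t * g i.x0 : ℝ) : ℂ) := by
  rw [Fv_eq]; push_cast; rfl
variable {φ : ER} (hφ : Smo φ) (Λ lam : ℝ)
def aa : Sm n := cx φ hφ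
def bb : Sm n := cx Bb BY
lemma Fv1 (i : IX) (j : Fin n) : Fv (Dd j Bh) (Dd j Bc) i = ((gp j BD i.x0 : ℝ) : ℂ) := by
  rw [aa, bb, Dd_cx, Dd_cx, Fv_cx]
  unfold Fw
  rw [gp_lin _ hφ BY]
lemma gpF2 {φ : ER} (hφ : Smo φ) (Λ lam t : ℝ) (j l : Fin n) : gp l (gp j (Fw Λ lam t φ)) = fun x => gp l Br x + t * gp l Jh x := by
  unfold Fw
  rw [gp_lin _ hφ BY, gp_lin _ BX ((BY).gp j)]
lemma Fv2 (i : IX) (j l : Fin n) : Fv (Dd l (Dd j Bh)) (Dd l (Dd j Bc)) i = ((gp l (gp j BD) i.x0 : ℝ) : ℂ) := by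
  rw [aa, bb, Dd_cx, Dd_cx, Dd_cx, Dd_cx, Fv_cx, gpF2 hφ]
lemma Fv3 (i : IX) (j l m : Fin n) : Fv (Dd m (Dd l (Dd j Bh))) (Dd m (Dd l (Dd j Bc))) i = ((gp m (gp l (gp j BD)) i.x0 : ℝ) : ℂ) := by
  rw [aa, bb, Dd_cx, Dd_cx, Dd_cx, Dd_cx, Dd_cx, Dd_cx, Fv_cx, gpF2 hφ, gp_lin _ ((BX).gp l) (((BY).gp j).gp l)]
lemma sgX (i : IX) (η : Eu n) (j : Fin n) : sg Bh Bc Jb j i η = I * zt (fun j => gp j BD i.x0) (xi Ba η) j := by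
  rw [sg, Fv1, zt, mul_add, ← mul_assoc, mul_right_comm, Complex.I_mul_I]
lemma sgY (i : IX) (η : Eu n) (j : Fin n) : sg Bh Bc 1 j i η = I * cJ (zt (fun j => gp j BD i.x0) (xi Ba η) j) := by
  rw [sg, Fv1, zt, map_add, map_mul, conj_ofReal, conj_ofReal, Complex.conj_I, mul_add]
  linear_combination ((gp j BD i.x0 : ℝ) : ℂ) * Complex.I_sq
lemma UUX (ch : ISm) (i : IX) (η : Eu n) (j : Fin n) : UU Bh Bc ch Jb j i η =
    Ph JC 1 i η + Sw (fun j l => gp l (gp j BD) i.x0) (fun m => Ph Bt 1 i η) j := by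
  change Ph _ 1 i η - Jb * Kp i η = _
  rw [ex_sum, neg_one_mul, sub_neg_eq_add, Sw]
  congr 1
  refine sum_congr rfl fun m _ => ?_
  rw [← Fv2 hφ]; rfl
lemma UUY (ch : ISm) (i : IX) (η : Eu n) (j : Fin n) : UU Bh Bc ch 1 j i η =
    Ph JC 1 i η - Sw (fun j l => gp l (gp j BD) i.x0) (fun m => Ph Bt 1 i η) j := by
  change Ph _ 1 i η - 1 * Kp i η = _
  rw [ex_sum, one_mul, Sw]
  congr 1
  refine sum_congr rfl fun m _ => ?_
  rw [← Fv2 hφ]; rfl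
/-- pointwise estimate on the Fourier side -/
lemma pt_est {K : Set JH} {C τ0 : ℝ} (hC : 0 < C) (H : AffC φ K Λ lam C τ0) {ch : ISm} (hc : TZ 0 ch) :
    ∃ e1 e2 e3 : IX → ER, Bd e1 ∧ Bd e2 ∧ Bd e3 ∧ ∀ i η, i.x0 ∈ K → 0 < i.t → i.t ≤ τ0 → i.t ^ 2 ≤ i.s ^ 2 →
      i.t / 2 * ‖Ph ch 1 i η‖ ^ 2 ≤ (Ph ch (KF Bh Bc) i η * cJ (Ph ch 1 i η)).re
        + (‖Ph ch (PF Bh Bc) i η‖ ^ 2 + ‖Ph ch (QF Bh Bc) i η‖ ^ 2) / i.s ^ 2 / 32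
        + BP * (wt Ba η ^ 4 * (∑ m, ‖Ph Bt 1 i η‖ ^ 2 + ∑ j, ‖Ph JC 1 i η‖ ^ 2)
          + i.s ^ 2 * (wt Ba η ^ 4 * ‖Ph ch 1 i η‖ ^ 2)
          + (wt Ba η ^ 4 * e1 i η ^ 2 + wt Ba η ^ 4 * e2 i η ^ 2 + wt Ba η ^ 4 * e3 i η ^ 2) / i.s ^ 2) := by
  obtain ⟨e1, B1, h1⟩ := qP (a := aa hφ) (b := bb hφ Λ lam) hc
  obtain ⟨e2, B2, h2⟩ := qQ (a := aa hφ) (b := bb hφ Λ lam) hc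
  obtain ⟨e3, B3, h3⟩ := qKF (a := aa hφ) (b := bb hφ Λ lam) hc
  refine ⟨e1, e2, e3, B1, B2, B3, fun i η hx t0 t1 t2 => ?_⟩
  obtain ⟨W, hW⟩ : ∃ W : Fin n → ℂ, W = fun m => Ph Bt 1 i η := ⟨_, rfl⟩
  obtain ⟨W', hW'⟩ : ∃ W : Fin n → ℂ, W = fun j => Ph JC 1 i η := ⟨_, rfl⟩
  have hh := H i.t t0 t1 i.x0 hx (xi Ba η) (‖Ph ch 1 i η‖ ^ 2) (jx (Ph ch 1 i η) W) (jxi (Ph ch 1 i η) W')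
    Jl (sq_nonneg _) (by positivity) (j_le _ _ _)
  have hFs : ∀ j l, gp l (gp j BD) = gp j (gp l BD) := fun j l => gp_comm (smo_Fw Λ lam i.t hφ) l j
  have := pt_comb (wt Ba η) (vv i η) Ba i.t C Jl (e1 i η) (e2 i η) (e3 i η) _ (Ph ch 1 i η)
    _ _ _ (Ph ch (PF Bh Bc) i η) (Ph ch (QF Bh Bc) i η) (Ph ch (KF Bh Bc) i η) _
    (one_le_wt _ η) (vv_sq i η) (pow_pos i.s0 2) t2 hC (by positivity) (B1.2.1 i η) (B2.2.1 i η) (B3.2.1 i η) hh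
    (alg_p _ _ _ _ _ _) (alg_k _ _ _ _ _ _ _ (fun j l => by rw [hFs j l]) (fun j l m => by rw [hFs j l])) ?_ ?_ ?_
  · rw [hW, hW'] at this; exact this
  · refine le_of_eq_of_le ?_ (h1 i η)
    congr 1
    change _ = Ph ch (PF Bh Bc) i η - (∑ j, _ : EEx) i η
    rw [ex_sum]
    congr 1
    refine sum_congr rfl fun j _ => ?_
    rw [← sgX hφ, hW, hW', ← UUX hφ]; rfl
  · refine le_of_eq_of_le ?_ (h2 i η)
    congr 1
    change _ = Ph ch (QF Bh Bc) i η - (∑ j, _ : EEx) i η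
    rw [ex_sum]
    congr 1
    refine sum_congr rfl fun j _ => ?_
    rw [← sgY hφ, hW, hW', ← UUY hφ]; rfl
  · refine le_of_eq_of_le ?_ (h3 i η)
    congr 1
    change _ = Ph ch (KF Bh Bc) i η - -(∑ j, _ : EEx) i η
    rw [ex_sum]
    congr 1
    congr 1
    refine sum_congr rfl fun j _ => ?_
    rw [ex_sum]
    refine sum_congr rfl fun l _ => ?_
    have e3 : (∑ m, (((gp m (gp l (gp j BD)) i.x0 : ℝ) : ℂ)) * W m) = (∑ m, kc (Fv (Dd m (Dd l (Dd j Bh))) (Dd m (Dd l (Dd j Bc)))) * Ph Bt 1 : EEx) i η := by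
      rw [ex_sum, hW]
      refine sum_congr rfl fun m _ => ?_
      rw [← Fv3 hφ]; rfl
    rw [e3, ← sgX hφ, ← sgY hφ, hW, hW', ← UUX hφ, ← UUY hφ, ← Fv2 hφ]; rfl
end
end
section
section
variable {n : ℕ}
def HI (f : ER) (A : ℝ) : Prop := Integrable f ∧ ∫ η, f η = A
lemma HI.add {f g : ER} {A B : ℝ} (hf : HI f A) (hg : HI g B) : HI (fun η => f η + g η) (A + B) :=
  ⟨hf.1.add hg.1, by rw [integral_add hf.1 hg.1, hf.2, hg.2]⟩
lemma HI.cm {f : ER} {A : ℝ} (hf : HI f A) (c : ℝ) : HI (fun η => c * f η) (c * A) :=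
  ⟨hf.1.const_mul c, by rw [integral_const_mul, hf.2]⟩
lemma HI.dv {f : ER} {A : ℝ} (hf : HI f A) (c : ℝ) : HI (fun η => f η / c) (A / c) :=
  ⟨hf.1.div_const c, by rw [integral_div, hf.2]⟩
lemma HI.sum {ι : Type*} {S : Finset ι} {f : ι → ER} {A : ι → ℝ} (hf : ∀ j, HI (f j) (A j)) : HI (fun η => ∑ j ∈ S, f j η) (∑ j ∈ S, A j) :=
  ⟨integrable_finsetSum _ fun j _ => (hf j).1, by
    rw [integral_finsetSum _ fun j _ => (hf j).1]; exact sum_congr rfl fun j _ => (hf j).2⟩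
lemma HI.le {f g : ER} {A B : ℝ} (hf : HI f A) (hg : HI g B) (h : ∀ η, f η ≤ g η) : A ≤ B := by
  rw [← hf.2, ← hg.2]; exact integral_mono hf.1 hg.1 h
lemma HI.congr {f g : ER} {A : ℝ} (hf : HI f A) (h : ∀ η, g η = f η) : HI g A := by
  have : g = f := funext h
  rwa [this]
variable {R0 R : ℝ} {φ : ER} (hφ : Smo φ) (Λ lam : ℝ)
lemma local_est {K : Set JH} {C τ0 : ℝ} (hC : 0 < C) (H : AffC φ K Λ lam C τ0) {ch : ISm} (hc : TZ 0 ch) :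
    ∃ D ≥ 0, ∀ i : IX, i.x0 ∈ K → 0 < i.t → i.t ≤ τ0 → i.t ^ 2 ≤ i.s ^ 2 →
      i.t / 2 * Mk Ba 0 (ch i * i.u) ≤ (ip Kx (ch i * i.u)).re
        + (Mk Ba 0 (ch i * PF Bh Bc Ba i.t i.u) + Mk Ba 0 (ch i * QF Bh Bc Ba i.t i.u)) / i.s ^ 2 / 32
        + D * i.s ^ 2 * Lm i := by
  obtain ⟨e1, e2, e3, ⟨-, -, i1, c1, c10, b1⟩, ⟨-, -, i2, c2, c20, b2⟩, ⟨-, -, i3, c3, c30, b3⟩, hp⟩ := pt_est hφ Λ lam hC H hc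
  obtain ⟨d0, d00, hd0⟩ := hc.bd
  have hl : ∀ m, ∃ C ≥ 0, ∀ i : IX, Mk Ba 4 (lin m i * ch i * i.u) ≤ C * i.s ^ (2 * (1 + 0)) * Lm i := fun m => (hc.mul (Tc.lin m)).bd
  have hd : ∀ m, ∃ C ≥ 0, ∀ i : IX, Mk Ba 4 (dd Ba m (ch i) * i.u) ≤ C * i.s ^ (2 * (0 + 1)) * Lm i := fun m => (hc.dd m).bd
  choose cl cl0 hl using hl
  choose cd cd0 hd using hd
  have scl : 0 ≤ ∑ m, cl m := sum_nonneg fun m _ => cl0 m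
  have scd : 0 ≤ ∑ m, cd m := sum_nonneg fun m _ => cd0 m
  refine ⟨BP * (∑ m, cl m + ∑ m, cd m + d0 + (c1 + c2 + c3)), by positivity, fun i hx t0 t1 t2 => ?_⟩
  have s2 : 0 < i.s ^ 2 := pow_pos i.s0 2
  have M0 : ∀ {v : Sm n}, Sup R v → HI (fun η => ‖ft v η‖ ^ 2) (Mk Ba 0 v) := fun hv => by
    have := Mk_ft Ba 0 hv
    simp only [pow_zero, one_mul] at this
    exact this
  have M4 : ∀ {v : Sm n}, Sup R v → HI (fun η => wt Ba η ^ 4 * ‖ft v η‖ ^ 2) (Mk Ba 4 v) := fun hv => Mk_ft Ba 4 hv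
  have hP : Sup R (PF Bh Bc Ba i.t i.u) := WW_PF.sup i.pr i.hu
  have hQ : Sup R (QF Bh Bc Ba i.t i.u) := WW_QF.sup i.pr i.hu
  have hK : Sup R (KF Bh Bc Ba i.t i.u) := WW_KF.sup i.pr i.hu
  have L1 := (M0 (i.hu.mul (ch i))).cm (i.t / 2)
  have hip := ip_ft (hK.mul (ch i)) (i.hu.mul (ch i))
  have A1 : HI (fun η => (ft Kx η * cJ (ft (ch i * i.u) η)).re)
      (ip Kx (ch i * i.u)).re := by
    refine ⟨hip.1.re, ?_⟩
    rw [← hip.2]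
    exact Complex.reCLM.integral_comp_comm hip.1
  have A2 := (((M0 (hP.mul (ch i))).add (M0 (hQ.mul (ch i)))).dv Ba).dv 32
  have A3 : HI (fun η => wt Ba η ^ 4 * (∑ m, ‖ft (lin m i * ch i * i.u) η‖ ^ 2 + ∑ m, ‖ft (dd Ba m (ch i) * i.u) η‖ ^ 2)) _ :=
    ((HI.sum (S := Finset.univ) fun m => M4 (i.hu.mul (lin m i * ch i))).add (HI.sum (S := Finset.univ) fun m => M4 (i.hu.mul (dd Ba m (ch i))))).congr
      fun η => by rw [mul_add, mul_sum, mul_sum]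
  have A4 := (M4 (i.hu.mul (ch i))).cm Ba
  have hi1 : HI _ _ := ⟨i1 i, rfl⟩
  have hi2 : HI _ _ := ⟨i2 i, rfl⟩
  have hi3 : HI _ _ := ⟨i3 i, rfl⟩
  have A5 := ((hi1.add hi2).add hi3).dv Ba
  have fin := L1.le ((A1.add A2).add (((A3.add A4).add A5).cm BP)) (fun η => hp i η hx t0 t1 t2)
  refine fin.trans (add_le_add le_rfl ?_)
  have e : BP * (∑ m, cl m + ∑ m, cd m + d0 + (c1 + c2 + c3)) * i.s ^ 2 * Lm i =
    BP * ((∑ m, cl m * i.s ^ (2 * (1 + 0)) * Lm i + ∑ m, cd m * i.s ^ (2 * (0 + 1)) * Lm i) + i.s ^ 2 * (d0 * i.s ^ (2 * 0) * Lm i)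
      + (c1 * i.s ^ 4 * Lm i + c2 * i.s ^ 4 * Lm i + c3 * i.s ^ 4 * Lm i) / i.s ^ 2) := by
    simp only [← sum_mul]
    have := i.s0
    field_simp
    ring
  rw [e]
  refine mll ?_ (by positivity)
  refine add_le_add (add_le_add (add_le_add (sum_le_sum fun m _ => hl m i) (sum_le_sum fun m _ => hd m i)) (mll (hd0 i) s2.le)) ?_
  exact div_le_div_of_nonneg_right (add_le_add (add_le_add (b1 i) (b2 i)) (b3 i)) s2.le
end
end
section
section
variable {n : ℕ}
def TT (κ : ER) (s : ℝ) (F : ER) (x0 : Eu n) : ℝ := ∫ y, F y * κ Bm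
lemma TT_HI {κ : ER} (hκ : Integrable κ) {s : ℝ} (hs : 0 < s) {F : ER} (hF : Integrable F) :
    HI (TT κ s F) ((∫ y, F y) * (s ^ (Module.finrank ℝ JH) * ∫ z, κ z)) := by
  obtain ⟨k, hk⟩ : ∃ k : ER, k = fun z => κ (s⁻¹ • (-z)) := ⟨_, rfl⟩
  have hk0 : Integrable (fun z => κ (s⁻¹ • z)) := hκ.comp_smul (inv_ne_zero hs.ne')
  have hk1 : Integrable k := by rw [hk]; exact hk0.comp_neg
  have hk2 : ∫ z, k z = s ^ (Module.finrank ℝ JH) * ∫ z, κ z := by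
    rw [hk, integral_neg_eq_self (fun z => κ (s⁻¹ • z)), Measure.integral_comp_inv_smul_of_nonneg _ _ hs.le, smul_eq_mul]
  have e : TT κ s F = convolution F k (ContinuousLinearMap.mul ℝ ℝ) volume := by
    funext x
    rw [convolution_def, TT, hk]
    refine integral_congr_ae (of_forall fun y => ?_)
    simp
  rw [e, ← hk2]
  exact ⟨hF.integrable_convolution _ hk1, integral_convolution _ hF hk1⟩
lemma G0 (h : ℝ) (u : Sm n) (y : Eu n) : G h 0 u y = ‖u.1 y‖ ^ 2 := rfl
lemma exists_chi : ∃ χ : Sm n, Sup 1 χ ∧ 0 < ∫ z, ‖χ.1 z‖ ^ 2 := by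
  let f : ContDiffBump (0 : Eu n) := ⟨1 / 2, 1, by norm_num, by norm_num⟩
  have hf : Smo (fun x => f x) := f.contDiff
  have hz : ∀ y : Eu n, 1 < ‖y‖ → f y = 0 := fun y hy => f.zero_of_le_dist (by rw [dist_zero_right]; exact hy.le)
  have hS : Sup 1 (cx _ hf) := fun y hy => by
    change ((f y : ℝ) : ℂ) = 0
    rw [hz y hy]; simp
  refine ⟨cx _ hf, hS, ?_⟩
  have hc : Continuous fun z => ‖(cx _ hf).1 z‖ ^ 2 := (smo (cx _ hf)).continuous.norm.pow 2
  refine hc.integral_pos_of_hasCompactSupport_nonneg_nonzero (x := 0) (hcs_of (R := 1) fun y hy => by rw [hS y hy]; simp) (fun z => sq_nonneg _) ?_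
  have : (cx _ hf).1 0 = ((f 0 : ℝ) : ℂ) := rfl
  rw [this, f.one_of_mem_closedBall (by simp [f.rIn_pos.le])]
  simp
variable {φ : ER} (hφ : Smo φ) (Λ lam : ℝ)
lemma global_est {K : Set JH} {C τ0 R0 : ℝ} (hC : 0 < C) (H : AffC φ K Λ lam C τ0) (hK : ∀ x ∈ K, ‖x‖ ≤ R0) (R : ℝ) :
    ∃ D ≥ 0, ∀ (s t : ℝ) (u : Sm n), 0 < s → s ≤ 1 → 0 < t → t ≤ τ0 → t ≤ 1 → t ^ 2 ≤ s ^ 2 → Sup R u →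
      (∀ x0 y, u.1 y ≠ 0 → ‖y - x0‖ ≤ s → x0 ∈ K) →
      t / 2 * Mk BB 0 u ≤ (ip (KF Bh Bc BB t u) u).re
        + (Mk BB 0 (PF Bh Bc BB t u) + Mk BB 0 (QF Bh Bc BB t u)) / s ^ 2 / 32
        + D * s ^ 2 * Mk BB 4 u := by
  obtain ⟨χ, hχ, hχp⟩ := exists_chi (n := n)
  obtain ⟨D, hD, hloc⟩ := local_est (R0 := R0) (R := R) hφ Λ lam hC H (TZ.sc hχ)
  obtain ⟨κ, hκ⟩ : ∃ κ : ER, κ = fun z => ‖χ.1 z‖ ^ 2 := ⟨_, rfl⟩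
  obtain ⟨β, hβ⟩ : ∃ β : ER, β = (Metric.closedBall (0 : Eu n) 1).indicator (fun _ => (1 : ℝ)) := ⟨_, rfl⟩
  have κi : Integrable κ := by
    rw [hκ]; exact int_of (R := 1) ((smo χ).continuous.norm.pow 2) fun y hy => by rw [hχ y hy]; simp
  have βi : Integrable β := by
    rw [hβ, integrable_indicator_iff Metric.isClosed_closedBall.measurableSet]
    exact integrableOn_const (isCompact_closedBall _ _).measure_lt_top.ne
  have κ0 : ∀ z, 0 ≤ κ z := fun z => by rw [hκ]; positivity
  have β0 : ∀ z, 0 ≤ β z := fun z => by rw [hβ]; exact indicator_nonneg (fun _ _ => zero_le_one) z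
  obtain ⟨cκ, hcκ⟩ : ∃ c, c = ∫ z, κ z := ⟨_, rfl⟩
  obtain ⟨cβ, hcβ⟩ : ∃ c, c = ∫ z, β z := ⟨_, rfl⟩
  have cκp : 0 < cκ := by rw [hcκ, hκ]; exact hχp
  have cβp : 0 ≤ cβ := by rw [hcβ]; exact integral_nonneg β0
  refine ⟨D * cβ / cκ, by positivity, fun s t u s0 s1 t0 t1 t1' t2 hu hsp => ?_⟩
  have pr : Pr BB t := ⟨by positivity, pow_le_one₀ s0.le s1, t0.le, t1'⟩
  obtain ⟨P, hP⟩ : ∃ P, P = PF Bh Bc BB t u := ⟨_, rfl⟩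
  obtain ⟨Q, hQ⟩ : ∃ P, P = QF Bh Bc BB t u := ⟨_, rfl⟩
  obtain ⟨k, hk⟩ : ∃ P, P = KF Bh Bc BB t u := ⟨_, rfl⟩
  have sP : Sup R P := hP ▸ WW_PF.sup pr hu
  have sQ : Sup R Q := hQ ▸ WW_QF.sup pr hu
  have sk : Sup R k := hk ▸ WW_KF.sup pr hu
  rw [← hP, ← hQ, ← hk]
  have iG : ∀ {v : Sm n}, Sup R v → Integrable (fun y => ‖v.1 y‖ ^ 2) := fun hv => hv.intG 0 0
  have iK : Integrable (fun y => k.1 y * cJ (u.1 y)) := ip_int sk u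
  have A1 := (TT_HI κi s0 (iG hu)).cm (t / 2)
  have A2 := TT_HI κi s0 iK.re
  have A3 := (((TT_HI κi s0 (iG sP)).add (TT_HI κi s0 (iG sQ))).dv BB).dv 32
  have A4 := (TT_HI βi s0 (hu.intG BB 4)).cm (D * s ^ 2)
  have key : ∀ x0, t / 2 * TT κ s (fun y => ‖u.1 y‖ ^ 2) x0 ≤ TT κ s (fun y => RCLike.re BZ) x0
      + (TT κ s (fun y => ‖P.1 y‖ ^ 2) x0 + TT κ s (fun y => ‖Q.1 y‖ ^ 2) x0) / s ^ 2 / 32 + D * s ^ 2 * TT β s (G BB 4 u) x0 := by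
    intro x0
    by_cases hx : x0 ∈ K
    · let i : IX := ⟨x0, s, t, u, hK x0 hx, s0, s1, t0.le, t1', hu⟩
      have h := hloc i hx t0 t1 t2
      have e1 : ∀ v : Sm n, Mk BB 0 (sc χ i * v) = TT κ s (fun y => ‖v.1 y‖ ^ 2) x0 := fun v => by
        unfold Mk TT
        refine integral_congr_ae (of_forall fun y => ?_)
        change ‖χ.1 Bm * v.1 y‖ ^ 2 = ‖v.1 y‖ ^ 2 * κ Bm
        rw [hκ, norm_mul, mul_pow, mul_comm]
      have e2 : (Kk).re = TT κ s (fun y => RCLike.re BZ) x0 := by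
        have hi := ip_int (sk.mul (sc χ i)) (sc χ i * u)
        have : (Kk).re = ∫ y, ((sc χ i * k).1 y * cJ ((sc χ i * u).1 y)).re :=
          (Complex.reCLM.integral_comp_comm hi).symm
        rw [this]
        unfold TT
        refine integral_congr_ae (of_forall fun y => ?_)
        change (χ.1 Bm * k.1 y * cJ (χ.1 Bm * u.1 y)).re = (BZ).re * κ Bm
        rw [hκ, map_mul]
        have : χ.1 Bm * k.1 y * (cJ (χ.1 Bm) * cJ (u.1 y)) =
          (χ.1 Bm * cJ (χ.1 Bm)) * BZ := by ring
        rw [this, conj_mul_self, re_ofReal_mul, mul_comm]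
      have e3 : Lm i = TT β s (G BB 4 u) x0 := by
        unfold Lm TT
        rw [← integral_indicator Metric.isClosed_closedBall.measurableSet]
        refine integral_congr_ae (of_forall fun y => ?_)
        change (Metric.closedBall x0 s).indicator (fun y => G BB 4 u y) y = G BB 4 u y * β Bm
        have hm : s⁻¹ • (y - x0) ∈ Metric.closedBall (0 : Eu n) 1 ↔ y ∈ Metric.closedBall x0 s := by
          rw [mem_closedBall_zero_iff, norm_smul, norm_inv, norm_of_nonneg s0.le, mem_closedBall_iff_norm, inv_mul_le_iff₀ s0, mul_one]
        rw [hβ]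
        by_cases hy : y ∈ Metric.closedBall x0 s
        · rw [indicator_of_mem hy, indicator_of_mem (hm.2 hy), mul_one]
        · rw [indicator_of_notMem hy, indicator_of_notMem (fun h => hy (hm.1 h)), mul_zero]
      have h' : t / 2 * Mk BB 0 (sc χ i * u) ≤ (Kk).re
        + (Mk BB 0 (sc χ i * P) + Mk BB 0 (sc χ i * Q)) / s ^ 2 / 32
        + D * s ^ 2 * Lm i := by rw [hk, hP, hQ]; exact h
      rw [e1, e1, e1, e2, e3] at h'
      exact h'
    · have hz : ∀ y, u.1 y = 0 ∨ κ Bm = 0 := fun y => by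
        by_contra hcon
        push Not at hcon
        have h1 : ¬ (‖y - x0‖ ≤ s) := fun h => hx (hsp x0 y hcon.1 h)
        push Not at h1
        have : χ.1 Bm = 0 := hχ _ (by
          rw [norm_smul, norm_inv, norm_of_nonneg s0.le, lt_inv_mul_iff₀ s0, mul_one]; exact h1)
        apply hcon.2
        rw [hκ]; simp [this]
      have z1 : TT κ s (fun y => ‖u.1 y‖ ^ 2) x0 = 0 := by
        unfold TT
        refine integral_eq_zero_of_ae (of_forall fun y => ?_)
        rcases hz y with h | h <;> simp [h]
      have z2 : TT κ s (fun y => RCLike.re BZ) x0 = 0 := by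
        unfold TT
        refine integral_eq_zero_of_ae (of_forall fun y => ?_)
        rcases hz y with h | h <;> simp [h]
      have z3 : ∀ v : Sm n, 0 ≤ TT κ s (fun y => ‖v.1 y‖ ^ 2) x0 := fun v => integral_nonneg fun y => mul_nonneg (sq_nonneg _) (κ0 _)
      have z4 : 0 ≤ TT β s (G BB 4 u) x0 := integral_nonneg fun y => mul_nonneg (G_nonneg _ _ _ _) (β0 _)
      have := z3 P
      have := z3 Q
      rw [z1, z2]
      rw [mul_zero, zero_add]
      positivity
  have fin := A1.le ((A2.add A3).add A4) key
  have e2 : ∫ y, RCLike.re BZ = (ip k u).re := Complex.reCLM.integral_comp_comm iK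
  rw [e2, ← hcκ, ← hcβ] at fin
  change t / 2 * (Mk BB 0 u * _) ≤ (ip k u).re * _ + (Mk BB 0 P * _ + Mk BB 0 Q * _) / s ^ 2 / 32 + D * s ^ 2 * (Mk BB 4 u * _) at fin
  have σp : 0 < s ^ (Module.finrank ℝ JH) * cκ := by positivity
  refine le_of_mul_le_mul_right ?_ σp
  refine (le_of_eq ?_).trans (fin.trans (le_of_eq ?_))
  · ring
  · field_simp
end
end
section
section
variable {n : ℕ} {φ : ER} (hφ : Smo φ) (Λ lam : ℝ)
lemma cj_cx (f : ER) (hf : Smo f) : cj Kr = cx f hf :=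
  Subtype.ext (funext fun y => conj_ofReal (f y))
lemma alg_u {h t L m0 m1 m4 p q k D C1 C2 B : ℝ} (h0 : 0 < h) (h1 : h ≤ 1) (hB : B = KA * C2) (hD : 0 ≤ D)
    (hC1 : 0 ≤ C1) (hC2 : 0 ≤ C2) (hL : L = (B + 1) / 16) (ht : t = h * L) (p0 : 0 ≤ p) (m00 : 0 ≤ m0)
    (a1 : t / 2 * m0 ≤ k + (p + q) / h / 32 + D * h * m4) (a2 : 32 * h * k ≤ p - q + C1 * h ^ 2 * m4)
    (a3 : m4 ≤ C2 * (p + m0)) (a4 : m1 ≤ m4) : h ^ 2 * m1 ≤ C2 * (3 + B) * p := by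
  have b1 : 32 * h * (t / 2 * m0) ≤ 32 * h * (k + (p + q) / h / 32 + D * h * m4) := mll a1 (by positivity)
  have b2 : 32 * h * (k + (p + q) / h / 32 + D * h * m4) = 32 * h * k + (p + q) + 32 * D * h ^ 2 * m4 := by field_simp
  have b3 : KA * h ^ 2 * m4 ≤ KA * h ^ 2 * (C2 * (p + m0)) := mll a3 (by positivity)
  have B0 : 0 ≤ B := by rw [hB]; positivity
  have hh : h ^ 2 ≤ 1 := by nlinarith
  have b4 : B * h ^ 2 * p ≤ B * p := by
    have := mll hh (mul_nonneg B0 p0); nlinarith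
  have e1 : KA * h ^ 2 * (C2 * (p + m0)) = B * h ^ 2 * p + B * h ^ 2 * m0 := by rw [hB]; ring
  have e2 : 32 * h * (t / 2 * m0) = B * h ^ 2 * m0 + h ^ 2 * m0 := by rw [ht, hL]; ring
  have b5 : h ^ 2 * m0 ≤ 2 * p + B * p := by linarith
  have b6 : h ^ 2 * p ≤ p := by nlinarith
  have b7 : h ^ 2 * m1 ≤ h ^ 2 * (C2 * (p + m0)) := mll (a4.trans a3) (by positivity)
  have b8 : C2 * (h ^ 2 * p + h ^ 2 * m0) ≤ C2 * (p + (2 * p + B * p)) := mll (by linarith) hC2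
  linarith
lemma carl_u {K : Set JH} {C τ0 R0 : ℝ} (hC : 0 < C) (hτ0 : 0 < τ0) (H : AffC φ K Λ lam C τ0) (hK : ∀ x ∈ K, ‖x‖ ≤ R0) (R : ℝ) :
    ∃ L : ℝ, ∃ h0 > 0, h0 ≤ 1 ∧ ∃ E ≥ 0, ∀ h, 0 < h → h < h0 → ∀ u : Sm n, Sup R u →
      Kl →
      h ^ 2 * Mk h 1 u ≤ E * Mk h 0 (PF Bh Bc h (h * L) u) := by
  obtain ⟨D, hD, hg⟩ := global_est hφ Λ lam hC H hK R
  obtain ⟨C1, hC1, hm⟩ := main_comm (a := aa hφ) (b := bb hφ Λ lam) (cj_cx _ _) (cj_cx _ _) R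
  obtain ⟨C2, hC2, he⟩ := elliptic Bh Bc R
  obtain ⟨B, hB⟩ : ∃ B, B = KA * C2 := ⟨_, rfl⟩
  have B0 : 0 ≤ B := by rw [hB]; positivity
  obtain ⟨L, hL⟩ : ∃ L, L = (B + 1) / 16 := ⟨_, rfl⟩
  have L0 : 0 < L := by rw [hL]; positivity
  refine ⟨L, min 1 (min (τ0 / L) (min (1 / L) (1 / L ^ 2))), by positivity, min_le_left _ _, C2 * (3 + B), by positivity, ?_⟩
  intro h h0 hh u hu hs
  simp only [lt_min_iff] at hh
  obtain ⟨h1, h2, h3, h4⟩ := hh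
  rw [lt_div_iff₀ (by positivity)] at h2 h3 h4
  have s2 : √h ^ 2 = h := sq_sqrt h0.le
  have t0 : 0 < h * L := by positivity
  have pr : Pr h (h * L) := ⟨h0, h1.le, t0.le, h3.le⟩
  have a1 := hg (√h) (h * L) u (Real.sqrt_pos.2 h0) (Real.sqrt_le_one.2 h1.le) t0 h2.le h3.le
    (by rw [s2]; have := mll h4.le h0.le; nlinarith) hu hs
  rw [s2] at a1
  exact alg_u h0 h1.le hB hD hC1 hC2 hL rfl (Mk_nonneg _ _ _) (Mk_nonneg _ _ _) a1 (hm h _ pr u hu) (he h _ pr u hu)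
    (Mk_mono h (by norm_num) hu)
def exS (f : ER) (hf : Smo f) (L : ℝ) : Sm n :=
  cx JU (contDiff_exp.comp (contDiff_const.mul hf))
lemma Dd_exS (f : ER) (hf : Smo f) (L : ℝ) (j : Fin n) : Dd j (exS f hf L) = (L : ℂ) • (Dd j Kr * exS f hf L) := by
  unfold exS
  rw [Dd_cx, Dd_cx]
  refine Subtype.ext (funext fun y => ?_)
  have h1 : HasFDerivAt JU (Real.exp (L * f y) • (L • fderiv ℝ f y)) y :=
    ((hf.diff y).hasFDerivAt.const_mul L).exp
  have : gp j JU y = L * (gp j f y * Real.exp (L * f y)) := by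
    simp only [gp, h1.fderiv, ContinuousLinearMap.smul_apply, smul_eq_mul]; ring
  change ((gp j JU y : ℝ) : ℂ) = (L : ℂ) * (((gp j f y : ℝ) : ℂ) * ((Real.exp (L * f y) : ℝ) : ℂ))
  rw [this]; push_cast; ring
lemma exS_mul (f : ER) (hf : Smo f) (L : ℝ) (u : Sm n) : exS f hf (-L) * (exS f hf L * u) = u := by
  refine Subtype.ext (funext fun y => ?_)
  change ((Real.exp (-L * f y) : ℝ) : ℂ) * (((Real.exp (L * f y) : ℝ) : ℂ) * u.1 y) = u.1 y
  rw [← mul_assoc, ← ofReal_mul, ← exp_add]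
  simp
lemma X_conj (a : Sm n) (f : ER) (hf : Smo f) (L h : ℝ) (j : Fin n) (v : Sm n) :
    EF a Kr (.X j) h (h * L) (exS f hf L * v) = exS f hf L * EF a Kr (.X j) h 0 v := by
  simp only [EF, fam_sub, dF_app, mulF_app, dd_mul]
  have : dd h j (exS f hf L) = ((h * L : ℝ) : ℂ) • (Dd j Kr * exS f hf L) := by
    change Be • Dd j (exS f hf L) = _
    rw [Dd_exS, smul_smul]; push_cast; rfl
  rw [this]
  simp only [Algebra.smul_def, Complex.ofReal_zero, map_zero]
  ring
lemma PF_conj (a : Sm n) (f : ER) (hf : Smo f) (L h : ℝ) (v : Sm n) :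
    PF a Kr h (h * L) (exS f hf L * v) = exS f hf L * PF a Kr h 0 v := by
  simp only [PF, fam_sum, pow_succ, pow_zero, one_mul, fam_mul, X_conj, mul_sum]
lemma carl_w {K : Set JH} {C τ0 R0 : ℝ} (hC : 0 < C) (hτ0 : 0 < τ0) (H : AffC φ K Λ lam C τ0) (hK : ∀ x ∈ K, ‖x‖ ≤ R0) (R : ℝ) :
    ∃ h0 > 0, h0 ≤ 1 ∧ ∃ E ≥ 0, ∀ h, 0 < h → h < h0 → ∀ u : Sm n, Sup R u →
      Kl →
      h ^ 2 * Mk h 1 u ≤ E * Mk h 0 (PF Bh Bc h 0 u) := by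
  obtain ⟨L, h0, h0p, h01, E, hE, hu⟩ := carl_u hφ Λ lam hC hτ0 H hK R
  obtain ⟨e, he⟩ : ∃ e, e = exS _ BY L := ⟨_, rfl⟩
  obtain ⟨e', he'⟩ : ∃ e, e = exS _ BY (-L) := ⟨_, rfl⟩
  obtain ⟨C1, hC1, b1⟩ := Mk_coef 1 e' R
  obtain ⟨C2, hC2, b2⟩ := Mk_coef 0 e R
  refine ⟨h0, h0p, h01, C1 * (E * C2), by positivity, fun h hp hh w hw hs => ?_⟩
  have h1 := hh.le.trans h01
  have k1 := hu h hp hh (e * w) (hw.mul e) fun x0 y hy => hs x0 y fun h0 => hy (by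
    change e.1 y * w.1 y = 0
    rw [h0, mul_zero])
  have k2 := b1 h hp h1 (e * w) (hw.mul e)
  have e1 : e' * (e * w) = w := by rw [he, he']; exact exS_mul _ _ _ _
  rw [e1] at k2
  have e2 : PF Bh Bc h (h * L) (e * w) = e * PF Bh Bc h 0 w := by
    rw [he]; exact PF_conj _ _ _ _ _ _
  rw [e2] at k1
  have k3 := b2 h hp h1 _ (WW_PF.sup (a := aa hφ) (b := bb hφ Λ lam) (h := h) (τ := 0) ⟨hp, h1, le_rfl, zero_le_one⟩ hw)
  calc h ^ 2 * Mk h 1 w ≤ h ^ 2 * (C1 * Mk h 1 (e * w)) := by gcongr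
    _ = C1 * (h ^ 2 * Mk h 1 (e * w)) := by ring
    _ ≤ C1 * (E * (C2 * Mk h 0 (PF Bh Bc h 0 w))) := by
      refine mll (k1.trans ?_) hC1
      exact mll k3 hE
    _ = _ := by ring
end
end
section
section
variable {n : ℕ}
lemma fd_A {X F : Fin n → ER} {X' F' : Fin n → Eu n →L[ℝ] ℝ} {x : Eu n} (hX : ∀ j, HasFDerivAt (X j) (X' j) x)
    (hF : ∀ j, HasFDerivAt (F j) (F' j) x) (v : Eu n) :
    fderiv ℝ (fun y => ∑ j, (X j y ^ 4 - 6 * F j y ^ 2 * X j y ^ 2 + F j y ^ 4)) x v =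
      ∑ j, ((4 * X j x ^ 3 - 12 * F j x ^ 2 * X j x) * X' j v + (4 * F j x ^ 3 - 12 * F j x * X j x ^ 2) * F' j v) := by
  have h := HasFDerivAt.fun_sum (u := Finset.univ) fun j _ => ((((hX j).pow 4).sub ((((hF j).pow 2).const_mul 6).mul ((hX j).pow 2))).add ((hF j).pow 4))
  have h2 := h.fderiv
  erw [h2]
  simp only [ContinuousLinearMap.sum_apply, ContinuousLinearMap.add_apply, ContinuousLinearMap.sub_apply, ContinuousLinearMap.smul_apply, smul_eq_mul]
  refine sum_congr rfl fun j _ => ?_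
  simp
  ring
lemma fd_B {X F : Fin n → ER} {X' F' : Fin n → Eu n →L[ℝ] ℝ} {x : Eu n} (hX : ∀ j, HasFDerivAt (X j) (X' j) x)
    (hF : ∀ j, HasFDerivAt (F j) (F' j) x) (v : Eu n) :
    fderiv ℝ (fun y => ∑ j, (4 * F j y * X j y ^ 3 - 4 * F j y ^ 3 * X j y)) x v =
      ∑ j, ((12 * F j x * X j x ^ 2 - 4 * F j x ^ 3) * X' j v + (4 * X j x ^ 3 - 12 * F j x ^ 2 * X j x) * F' j v) := by
  have h := HasFDerivAt.fun_sum (u := Finset.univ) fun j _ => ((((hF j).const_mul 4).mul ((hX j).pow 3)).sub ((((hF j).pow 3).const_mul 4).mul (hX j)))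
  have h2 := h.fderiv
  erw [h2]
  simp only [ContinuousLinearMap.sum_apply, ContinuousLinearMap.add_apply, ContinuousLinearMap.sub_apply, ContinuousLinearMap.smul_apply, smul_eq_mul]
  refine sum_congr rfl fun j _ => ?_
  simp
  ring
lemma zt3 (f ξ : FR) (j l : Fin n) : ((zt f ξ j) ^ 3 * (cJ Je) ^ 3).re =
    (ξ j ^ 3 - 3 * f j ^ 2 * ξ j) * (ξ l ^ 3 - 3 * f l ^ 2 * ξ l) + (3 * f j * ξ j ^ 2 - f j ^ 3) * (3 * f l * ξ l ^ 2 - f l ^ 3) := by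
  simp [zt, pow_succ]
  ring
lemma poisson_eq {φ : ER} (hφ : Smo φ) (x ξ : Eu n) :
    poisson φ x ξ = 16 * kS (fun j => gp j φ x) (fun j l => gp l Br x) (fun j => ξ j) := by
  have hc : ∀ y : Eu n, ∀ j : Fin n, HasFDerivAt (fun z : Eu n => z j) BQ y := fun y j =>
    (BQ).hasFDerivAt
  have hk : ∀ (y : Eu n) (c : FR) (j : Fin n), HasFDerivAt (fun _ : Eu n => c j) (0 : Eu n →L[ℝ] ℝ) y := fun y c j => hasFDerivAt_const _ _
  have hp : ∀ j : Fin n, HasFDerivAt (pdR j φ) (fderiv ℝ Br x) x := fun j => ((BX).diff x).hasFDerivAt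
  have pj : ∀ j k : Fin n, BQ (EuclideanSpace.single k 1) = if j = k then 1 else 0 := fun j k => by
    simp
  unfold poisson kS symA symB
  rw [sum_comm, mul_sum]
  refine sum_congr rfl fun k _ => ?_
  rw [fd_A (hc ξ) (hk ξ fun j => pdR j φ x), fd_B (hk x fun j => ξ j) hp, fd_A (hk x fun j => ξ j) hp, fd_B (hc ξ) (hk ξ fun j => pdR j φ x)]
  simp only [pj, zero_apply, mul_zero, add_zero, zero_add, mul_ite, mul_one, Finset.sum_ite_eq', Finset.mem_univ, if_true]
  rw [mul_sum, mul_sum, sum_mul, ← sum_sub_distrib]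
  refine sum_congr rfl fun j _ => ?_
  have := zt3 (fun j => gp j φ x) (fun j => ξ j) j k
  rw [this]
  change _ = 16 * (fderiv ℝ Br x (EuclideanSpace.single k 1) * _)
  simp only [← gp_eq_pdR]
  ring
lemma pS_re (f ξ : FR) : (pS f ξ).re = ∑ j, Jo := by
  simp only [pS, re_sum]
  refine sum_congr rfl fun j _ => ?_
  simp [zt, pow_succ]; ring
lemma pS_im (f ξ : FR) : (pS f ξ).im = ∑ j, (4 * f j * ξ j ^ 3 - 4 * f j ^ 3 * ξ j) := by
  simp only [pS, Complex.im_sum]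
  refine sum_congr rfl fun j _ => ?_
  simp [zt, pow_succ]; ring
lemma pdR_ev {φ ψ : ER} {x : Eu n} (e : φ =ᶠ[nhds x] ψ) (j : Fin n) : pdR j φ =ᶠ[nhds x] pdR j ψ := by
  filter_upwards [e.eventuallyEq_nhds] with z hz
  rw [pdR, pdR, hz.fderiv_eq]
lemma pd_ev {u v : Eu n → ℂ} {x : Eu n} (e : u =ᶠ[nhds x] v) (j : Fin n) : pd j u =ᶠ[nhds x] pd j v := by
  filter_upwards [e.eventuallyEq_nhds] with z hz
  rw [pd, pd, hz.fderiv_eq]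
lemma poisson_loc {φ ψ : ER} {x : Eu n} (e : φ =ᶠ[nhds x] ψ) (ξ : Eu n) :
    symA φ x ξ = symA ψ x ξ ∧ symB φ x ξ = symB ψ x ξ ∧ poisson φ x ξ = poisson ψ x ξ := by
  have h1 : ∀ j, pdR j φ x = pdR j ψ x := fun j => (pdR_ev e j).eq_of_nhds
  have h2 : ∀ᶠ y in nhds x, ∀ j, pdR j φ y = pdR j ψ y := Filter.eventually_all.2 fun j => pdR_ev e j
  have h3 : (fun y => symA φ y ξ) =ᶠ[nhds x] fun y => symA ψ y ξ := by
    filter_upwards [h2] with y hy; simp only [symA, hy]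
  have h4 : (fun y => symB φ y ξ) =ᶠ[nhds x] fun y => symB ψ y ξ := by
    filter_upwards [h2] with y hy; simp only [symB, hy]
  refine ⟨h3.eq_of_nhds, h4.eq_of_nhds, ?_⟩
  have h5 : (fun ξ' => symA φ x ξ') = fun ξ' => symA ψ x ξ' := by funext z; simp only [symA, h1]
  have h6 : (fun ξ' => symB φ x ξ') = fun ξ' => symB ψ x ξ' := by funext z; simp only [symB, h1]
  unfold poisson
  rw [h3.fderiv_eq, h4.fderiv_eq, h5, h6]
lemma hbr_of {φ ψ : ER} (hψ : Smo ψ) {x : Eu n} (e : φ =ᶠ[nhds x] ψ)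
    (H : ∀ ξ : Eu n, symA φ x ξ = 0 → symB φ x ξ = 0 → 0 ≤ poisson φ x ξ) (ξ : FR) (hp : pS (fun j => gp j ψ x) ξ = 0) :
    0 ≤ kS (fun j => gp j ψ x) (fun j l => gp l (gp j ψ) x) ξ := by
  obtain ⟨h1, h2, h3⟩ := poisson_loc e (WithLp.toLp 2 ξ)
  have h := H (WithLp.toLp 2 ξ)
  rw [h1, h2, h3, poisson_eq hψ] at h
  have ha := pS_re (fun j => gp j ψ x) ξ
  have hb := pS_im (fun j => gp j ψ x) ξ
  rw [hp] at ha hb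
  have := h ha.symm hb.symm
  exact nonneg_of_mul_nonneg_right this (by norm_num)
lemma hgr_of {φ ψ : ER} {x : Eu n} (e : φ =ᶠ[nhds x] ψ) (hψ : Smo ψ) (H : fderiv ℝ φ x ≠ 0) : ∃ j, gp j ψ x ≠ 0 := by
  by_contra hc
  push Not at hc
  refine H ?_
  rw [e.fderiv_eq]
  refine ContinuousLinearMap.ext fun v => ?_
  have hv : v = ∑ j, v j • EuclideanSpace.single j (1 : ℝ) := by
    ext i; simp [Pi.single_apply]
  rw [hv, map_sum]
  simp only [map_smul]
  refine sum_eq_zero fun j _ => ?_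
  have : fderiv ℝ ψ x (EuclideanSpace.single j 1) = 0 := hc j
  rw [this]; simp
/-- global smooth extension of the weight -/
lemma ext_weight {Ω Ω' : Set JH} (hΩ' : IsOpen Ω') (hcomp : IsCompact (closure Ω)) (hsub : closure Ω ⊆ Ω')
    {φ : ER} (hφ : ContDiffOn ℝ (⊤ : ℕ∞) φ Ω') :
    ∃ δ > 0, ∃ ψ : ER, Smo ψ ∧ ∀ x ∈ Metric.thickening (2 * δ) (closure Ω), x ∈ Ω' ∧ φ =ᶠ[nhds x] ψ := by
  obtain ⟨d, d0, hd⟩ := hcomp.exists_cthickening_subset_open hΩ' hsub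
  have dis : Disjoint ((Metric.thickening d (closure Ω))ᶜ) (Metric.cthickening (2 * (d / 3)) (closure Ω)) := by
    rw [Set.disjoint_compl_left_iff_subset]
    exact Metric.cthickening_subset_thickening' d0 (by linarith) _
  obtain ⟨η, h0, h1, -⟩ := exists_contMDiffMap_zero_one_of_isClosed (modelWithCornersSelf ℝ JH) (n := (⊤ : ℕ∞))
    Metric.isOpen_thickening.isClosed_compl Metric.isClosed_cthickening dis
  have ηs : ContDiff ℝ (⊤ : ℕ∞) η := η.contMDiff.contDiff
  refine ⟨d / 3, by positivity, fun x => η x * φ x, ?_, fun x hx => ⟨?_, ?_⟩⟩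
  · refine contDiff_iff_contDiffAt.2 fun x => ?_
    by_cases hx : x ∈ Ω'
    · exact ηs.contDiffAt.mul (hφ.contDiffAt (hΩ'.mem_nhds hx))
    · have hx' : x ∈ (Metric.cthickening d (closure Ω))ᶜ := fun h => hx (hd h)
      refine (contDiffAt_const (c := (0 : ℝ))).congr_of_eventuallyEq ?_
      filter_upwards [Metric.isClosed_cthickening.isOpen_compl.mem_nhds hx'] with y hy
      have : η y = 0 := h0 (fun h => hy (Metric.thickening_subset_cthickening _ _ h))
      rw [this, zero_mul]
  · exact hd (Metric.thickening_subset_cthickening _ _ (Metric.thickening_mono (by linarith) _ hx))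
  · filter_upwards [Metric.isOpen_thickening.mem_nhds hx] with y hy
    have : η y = 1 := h1 (Metric.thickening_subset_cthickening _ _ hy)
    rw [this, one_mul]
end
end
section
section
variable {n : ℕ}
lemma dd_conj {ψ : ER} (hψ : Smo ψ) (b : Sm n) {h : ℝ} (h0 : 0 < h) (j : Fin n) (v : Sm n) :
    dd h j (exS ψ hψ (-h⁻¹) * v) = exS ψ hψ (-h⁻¹) * EF BR b (.X j) h 0 v := by
  have : dd h j (exS ψ hψ (-h⁻¹)) = -(Dd j BR * exS ψ hψ (-h⁻¹)) := by
    change Be • Dd j (exS ψ hψ (-h⁻¹)) = _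
    rw [Dd_exS, smul_smul]
    have : Be * ((-h⁻¹ : ℝ) : ℂ) = -1 := by
      rw [← ofReal_mul, mul_neg, mul_inv_cancel₀ h0.ne']; simp
    rw [this, neg_one_smul]
  simp only [EF, fam_sub, dF_app, mulF_app, dd_mul]
  rw [this]
  simp only [Algebra.smul_def, Complex.ofReal_zero, map_zero]
  ring
lemma pd4_dd (h : ℝ) (j : Fin n) (u : Sm n) (y : Eu n) :
    (dd h j (dd h j (dd h j BF))).1 y = Be ^ 4 * (pd j)^[4] u.1 y := by
  have : dd h j (dd h j (dd h j BF)) = (Be ^ 4) • Dd j (Dd j (Dd j (Dd j u))) := by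
    simp only [dd, LinearMap.smul_apply, map_smul, smul_smul]
    congr 1; ring
  rw [this]; rfl
lemma conj_pt {φ ψ : ER} (hψ : Smo ψ) (b : Sm n) (A : Eu n → Fin n → ℂ) (q : Eu n → ℂ) (W : Sm n) {y : Eu n}
    (e : φ =ᶠ[nhds y] ψ) {h : ℝ} (h0 : 0 < h) :
    (Real.exp (φ y / h) : ℂ) * Be ^ 4 * opL A q BK y =
      (PF BR b h 0 W).1 y - I * Be ^ 3 * ∑ j, A y j * (Bn).1 y
        + Be ^ 4 * q y * W.1 y := by
  obtain ⟨E, hE⟩ : ∃ E, E = exS ψ hψ (-h⁻¹) := ⟨_, rfl⟩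
  have ev : BK =ᶠ[nhds y] (Ke).1 := by
    filter_upwards [e] with z hz
    rw [hz, hE]
    change _ = ((Real.exp (-h⁻¹ * ψ z) : ℝ) : ℂ) * W.1 z
    rw [show -(ψ z) / h = -h⁻¹ * ψ z by field_simp]
  have d1 : ∀ j, pd j BK y = pd j (Ke).1 y := fun j => (pd_ev ev j).eq_of_nhds
  have d4 : ∀ j, (pd j)^[4] BK y = (pd j)^[4] (Ke).1 y := fun j =>
    (pd_ev (pd_ev (pd_ev (pd_ev ev j) j) j) j).eq_of_nhds
  have x1 : ∀ j, Be * pd j (Ke).1 y = E.1 y * (Bn).1 y := fun j => by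
    have := congrArg (fun v : Sm n => v.1 y) (dd_conj hψ b h0 j W)
    rw [← hE] at this
    exact this
  have x4 : ∀ j, Be ^ 4 * (pd j)^[4] (Ke).1 y = E.1 y * (Jv).1 y := fun j => by
    rw [← pd4_dd, hE]
    simp only [dd_conj hψ b h0, pow_succ, pow_zero, one_mul, fam_mul]
    rfl
  have hEy : (Real.exp (φ y / h) : ℂ) * E.1 y = 1 := by
    rw [hE]
    change ((Real.exp (φ y / h) : ℝ) : ℂ) * ((Real.exp (-h⁻¹ * ψ y) : ℝ) : ℂ) = 1
    rw [e.eq_of_nhds, ← ofReal_mul, ← exp_add, show ψ y / h + -h⁻¹ * ψ y = 0 by field_simp; ring]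
    simp
  have hP : (PF BR b h 0 W).1 y = ∑ j, (Jv).1 y := by
    rw [PF, fam_sum]
    simp
  unfold opL
  simp only [d1, d4]
  rw [ev.eq_of_nhds, hP]
  have c1 : Be ^ 4 * ∑ j, (pd j)^[4] (Ke).1 y = E.1 y * ∑ j, (Jv).1 y := by
    rw [mul_sum, mul_sum]; exact sum_congr rfl fun j _ => x4 j
  have c2 : Be * ∑ j, A y j * pd j (Ke).1 y = E.1 y * ∑ j, A y j * (Bn).1 y := by
    rw [mul_sum, mul_sum]
    refine sum_congr rfl fun j _ => ?_
    rw [mul_left_comm, x1]; ring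
  have c3 : (Ke).1 y = E.1 y * W.1 y := rfl
  rw [c3]
  generalize (∑ j, (pd j)^[4] (Ke).1 y) = S4 at *
  generalize (∑ j, A y j * pd j (Ke).1 y) = S1 at *
  generalize (∑ j, (Jv).1 y) = T4 at *
  generalize (∑ j, A y j * (Bn).1 y) = T1 at *
  generalize (Real.exp (φ y / h) : ℂ) = x at *
  linear_combination x * c1 - I * Be ^ 3 * x * c2 + (T4 - I * Be ^ 3 * T1 + Be ^ 4 * q y * W.1 y) * hEy
/-- bound of the lower order terms -/
lemma low_pt {ψ : ER} (hψ : Smo ψ) (b : Sm n) (R M Mq : ℝ) (hM : 0 ≤ M) (hMq : 0 ≤ Mq) :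
    ∃ c ≥ 0, ∀ (A : Fin n → ℂ) (q : ℂ) (W : Sm n) (y : Eu n) (h : ℝ), ‖A‖ ≤ M → ‖q‖ ≤ Mq → ‖y‖ ≤ R → 0 < h → h ≤ 1 →
      ‖I * Be ^ 3 * (∑ j, A j * (Bn).1 y) - Be ^ 4 * q * W.1 y‖ ^ 2 ≤ c * h ^ 6 * G h 1 W y := by
  obtain ⟨N, hN, hb⟩ := cbFam (fun j => (Dd j BR).1) (fun j => (smo _).continuous) R
  refine ⟨JF ^ 2, by positivity, fun A q W y h hA hq hy h0 h1 => ?_⟩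
  obtain ⟨g, hg⟩ : ∃ g, g = √(G h 1 W y) := ⟨_, rfl⟩
  have G0 := G_nonneg h 1 W y
  have g0 : 0 ≤ g := hg ▸ sqrt_nonneg _
  have w0 : ‖W.1 y‖ ≤ g := by
    rw [hg]; exact le_sqrt_of_sq_le (G_mono h (Nat.zero_le 1) W y)
  have w1 : ∀ j, ‖(dd h j W).1 y‖ ≤ g := fun j => by
    rw [hg]; exact le_sqrt_of_sq_le (G_dd h 0 j W y)
  have x1 : ∀ j, ‖(Bn).1 y‖ ≤ (1 + N) * g := fun j => by
    have : (Bn).1 y = (dd h j W).1 y - (Dd j BR).1 y * W.1 y := by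
      have : EF BR b (.X j) h 0 W = dd h j W - Dd j BR * W := by
        simp [EF, fam_sub, dF_app, mulF_app]
      rw [this]; rfl
    rw [this]
    calc _ ≤ ‖(dd h j W).1 y‖ + ‖(Dd j BR).1 y * W.1 y‖ := norm_sub_le _ _
      _ ≤ g + N * g := by
        rw [norm_mul]
        exact add_le_add (w1 j) (mul_le_mul (hb j y hy) w0 (norm_nonneg _) hN)
      _ = _ := by ring
  have s1 : ‖∑ j, A j * (Bn).1 y‖ ≤ n * (M * (1 + N)) * g := by
    refine (norm_sum_le_of_le (n := fun _ => M * ((1 + N) * g)) _ fun j _ => ?_).trans (le_of_eq ?_)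
    · rw [norm_mul]
      exact mul_le_mul ((norm_le_pi_norm A j).trans hA) (x1 j) (norm_nonneg _) hM
    · simp; ring
  have nh : ‖Be‖ = h := by rw [norm_real, norm_of_nonneg h0.le]
  have key : ‖I * Be ^ 3 * (∑ j, A j * (Bn).1 y) - Be ^ 4 * q * W.1 y‖ ≤
      h ^ 3 * (JF * g) := by
    refine (norm_sub_le _ _).trans ?_
    rw [norm_mul, norm_mul, norm_mul, norm_mul, norm_pow, norm_pow, nh, norm_I, one_mul]
    have e1 : h ^ 4 * ‖q‖ * ‖W.1 y‖ ≤ h ^ 3 * Mq * g := by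
      have : h ^ 4 ≤ h ^ 3 := pow_le_pow_of_le_one h0.le h1 (by norm_num)
      gcongr
    have e2 := mll s1 (pow_nonneg h0.le 3)
    calc _ ≤ _ := add_le_add e2 e1
      _ = _ := by ring
  calc _ ≤ (h ^ 3 * (JF * g)) ^ 2 := pow_le_pow_left₀ (norm_nonneg _) key 2
    _ = JF ^ 2 * h ^ 6 * g ^ 2 := by ring
    _ = _ := by rw [hg, sq_sqrt G0]
end
end
section
section
variable {n : ℕ}
lemma X_loc {a b : Sm n} {h τ : ℝ} (j : Fin n) {v : Sm n} {y : Eu n} (e : v.1 =ᶠ[nhds y] 0) :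
    (EX h τ v).1 =ᶠ[nhds y] 0 := by
  have h1 := dd_loc h j (v := (0 : Sm n)) e
  rw [map_zero] at h1
  filter_upwards [e, h1] with z hz hz1
  have : (EX h τ v).1 z = (dd h j v).1 z - ((Dd j a + Kf • Dd j b).1 z) * v.1 z := rfl
  rw [this, hz, hz1]
  simp
lemma PF_loc {a b : Sm n} {h τ : ℝ} {v : Sm n} {y : Eu n} (e : v.1 =ᶠ[nhds y] 0) : (PF a b h τ v).1 y = 0 := by
  have : (PF a b h τ v).1 y = ∑ j, (EX h τ (EX h τ (EX h τ (EX h τ v)))).1 y := by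
    simp only [PF, fam_sum, pow_succ, pow_zero, one_mul, fam_mul]
    simp
  rw [this]
  exact sum_eq_zero fun j _ => (X_loc j (X_loc j (X_loc j (X_loc j e)))).eq_of_nhds
lemma lhs_le {Ω : Set JH} {R h : ℝ} (W : Sm n) (hW : Sup R W) : l2sq Ω W.1 + h ^ 2 * gradsq Ω W.1 ≤ Mk h 1 W := by
  have e : h ^ 2 * gradsq Ω W.1 = ∫ y in Ω, ∑ j, G h 0 (dd h j W) y := by
    unfold gradsq
    rw [← integral_const_mul]
    refine integral_congr_ae (of_forall fun y => ?_)
    change h ^ 2 * ∑ j, ‖pd j W.1 y‖ ^ 2 = ∑ j, ‖Be * pd j W.1 y‖ ^ 2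
    rw [mul_sum]
    refine sum_congr rfl fun j _ => ?_
    rw [norm_mul, mul_pow, norm_real, norm_eq_abs, sq_abs]
  have i1 : Integrable (fun y => ∑ j, G h 0 (dd h j W) y) := integrable_finsetSum _ fun j _ => (hW.dd h j).intG h 0
  rw [e]
  change (∫ y in Ω, G h 0 W y) + _ ≤ _
  rw [← integral_add (hW.intG h 0).integrableOn i1.integrableOn]
  exact setIntegral_le_integral (hW.intG h 1) (of_forall fun y => G_nonneg h 1 W y)
lemma alg_fin {E p f c h m l : ℝ} (h0 : 0 < h) (h1 : h ≤ 1) (hE : 0 ≤ E) (hc : 0 ≤ c) (hs : h * (4 * E * c + 1) ≤ 1) (hm : 0 ≤ m) (f0 : 0 ≤ f)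
    (a1 : h ^ 2 * m ≤ E * p) (a2 : p ≤ 2 * f + 2 * (c * h ^ 6 * m)) (a3 : l ≤ m) : h ^ 2 * l ≤ (4 * E + 1) * f := by
  have b1 : E * p ≤ E * (2 * f + 2 * (c * h ^ 6 * m)) := mll a2 hE
  have b2 : h ^ 4 ≤ h := by
    have := pow_le_pow_of_le_one h0.le h1 (show 1 ≤ 4 by norm_num); rwa [pow_one] at this
  have b3 : 4 * E * c * h ^ 4 ≤ 1 := by
    have := mll b2 (show 0 ≤ 4 * E * c by positivity); linarith
  have b4 : 4 * E * c * h ^ 4 * (h ^ 2 * m) ≤ 1 * (h ^ 2 * m) := mlr b3 (by positivity)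
  have b5 : h ^ 2 * l ≤ h ^ 2 * m := mll a3 (by positivity)
  have b6 : E * (2 * f + 2 * (c * h ^ 6 * m)) = 2 * E * f + (4 * E * c * h ^ 4 * (h ^ 2 * m)) / 2 := by ring
  linarith
lemma p_le {Ω : Set JH} (hΩ : IsOpen Ω) {R c h : ℝ} (hc : 0 ≤ c * h ^ 6) {A : Eu n → Fin n → ℂ} {q : Eu n → ℂ} (hA : ContinuousOn A Ω) (hq : Measurable q)
    {P W : Sm n} {X : Fin n → Sm n} (hP : Sup R P) (hW : Sup R W) (hP0 : ∀ y, y ∉ Ω → P.1 y = 0) {F : Eu n → ℂ}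
    (hF : ∀ y ∈ Ω, F y = P.1 y - I * Be ^ 3 * ∑ j, A y j * (X j).1 y + Be ^ 4 * q y * W.1 y)
    (hr : ∀ y ∈ Ω, ‖I * Be ^ 3 * (∑ j, A y j * (X j).1 y) - Be ^ 4 * q y * W.1 y‖ ^ 2 ≤ c * h ^ 6 * G h 1 W y) :
    Mk h 0 P ≤ 2 * l2sq Ω F + 2 * (c * h ^ 6 * Mk h 1 W) := by
  have iP : Integrable (fun y => ‖P.1 y‖ ^ 2) := hP.intG 0 0
  have iG : Integrable (fun y => c * h ^ 6 * G h 1 W y) := (hW.intG h 1).const_mul _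
  have sq2 : ∀ z w : ℂ, ‖z + w‖ ^ 2 ≤ 2 * ‖z‖ ^ 2 + 2 * ‖w‖ ^ 2 := fun z w => by
    have h1 := norm_add_le z w
    have h2 := pow_le_pow_left₀ (norm_nonneg _) h1 2
    nlinarith [sq_nonneg (‖z‖ - ‖w‖)]
  have mF : AEStronglyMeasurable F (volume.restrict Ω) := by
    have m1 : AEStronglyMeasurable (fun y => P.1 y - I * Be ^ 3 * ∑ j, A y j * (X j).1 y + Be ^ 4 * q y * W.1 y) (volume.restrict Ω) := by
      refine (AEStronglyMeasurable.sub ?_ ?_).add ?_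
      · exact (smo P).continuous.aestronglyMeasurable
      · refine AEStronglyMeasurable.const_mul ?_ _
        refine ContinuousOn.aestronglyMeasurable ?_ hΩ.measurableSet
        exact continuousOn_finsetSum _ fun j _ => ((continuous_apply j).comp_continuousOn hA).mul (smo (X j)).continuous.continuousOn
      · exact ((hq.const_mul _).aestronglyMeasurable).mul (smo W).continuous.aestronglyMeasurable
    exact m1.congr ((ae_restrict_iff' hΩ.measurableSet).2 (of_forall fun y hy => (hF y hy).symm))
  have iF : IntegrableOn (fun y => ‖F y‖ ^ 2) Ω := by
    refine Integrable.mono' (((iP.const_mul 2).add (iG.const_mul 2)).integrableOn) (mF.norm.pow 2) ?_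
    refine (ae_restrict_iff' hΩ.measurableSet).2 (of_forall fun y hy => ?_)
    rw [norm_of_nonneg (by positivity)]
    have e : F y = P.1 y + -Bz := by rw [hF y hy]; ring
    have h1 := sq2 (P.1 y) (-Bz)
    rw [← e, norm_neg] at h1
    exact h1.trans (add_le_add le_rfl (mll (hr y hy) (by norm_num)))
  have e1 : Mk h 0 P = ∫ y in Ω, ‖P.1 y‖ ^ 2 := by
    refine (setIntegral_eq_integral_of_forall_compl_eq_zero fun y hy => ?_).symm
    change ‖P.1 y‖ ^ 2 = 0
    rw [hP0 y hy]; simp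
  have e2 : ∫ y in Ω, c * h ^ 6 * G h 1 W y ≤ c * h ^ 6 * Mk h 1 W := by
    unfold Mk
    rw [← integral_const_mul]
    exact setIntegral_le_integral iG (of_forall fun y => mul_nonneg hc (G_nonneg _ _ _ _))
  rw [e1]
  have k : ∫ y in Ω, ‖P.1 y‖ ^ 2 ≤ ∫ y in Ω, (2 * ‖F y‖ ^ 2 + 2 * (c * h ^ 6 * G h 1 W y)) := by
    refine setIntegral_mono_on iP.integrableOn ((iF.const_mul 2).add (iG.const_mul 2).integrableOn) hΩ.measurableSet fun y hy => ?_
    have e : P.1 y = F y + Bz := by rw [hF y hy]; ring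
    have h1 := sq2 (F y) Bz
    rw [← e] at h1
    exact h1.trans (add_le_add le_rfl (mll (hr y hy) (by norm_num)))
  rw [integral_add (iF.const_mul 2) (iG.const_mul 2).integrableOn, integral_const_mul, integral_const_mul] at k
  exact k.trans (add_le_add le_rfl (mll e2 (by norm_num)))
end
end
end

/-- Proposition 2.3: general semiclassical Carleman estimate. -/
theorem carleman_general_weight
    (n : ℕ) (hn : 2 ≤ n)
    (Ω Ω' : Set (EuclideanSpace ℝ (Fin n)))
    (hΩ : IsOpen Ω) (hΩ' : IsOpen Ω')
    (hcomp : IsCompact (closure Ω)) (hsub : closure Ω ⊆ Ω')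
    (φ : EuclideanSpace ℝ (Fin n) → ℝ)
    (hφ : ContDiffOn ℝ (⊤ : ℕ∞) φ Ω')
    (hφgrad : ∀ x ∈ Ω', fderiv ℝ φ x ≠ 0)
    (hbracket : ∀ x ∈ Ω', ∀ ξ : EuclideanSpace ℝ (Fin n),
      symA φ x ξ = 0 → symB φ x ξ = 0 → 0 ≤ poisson φ x ξ)
    (A : EuclideanSpace ℝ (Fin n) → Fin n → ℂ) (q : EuclideanSpace ℝ (Fin n) → ℂ)
    (hA : BddLipOn Ω A) (hq : BddMeasOn Ω q) :
    ∃ C > (0 : ℝ), ∃ h₀ : ℝ, 0 < h₀ ∧ h₀ < 1 ∧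
      ∀ h : ℝ, 0 < h → h < h₀ →
        ∀ w : EuclideanSpace ℝ (Fin n) → ℂ, IsCcInfty Ω w →
          h ^ 2 * (l2sq Ω w + h ^ 2 * gradsq Ω w) ≤
            C * l2sq Ω (fun x =>
              (Real.exp (φ x / h) : ℂ) * (h : ℂ) ^ 4 *
                opL A q (fun y => (Real.exp (-(φ y) / h) : ℂ) * w y) x) := by
  obtain ⟨δ, δ0, ψ, hψ, hψe⟩ := ext_weight hΩ' hcomp hsub hφ
  obtain ⟨K, hK⟩ : ∃ K, K = Metric.cthickening δ (closure Ω) := ⟨_, rfl⟩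
  have Kc : IsCompact K := hK ▸ hcomp.cthickening
  have near : ∀ x ∈ K, ∀ y, ‖y - x‖ ≤ δ / 2 → y ∈ Ω' ∧ φ =ᶠ[nhds y] ψ := fun x hx y hy => by
    refine hψe y ?_
    have hx2 : x ∈ Metric.thickening (3 / 2 * δ) (closure Ω) :=
      Metric.cthickening_subset_thickening' (by positivity) (by linarith) _ (hK ▸ hx)
    obtain ⟨z, hz, hxz⟩ := Metric.mem_thickening_iff.1 hx2
    refine Metric.mem_thickening_iff.2 ⟨z, hz, ?_⟩
    have := dist_triangle y x z
    rw [dist_eq_norm y x] at this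
    linarith
  obtain ⟨Λ, lam, C, hC, τ0, hτ0, H⟩ := AFF ψ hψ K Kc (δ / 2) (by positivity)
    (fun x hx y hy => hgr_of (near x hx y hy).2 hψ (hφgrad y (near x hx y hy).1))
    (fun x hx y hy ξ hp => hbr_of hψ (near x hx y hy).2 (hbracket y (near x hx y hy).1) ξ hp)
  obtain ⟨R, hR⟩ := Kc.isBounded.exists_norm_le
  have ΩK : ∀ x ∈ Ω, x ∈ K := fun x hx => hK ▸ Metric.self_subset_cthickening _ (subset_closure hx)
  obtain ⟨h0, h0p, h01, E, hE, hcar⟩ := carl_w hψ Λ lam hC hτ0 H hR R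
  obtain ⟨⟨M, hM⟩, Kl, hLip⟩ := hA
  obtain ⟨qm, Mq, hMq⟩ := hq
  obtain ⟨c, hc, hlow⟩ := low_pt hψ (bb hψ Λ lam) R (max M 0) (max Mq 0) (le_max_right _ _) (le_max_right _ _)
  refine ⟨4 * E + 1, by positivity, min (1 / 2) (min h0 (min (δ ^ 2) (1 / (4 * E * c + 1)))), by positivity,
    (min_le_left _ _).trans_lt (by norm_num), fun h hp hh w hw => ?_⟩
  simp only [lt_min_iff] at hh
  obtain ⟨k1, k2, k3, k4⟩ := hh
  rw [lt_div_iff₀ (by positivity)] at k4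
  have h1 : h ≤ 1 := by linarith
  obtain ⟨ws, -, wt⟩ := hw
  obtain ⟨W, hWw⟩ : ∃ W : Sm n, W.1 = w := ⟨mkS w ws, rfl⟩
  have wΩ : ∀ y, W.1 y ≠ 0 → y ∈ Ω := fun y hy => wt (subset_tsupport _ (hWw ▸ hy))
  have hW : Sup R W := fun y hy => by
    by_contra hne
    exact absurd (hR y (ΩK y (wΩ y hne))) (not_le.2 hy)
  have hsd : √h ≤ δ := Real.sqrt_le_iff.2 ⟨δ0.le, k3.le⟩
  have a1 := hcar h hp k2 W hW fun x0 y hy hxy => by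
    rw [hK]
    refine Metric.mem_cthickening_of_dist_le x0 y δ _ (subset_closure (wΩ y hy)) ?_
    rw [dist_comm, dist_eq_norm]; exact hxy.trans hsd
  have sP : Sup R (PF (aa hψ) (bb hψ Λ lam) h 0 W) :=
    WW_PF.sup (a := aa hψ) (b := bb hψ Λ lam) (h := h) (τ := 0) ⟨hp, h1, le_rfl, zero_le_one⟩ hW
  have a2 := p_le (c := c) (h := h) hΩ (by positivity) hLip.continuousOn qm sP hW
    (fun y hy => PF_loc (by rw [hWw]; exact notMem_tsupport_iff_eventuallyEq.1 fun h => hy (wt h)))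
    (X := fun j => EF (aa hψ) (bb hψ Λ lam) (.X j) h 0 W)
    (fun y hy => conj_pt hψ (bb hψ Λ lam) A q W (hψe y (Metric.self_subset_thickening (by positivity) _ (subset_closure hy))).2 hp)
    (fun y hy => hlow (A y) (q y) W y h ((hM y hy).trans (le_max_left _ _)) ((hMq y hy).trans (le_max_left _ _)) (hR y (ΩK y hy)) hp h1)
  rw [← hWw]
  exact alg_fin hp h1 hE hc k4.le (Mk_nonneg _ _ _) (integral_nonneg fun _ => by positivity) a1 a2 (lhs_le W hW)
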